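/- Let n ≥ 3 be an integer and let q ∈ ℝ[y₁, …, y_n] be a quadratic polynomial satisfying the irrationality condition, whose homogeneous part is nondegenerate and indefinite. Then the set q(ℤⁿ) = { q(y) : y ∈ ℤⁿ } is dense in ℝ. -/

import Mathlib

namespace IrratQuad

/-- The squared Euclidean norm on `ℝ³`. -/
def nsq (x : Fin 3 → ℝ) : ℝ := x 0 ^ 2 + x 1 ^ 2 + x 2 ^ 2

/-- The symmetric bilinear form polarising `2 x₀ x₂ - x₁²`. -/
def bil {R : Type*} [CommRing R] (x y : Fin 3 → R) : R := x 0 * y 2 + x 2 * y 0 - x 1 * y 1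

/-- The cross product composed with the matrix of `bil`. -/
def dia {R : Type*} [CommRing R] (x y : Fin 3 → R) : Fin 3 → R :=
  ![x 0 * y 1 - x 1 * y 0, x 0 * y 2 - x 2 * y 0, x 1 * y 2 - x 2 * y 1]

/-- The one-parameter unipotent group preserving `bil`. -/
noncomputable def shear (t : ℝ) (x : Fin 3 → ℝ) : Fin 3 → ℝ :=
  ![x 0 + t * x 1 + t ^ 2 / 2 * x 2, x 1 + t * x 2, x 2]

/-- The inclusion of integer vectors into real vectors. -/
def toR {n : ℕ} (m : Fin n → ℤ) : Fin n → ℝ := fun i => (m i : ℝ)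

@[simp] lemma toR_apply {n : ℕ} (m : Fin n → ℤ) (i : Fin n) : toR m i = (m i : ℝ) := rfl

lemma toR_injective {n : ℕ} : Function.Injective (toR (n := n)) := fun m m' h => by
  ext i; have := congrFun h i; simpa using this

lemma toR_ne_zero {n : ℕ} {m : Fin n → ℤ} (hm : m ≠ 0) : toR m ≠ 0 := fun h =>
  hm (toR_injective (by rw [h]; ext i; simp))

lemma nsq_nonneg (x : Fin 3 → ℝ) : 0 ≤ nsq x := by unfold nsq; positivity

lemma nsq_smul (c : ℝ) (x : Fin 3 → ℝ) : nsq (c • x) = c ^ 2 * nsq x := by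
  simp [nsq]; ring

lemma nsq_pos {x : Fin 3 → ℝ} (hx : x ≠ 0) : 0 < nsq x := by
  rcases (nsq_nonneg x).lt_or_eq with h | h
  · exact h
  · exfalso; apply hx
    unfold nsq at h
    have h0 : x 0 = 0 := by nlinarith [sq_nonneg (x 0), sq_nonneg (x 1), sq_nonneg (x 2)]
    have h1 : x 1 = 0 := by nlinarith [sq_nonneg (x 0), sq_nonneg (x 1), sq_nonneg (x 2)]
    have h2 : x 2 = 0 := by nlinarith [sq_nonneg (x 0), sq_nonneg (x 1), sq_nonneg (x 2)]
    ext i; fin_cases i <;> simp [h0, h1, h2]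

lemma nsq_dia_le (x y : Fin 3 → ℝ) : nsq (dia x y) ≤ nsq x * nsq y := by
  simp [nsq, dia]
  nlinarith [sq_nonneg (x 0 * y 0 + x 1 * y 1 + x 2 * y 2)]

lemma bil_sq_le (x y : Fin 3 → ℝ) : bil x y ^ 2 ≤ nsq x * nsq y := by
  simp [nsq, bil]
  nlinarith [sq_nonneg (x 0 * y 1 + x 1 * y 2), sq_nonneg (x 0 * y 0 - x 2 * y 2),
    sq_nonneg (x 1 * y 0 + x 2 * y 1)]

lemma shear_smul (t c : ℝ) (x : Fin 3 → ℝ) : shear t (c • x) = c • shear t x := by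
  ext i; fin_cases i <;> simp [shear] <;> ring

lemma dia_shear (t : ℝ) (x y : Fin 3 → ℝ) : dia (shear t x) (shear t y) = shear t (dia x y) := by
  ext i; fin_cases i <;> simp [shear, dia] <;> ring

lemma bil_shear (t : ℝ) (x y : Fin 3 → ℝ) : bil (shear t x) (shear t y) = bil x y := by
  simp [shear, bil]; ring

lemma toR_dia (m m' : Fin 3 → ℤ) : toR (dia m m') = dia (toR m) (toR m') := by
  ext i; fin_cases i <;> simp [toR, dia]

lemma toR_bil (m m' : Fin 3 → ℤ) : ((bil m m' : ℤ) : ℝ) = bil (toR m) (toR m') := by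
  simp [toR, bil]

lemma bil_dia_left {R : Type*} [CommRing R] (x y : Fin 3 → R) : bil x (dia y x) = 0 := by
  simp [bil, dia]; ring

lemma parallel_of_dia_eq_zero {x y : Fin 3 → ℝ} (hx : x ≠ 0) (h : dia x y = 0) :
    ∃ c : ℝ, y = c • x := by
  have h0 := congrFun h 0
  have h1 := congrFun h 1
  have h2 := congrFun h 2
  simp [dia] at h0 h1 h2
  have hN := (nsq_pos hx).ne'
  refine ⟨(x 0 * y 0 + x 1 * y 1 + x 2 * y 2) / nsq x, ?_⟩
  ext i
  simp only [Pi.smul_apply, smul_eq_mul]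
  rw [div_mul_eq_mul_div, eq_div_iff hN]
  unfold nsq
  fin_cases i
  · simp; linear_combination (-x 1) * h0 - x 2 * h1
  · simp; linear_combination (x 0) * h0 - x 2 * h2
  · simp; linear_combination (x 0) * h1 + x 1 * h2

lemma dia_eq_zero_of_parallel {x y z : Fin 3 → ℝ} (hx : x ≠ 0) (h : dia x y = 0)
    (h' : dia x z = 0) : dia y z = 0 := by
  obtain ⟨c, rfl⟩ := parallel_of_dia_eq_zero hx h
  obtain ⟨d, rfl⟩ := parallel_of_dia_eq_zero hx h'
  ext i; fin_cases i <;> simp [dia] <;> ring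

lemma dia_dia_of_bil {v x y : Fin 3 → ℝ} (hx : bil v x = 0) (hy : bil v y = 0) :
    dia v (dia x y) = 0 := by
  simp only [bil] at hx hy
  ext i; fin_cases i <;> simp [dia]
  · linear_combination x 0 * hy - y 0 * hx
  · linear_combination x 1 * hy - y 1 * hx
  · linear_combination x 2 * hy - y 2 * hx

lemma continuous_nsq_shear (x : Fin 3 → ℝ) : Continuous fun t => nsq (shear t x) := by
  simp only [nsq, shear, Matrix.cons_val_zero, Matrix.cons_val_one, Matrix.cons_val]
  fun_prop

lemma exists_one_le_nsq_shear {x : Fin 3 → ℝ} (h : x 1 ≠ 0 ∨ x 2 ≠ 0) :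
    ∃ t, 0 ≤ t ∧ 1 ≤ nsq (shear t x) := by
  by_cases h2 : x 2 = 0
  · have h1 : x 1 ≠ 0 := h.resolve_right (by simpa using h2)
    refine ⟨(1 + |x 0|) / |x 1|, by positivity, ?_⟩
    have hp : 0 < |x 1| := abs_pos.mpr h1
    have key : 1 ≤ |x 0 + (1 + |x 0|) / |x 1| * x 1| := by
      have e : |(1 + |x 0|) / |x 1| * x 1| = 1 + |x 0| := by
        rw [abs_mul, abs_div, abs_abs, abs_of_nonneg (by positivity : (0:ℝ) ≤ 1 + |x 0|)]
        field_simp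
      have := abs_sub_abs_le_abs_sub ((1 + |x 0|) / |x 1| * x 1) (-x 0)
      rw [e, abs_neg, sub_neg_eq_add, add_comm (_ * _)] at this
      linarith
    have k2 := one_le_sq_iff_one_le_abs _ |>.mpr key
    simp only [nsq, shear, h2, Matrix.cons_val_zero, Matrix.cons_val_one, Matrix.cons_val]
    rw [mul_zero, add_zero]
    nlinarith [sq_nonneg (x 1)]
  · refine ⟨(1 + |x 1|) / |x 2|, by positivity, ?_⟩
    have hp : 0 < |x 2| := abs_pos.mpr h2
    have key : 1 ≤ |x 1 + (1 + |x 1|) / |x 2| * x 2| := by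
      have e : |(1 + |x 1|) / |x 2| * x 2| = 1 + |x 1| := by
        rw [abs_mul, abs_div, abs_abs, abs_of_nonneg (by positivity : (0:ℝ) ≤ 1 + |x 1|)]
        field_simp
      have := abs_sub_abs_le_abs_sub ((1 + |x 1|) / |x 2| * x 2) (-x 1)
      rw [e, abs_neg, sub_neg_eq_add, add_comm (_ * _)] at this
      linarith
    have k2 := one_le_sq_iff_one_le_abs _ |>.mpr key
    simp only [nsq, shear, Matrix.cons_val_zero, Matrix.cons_val_one, Matrix.cons_val]
    nlinarith [sq_nonneg (x 2), sq_nonneg (x 0 + (1 + |x 1|) / |x 2| * x 1 + ((1 + |x 1|) / |x 2|) ^ 2 / 2 * x 2)]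

end IrratQuad

namespace IrratQuad

lemma quad_coeff_bound {a b c M : ℝ} (h0 : |a| ≤ M) (h1 : |a + b / 2 + c / 4| ≤ M)
    (h2 : |a + b + c| ≤ M) : |b| ≤ 8 * M ∧ |c| ≤ 8 * M := by
  rw [abs_le] at h0 h1 h2
  constructor <;> rw [abs_le] <;> constructor <;> linarith [h0.1, h0.2, h1.1, h1.2, h2.1, h2.2]

lemma quad_near_end {b p q r t : ℝ} (hb : 0 < b)
    (h : ∀ s ∈ Set.Icc 0 b, |p + s * q + s ^ 2 * r| ≤ 1) (ht : t ∈ Set.Icc (b * (1 - 1 / 288)) b) :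
    |(p + t * q + t ^ 2 * r) ^ 2 - (p + b * q + b ^ 2 * r) ^ 2| ≤ 1 / 6 := by
  have h0 := h 0 ⟨le_rfl, hb.le⟩
  have h1 := h (b / 2) ⟨by linarith, by linarith⟩
  have h2 := h b ⟨hb.le, le_rfl⟩
  obtain ⟨hq, hr⟩ := quad_coeff_bound (a := p) (b := b * q) (c := b ^ 2 * r) (M := 1)
    (by simpa using h0) (by convert h1 using 2; ring) h2
  obtain ⟨w, hw⟩ : ∃ w, t = b * w := ⟨t / b, by field_simp⟩
  subst hw
  have hw1 : 1 - 1 / 288 ≤ w := le_of_mul_le_mul_left ht.1 hb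
  have hw2 : w ≤ 1 := by
    have : b * w ≤ b * 1 := by linarith [ht.2]
    exact le_of_mul_le_mul_left this hb
  have ht1 := h (b * w) ⟨by nlinarith, ht.2⟩
  have e : (p + b * w * q + (b * w) ^ 2 * r) - (p + b * q + b ^ 2 * r)
      = (w - 1) * (b * q + (w + 1) * (b ^ 2 * r)) := by ring
  have hd : |(p + b * w * q + (b * w) ^ 2 * r) - (p + b * q + b ^ 2 * r)| ≤ 1 / 12 := by
    rw [e, abs_mul]
    have a1 : |w - 1| ≤ 1 / 288 := by rw [abs_le]; constructor <;> linarith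
    have a2 : |b * q + (w + 1) * (b ^ 2 * r)| ≤ 24 := by
      refine (abs_add_le _ _).trans ?_
      rw [abs_mul (w + 1)]
      have : |w + 1| ≤ 2 := by rw [abs_le]; constructor <;> linarith
      nlinarith [abs_nonneg (w + 1), abs_nonneg (b ^ 2 * r)]
    nlinarith [abs_nonneg (w - 1), abs_nonneg (b * q + (w + 1) * (b ^ 2 * r))]
  have hs : |(p + b * w * q + (b * w) ^ 2 * r) + (p + b * q + b ^ 2 * r)| ≤ 2 :=
    (abs_add_le _ _).trans (by linarith)
  rw [sq_sub_sq, abs_mul]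
  nlinarith [abs_nonneg ((p + b * w * q + (b * w) ^ 2 * r) - (p + b * q + b ^ 2 * r)),
    abs_nonneg ((p + b * w * q + (b * w) ^ 2 * r) + (p + b * q + b ^ 2 * r))]

lemma quad_extend {b p q r t M : ℝ} (hb : 0 < b)
    (h : ∀ s ∈ Set.Icc (b * (1 - 1 / 288)) b, |p + s * q + s ^ 2 * r| ≤ M)
    (ht : t ∈ Set.Icc 0 b) :
    |p + t * q + t ^ 2 * r| ≤ 1000000 * M := by
  have h0 := h b ⟨by nlinarith, le_rfl⟩
  have h1 := h (b * (1 - 1 / 576)) ⟨by nlinarith, by nlinarith⟩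
  have h2 := h (b * (1 - 1 / 288)) ⟨by nlinarith, by nlinarith⟩
  have hM : 0 ≤ M := (abs_nonneg _).trans h0
  obtain ⟨hq, hr⟩ := quad_coeff_bound (a := p + b * q + b ^ 2 * r)
    (b := -(b / 288) * (q + 2 * b * r)) (c := (b / 288) ^ 2 * r) (M := M)
    h0 (by convert h1 using 2; ring) (by convert h2 using 2; ring)
  obtain ⟨w, hw⟩ : ∃ w, t = b * (1 - w / 288) := ⟨288 * (1 - t / b), by field_simp; ring⟩
  subst hw
  have hw1 : w ≤ 288 := by
    have := ht.1
    have : 0 ≤ 1 - w / 288 := by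
      by_contra hc
      push Not at hc
      nlinarith
    linarith
  have hw0 : 0 ≤ w := by
    have h3 : b * (1 - w / 288) ≤ b * 1 := by linarith [ht.2]
    have := le_of_mul_le_mul_left h3 hb
    linarith
  have e : p + b * (1 - w / 288) * q + (b * (1 - w / 288)) ^ 2 * r
      = (p + b * q + b ^ 2 * r) + w * (-(b / 288) * (q + 2 * b * r)) + w ^ 2 * ((b / 288) ^ 2 * r) := by
    ring
  rw [e]
  refine (abs_add_three _ _ _).trans ?_
  rw [abs_mul w, abs_mul (w ^ 2), abs_of_nonneg hw0, abs_of_nonneg (sq_nonneg w)]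
  have : w ^ 2 ≤ 288 ^ 2 := by nlinarith
  nlinarith [abs_nonneg (-(b / 288) * (q + 2 * b * r)), abs_nonneg ((b / 288) ^ 2 * r)]

lemma nsq_shear_eq (t : ℝ) (x : Fin 3 → ℝ) : nsq (shear t x) =
    (x 0 + t * x 1 + t ^ 2 * (x 2 / 2)) ^ 2 + (x 1 + t * x 2 + t ^ 2 * 0) ^ 2
      + (x 2 + t * 0 + t ^ 2 * 0) ^ 2 := by
  simp [nsq, shear]; ring

lemma nsq_shear_near_end {b t : ℝ} {x : Fin 3 → ℝ} (hb : 0 < b)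
    (h : ∀ s ∈ Set.Icc 0 b, nsq (shear s x) ≤ 1) (h1 : 1 ≤ nsq (shear b x))
    (ht : t ∈ Set.Icc (b * (1 - 1 / 288)) b) : 1 / 2 ≤ nsq (shear t x) := by
  have k0 := quad_near_end (p := x 0) (q := x 1) (r := x 2 / 2) hb (fun s hs => by
    have := h s hs
    rw [nsq_shear_eq] at this
    rw [← sq_le_one_iff_abs_le_one]
    nlinarith [sq_nonneg (x 1 + s * x 2 + s ^ 2 * 0), sq_nonneg (x 2 + s * 0 + s ^ 2 * 0)]) ht
  have k1 := quad_near_end (p := x 1) (q := x 2) (r := 0) hb (fun s hs => by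
    have := h s hs
    rw [nsq_shear_eq] at this
    rw [← sq_le_one_iff_abs_le_one]
    nlinarith [sq_nonneg (x 0 + s * x 1 + s ^ 2 * (x 2 / 2)), sq_nonneg (x 2 + s * 0 + s ^ 2 * 0)]) ht
  have k2 := quad_near_end (p := x 2) (q := 0) (r := 0) hb (fun s hs => by
    have := h s hs
    rw [nsq_shear_eq] at this
    rw [← sq_le_one_iff_abs_le_one]
    nlinarith [sq_nonneg (x 0 + s * x 1 + s ^ 2 * (x 2 / 2)),
      sq_nonneg (x 1 + s * x 2 + s ^ 2 * 0)]) ht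
  rw [nsq_shear_eq] at h1 ⊢
  linarith [(abs_le.mp k0).1, (abs_le.mp k1).1, (abs_le.mp k2).1]

/-- The threshold for small vectors in the nondivergence argument. -/
noncomputable def eta : ℝ := (1 / 2000000) ^ 2

lemma nsq_shear_extend {b t : ℝ} {x : Fin 3 → ℝ} (hb : 0 < b)
    (h : ∀ s ∈ Set.Icc (b * (1 - 1 / 288)) b, nsq (shear s x) ≤ eta)
    (ht : t ∈ Set.Icc 0 b) : nsq (shear t x) < 1 := by
  have k0 := quad_extend (p := x 0) (q := x 1) (r := x 2 / 2) (M := 1 / 2000000) hb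
    (fun s hs => abs_le_of_sq_le_sq (by
      have := h s hs
      rw [nsq_shear_eq, eta] at this
      nlinarith [sq_nonneg (x 1 + s * x 2 + s ^ 2 * 0), sq_nonneg (x 2 + s * 0 + s ^ 2 * 0)])
      (by norm_num)) ht
  have k1 := quad_extend (p := x 1) (q := x 2) (r := 0) (M := 1 / 2000000) hb
    (fun s hs => abs_le_of_sq_le_sq (by
      have := h s hs
      rw [nsq_shear_eq, eta] at this
      nlinarith [sq_nonneg (x 0 + s * x 1 + s ^ 2 * (x 2 / 2)),
        sq_nonneg (x 2 + s * 0 + s ^ 2 * 0)])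
      (by norm_num)) ht
  have k2 := quad_extend (p := x 2) (q := 0) (r := 0) (M := 1 / 2000000) hb
    (fun s hs => abs_le_of_sq_le_sq (by
      have := h s hs
      rw [nsq_shear_eq, eta] at this
      nlinarith [sq_nonneg (x 0 + s * x 1 + s ^ 2 * (x 2 / 2)),
        sq_nonneg (x 1 + s * x 2 + s ^ 2 * 0)])
      (by norm_num)) ht
  rw [nsq_shear_eq]
  have l0 := sq_le_sq' (abs_le.mp k0).1 (abs_le.mp k0).2
  have l1 := sq_le_sq' (abs_le.mp k1).1 (abs_le.mp k1).2
  have l2 := sq_le_sq' (abs_le.mp k2).1 (abs_le.mp k2).2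
  norm_num at l0 l1 l2
  norm_num
  linarith

end IrratQuad

namespace IrratQuad

/-- Two linear automorphisms of `ℝ³` that are adjoint-inverse to each other for `bil`. -/
structure DualPair (g g' : (Fin 3 → ℝ) →ₗ[ℝ] (Fin 3 → ℝ)) : Prop where
  dia_left : ∀ x y, dia (g x) (g y) = g' (dia x y)
  dia_right : ∀ x y, dia (g' x) (g' y) = g (dia x y)
  bil_eq : ∀ x y, bil (g x) (g' y) = bil x y

lemma bil_comm {R : Type*} [CommRing R] (x y : Fin 3 → R) : bil x y = bil y x := by
  simp [bil]; ring

lemma DualPair.symm {g g' : (Fin 3 → ℝ) →ₗ[ℝ] (Fin 3 → ℝ)} (h : DualPair g g') :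
    DualPair g' g :=
  ⟨h.dia_right, h.dia_left, fun x y => by rw [bil_comm, h.bil_eq, bil_comm]⟩

lemma exists_nsq_toR_min (s : Set (Fin 3 → ℤ)) (hs : s.Nonempty) :
    ∃ m ∈ s, ∀ m' ∈ s, nsq (toR m) ≤ nsq (toR m') := by
  let f : (Fin 3 → ℤ) → ℕ := fun m => (m 0 ^ 2 + m 1 ^ 2 + m 2 ^ 2).toNat
  have hf : ∀ m, ((f m : ℕ) : ℝ) = nsq (toR m) := fun m => by
    have : ((f m : ℕ) : ℤ) = m 0 ^ 2 + m 1 ^ 2 + m 2 ^ 2 := Int.toNat_of_nonneg (by positivity)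
    have h2 : (((f m : ℕ) : ℤ) : ℝ) = _ := congrArg (Int.cast : ℤ → ℝ) this
    push_cast at h2
    rw [h2]; simp [nsq]
  obtain ⟨m, hm, hmin⟩ := WellFounded.has_min (measure f).wf s hs
  refine ⟨m, hm, fun m' hm' => ?_⟩
  rw [← hf, ← hf]
  exact_mod_cast not_lt.mp (hmin m' hm')

section
variable {g g' : (Fin 3 → ℝ) →ₗ[ℝ] (Fin 3 → ℝ)}

lemma DualPair.injective (h : DualPair g g') {x : Fin 3 → ℝ} (hx : x ≠ 0) : g x ≠ 0 := by
  intro h0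
  apply hx
  have : ∀ y, bil x y = 0 := fun y => by rw [← h.bil_eq, h0]; simp [bil]
  have a0 := this ![0, 0, 1]
  have a1 := this ![0, 1, 0]
  have a2 := this ![1, 0, 0]
  simp [bil] at a0 a1 a2
  ext i; fin_cases i <;> simp [*]

lemma DualPair.one_le_sq_of_parallel {b : ℝ} {v m : Fin 3 → ℤ} {k : ℝ}
    (hv : ∀ s ∈ Set.Icc 0 b, nsq (shear s (g (toR v))) ≤ 1)
    (hg : ∀ m : Fin 3 → ℤ, m ≠ 0 → ∃ t ∈ Set.Icc 0 b, 1 ≤ nsq (shear t (g (toR m))))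
    (hm : m ≠ 0) (hk : toR m = k • toR v) : 1 ≤ k ^ 2 := by
  obtain ⟨t, ht, h1⟩ := hg m hm
  rw [hk, map_smul, shear_smul, nsq_smul] at h1
  nlinarith [hv t ht, sq_nonneg k]

lemma DualPair.exists_large_perp (h : DualPair g g') {b : ℝ} (hb : 0 < b) {v : Fin 3 → ℤ}
    (hv0 : v ≠ 0)
    (hv : ∀ s ∈ Set.Icc 0 b, nsq (shear s (g (toR v))) ≤ 1)
    (hvb : 1 ≤ nsq (shear b (g (toR v))))
    (hg : ∀ m : Fin 3 → ℤ, m ≠ 0 → ∃ t ∈ Set.Icc 0 b, 1 ≤ nsq (shear t (g (toR m))))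
    (hg' : ∀ m : Fin 3 → ℤ, m ≠ 0 → ∃ t ∈ Set.Icc 0 b, 1 ≤ nsq (shear t (g' (toR m)))) :
    ∃ t ∈ Set.Icc (b * (1 - 1 / 288)) b, ∀ w : Fin 3 → ℤ, w ≠ 0 → bil v w = 0 →
      eta ≤ nsq (shear t (g' (toR w))) := by
  by_contra! hcon
  have hvR := toR_ne_zero hv0
  have hpair : ∀ w w' : Fin 3 → ℤ, bil v w = 0 → bil v w' = 0 → dia (toR w) (toR w') ≠ 0 →
      ∀ t ∈ Set.Icc (b * (1 - 1 / 288)) b, nsq (shear t (g' (toR w))) < eta →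
      nsq (shear t (g' (toR w'))) < eta → False := by
    intro w w' hw hw' hne t ht h1 h2
    have hpar : dia (toR v) (dia (toR w) (toR w')) = 0 :=
      dia_dia_of_bil (by rw [← toR_bil, hw]; simp) (by rw [← toR_bil, hw']; simp)
    obtain ⟨k, hk⟩ := parallel_of_dia_eq_zero hvR hpar
    have hk2 : 1 ≤ k ^ 2 := DualPair.one_le_sq_of_parallel (m := dia w w') hv hg
      (fun h0 => hne (by rw [← toR_dia, h0]; ext i; simp)) (by rw [toR_dia, hk])
    have h3 := nsq_dia_le (shear t (g' (toR w))) (shear t (g' (toR w')))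
    rw [dia_shear, h.dia_right, hk, map_smul, shear_smul, nsq_smul] at h3
    have h4 := nsq_shear_near_end hb hv hvb ht
    have e1 : eta ≤ 1 / 4 := by unfold eta; norm_num
    have e2 : 0 ≤ eta := by unfold eta; norm_num
    nlinarith [nsq_nonneg (shear t (g' (toR w))), nsq_nonneg (shear t (g' (toR w')))]
  have hbmem : b ∈ Set.Icc (b * (1 - 1 / 288)) b := ⟨by nlinarith, le_rfl⟩
  obtain ⟨w0, hw0, hw0v, hw0b⟩ := hcon b hbmem
  have hw0R := toR_ne_zero hw0
  let U : Set ℝ := {t | ∃ w : Fin 3 → ℤ, w ≠ 0 ∧ bil v w = 0 ∧ dia (toR w0) (toR w) = 0 ∧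
    nsq (shear t (g' (toR w))) < eta}
  let V : Set ℝ := {t | ∃ w : Fin 3 → ℤ, w ≠ 0 ∧ bil v w = 0 ∧ dia (toR w0) (toR w) ≠ 0 ∧
    nsq (shear t (g' (toR w))) < eta}
  have hUo : IsOpen U := by
    have : U = ⋃ w : {w : Fin 3 → ℤ // w ≠ 0 ∧ bil v w = 0 ∧ dia (toR w0) (toR w) = 0},
        {t | nsq (shear t (g' (toR w.1))) < eta} := by
      ext t; simp [U, and_assoc]
    rw [this]
    exact isOpen_iUnion fun w => isOpen_lt (continuous_nsq_shear _) continuous_const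
  have hVo : IsOpen V := by
    have : V = ⋃ w : {w : Fin 3 → ℤ // w ≠ 0 ∧ bil v w = 0 ∧ dia (toR w0) (toR w) ≠ 0},
        {t | nsq (shear t (g' (toR w.1))) < eta} := by
      ext t; simp [V, and_assoc]
    rw [this]
    exact isOpen_iUnion fun w => isOpen_lt (continuous_nsq_shear _) continuous_const
  have hall : ∀ t ∈ Set.Icc (b * (1 - 1 / 288)) b, t ∈ U := by
    by_contra! hx
    obtain ⟨t, ht, htU⟩ := hx
    have hcov : Set.Icc (b * (1 - 1 / 288)) b ⊆ U ∪ V := fun s hs => by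
      obtain ⟨w, h1, h2, h3⟩ := hcon s hs
      by_cases h4 : dia (toR w0) (toR w) = 0
      · exact Or.inl ⟨w, h1, h2, h4, h3⟩
      · exact Or.inr ⟨w, h1, h2, h4, h3⟩
    obtain ⟨s, hs, ⟨w, h1, h2, h3, h4⟩, ⟨w', h1', h2', h3', h4'⟩⟩ :=
      isPreconnected_Icc U V hUo hVo hcov
        ⟨b, hbmem, w0, hw0, hw0v, by ext i; fin_cases i <;> simp [dia] <;> ring, hw0b⟩
        ⟨t, ht, (hcov ht).resolve_left htU⟩
    refine hpair w w' h2 h2' (fun h0 => h3' ?_) s hs h4 h4'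
    obtain ⟨c, hc⟩ := parallel_of_dia_eq_zero hw0R h3
    refine dia_eq_zero_of_parallel (toR_ne_zero h1) ?_ h0
    rw [hc]; ext i; fin_cases i <;> simp [dia] <;> ring
  obtain ⟨w1, ⟨hw1, hw1v, hw1p⟩, hmin⟩ := exists_nsq_toR_min
    {w | w ≠ 0 ∧ bil v w = 0 ∧ dia (toR w0) (toR w) = 0}
    ⟨w0, hw0, hw0v, by ext i; fin_cases i <;> simp [dia] <;> ring⟩
  have hw1R := toR_ne_zero hw1
  obtain ⟨t, ht, ht1⟩ := hg' w1 hw1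
  refine absurd ht1 (not_le.mpr (nsq_shear_extend hb (fun s hs => ?_) ht))
  obtain ⟨w, h1, h2, h3, h4⟩ := hall s hs
  obtain ⟨c, hc⟩ := parallel_of_dia_eq_zero hw1R (dia_eq_zero_of_parallel hw0R hw1p h3)
  have hm := hmin w ⟨h1, h2, h3⟩
  rw [hc, nsq_smul] at hm
  have hc2 : 1 ≤ c ^ 2 := by
    have := nsq_pos hw1R
    by_contra! hlt
    nlinarith
  rw [hc, map_smul, shear_smul, nsq_smul] at h4
  nlinarith [nsq_nonneg (shear s (g' (toR w1)))]

lemma DualPair.exists_all_large (h : DualPair g g') {b : ℝ} (hb : 0 < b) {v : Fin 3 → ℤ}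
    (hv0 : v ≠ 0)
    (hv : ∀ s ∈ Set.Icc 0 b, nsq (shear s (g (toR v))) ≤ 1)
    (hvb : 1 ≤ nsq (shear b (g (toR v))))
    (hg : ∀ m : Fin 3 → ℤ, m ≠ 0 → ∃ t ∈ Set.Icc 0 b, 1 ≤ nsq (shear t (g (toR m))))
    (hg' : ∀ m : Fin 3 → ℤ, m ≠ 0 → ∃ t ∈ Set.Icc 0 b, 1 ≤ nsq (shear t (g' (toR m)))) :
    ∃ t, 0 ≤ t ∧ ∀ m : Fin 3 → ℤ, m ≠ 0 →
      eta ≤ nsq (shear t (g (toR m))) ∧ eta ≤ nsq (shear t (g' (toR m))) := by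
  obtain ⟨t, ht, hperp⟩ := h.exists_large_perp hb hv0 hv hvb hg hg'
  have ht0 : 0 ≤ t := le_trans (by nlinarith) ht.1
  have hvt := hv t ⟨ht0, ht.2⟩
  have hvR := toR_ne_zero hv0
  have e1 : eta ≤ 1 / 4 := by unfold eta; norm_num
  refine ⟨t, ht0, fun m hm => ⟨?_, ?_⟩⟩
  · by_cases hpar : dia (toR v) (toR m) = 0
    · obtain ⟨k, hk⟩ := parallel_of_dia_eq_zero hvR hpar
      have hk2 := DualPair.one_le_sq_of_parallel hv hg hm hk
      have h4 := nsq_shear_near_end hb hv hvb ht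
      rw [hk, map_smul, shear_smul, nsq_smul]
      nlinarith
    · have h0 : dia m v ≠ 0 := fun h0 => hpar (by
        have : dia (toR m) (toR v) = 0 := by rw [← toR_dia, h0]; ext i; simp
        have e : dia (toR v) (toR m) = - dia (toR m) (toR v) := by
          ext i; fin_cases i <;> simp [dia] <;> ring
        rw [e, this, neg_zero])
      have h1 := hperp (dia m v) h0 (bil_dia_left v m)
      rw [toR_dia, ← h.dia_left, ← dia_shear] at h1
      have h2 := nsq_dia_le (shear t (g (toR m))) (shear t (g (toR v)))
      nlinarith [nsq_nonneg (shear t (g (toR m)))]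
  · by_cases hz : bil v m = 0
    · exact hperp m hm hz
    · have h1 := bil_sq_le (shear t (g (toR v))) (shear t (g' (toR m)))
      rw [bil_shear, h.bil_eq, ← toR_bil] at h1
      have h2 : (1 : ℝ) ≤ ((bil v m : ℤ) : ℝ) ^ 2 := by
        have : 1 ≤ (bil v m) ^ 2 := by
          have := sq_pos_of_ne_zero hz
          omega
        exact_mod_cast this
      nlinarith [nsq_nonneg (shear t (g' (toR m)))]

lemma DualPair.finite_lt_one (h : DualPair g g') :
    {m : Fin 3 → ℤ | nsq (g (toR m)) < 1}.Finite := by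
  obtain ⟨N, hN⟩ : ∃ N : ℕ, nsq (g' ![0, 0, 1]) ≤ N ∧ nsq (g' ![0, 1, 0]) ≤ N ∧
      nsq (g' ![1, 0, 0]) ≤ N := by
    obtain ⟨N, hN⟩ := exists_nat_ge (nsq (g' ![0, 0, 1]) + nsq (g' ![0, 1, 0]) + nsq (g' ![1, 0, 0]))
    exact ⟨N, by linarith [nsq_nonneg (g' ![0, 1, 0]), nsq_nonneg (g' ![1, 0, 0])],
      by linarith [nsq_nonneg (g' ![0, 0, 1]), nsq_nonneg (g' ![1, 0, 0])],
      by linarith [nsq_nonneg (g' ![0, 1, 0]), nsq_nonneg (g' ![0, 0, 1])]⟩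
  refine (Set.Finite.pi' (t := fun _ : Fin 3 => Set.Icc (-(N : ℤ)) N)
    (fun _ => Set.finite_Icc _ _)).subset fun m hm => ?_
  have key : ∀ (y : Fin 3 → ℝ) (k : ℤ), nsq (g' y) ≤ N → bil (toR m) y ^ 2 = (k : ℝ) ^ 2 →
      k ∈ Set.Icc (-(N : ℤ)) N := by
    intro y k hy hk
    have h1 := bil_sq_le (g (toR m)) (g' y)
    rw [h.bil_eq, hk] at h1
    have h2 : (k : ℝ) ^ 2 ≤ N := by
      have hm' : nsq (g (toR m)) < 1 := hm
      nlinarith [nsq_nonneg (g' y)]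
    have h3 : k ^ 2 ≤ (N : ℤ) := by exact_mod_cast h2
    constructor <;> nlinarith
  intro i
  fin_cases i
  · exact key _ _ hN.1 (by simp [bil])
  · exact key _ _ hN.2.1 (by simp [bil])
  · exact key _ _ hN.2.2 (by simp [bil])

lemma exists_first_time (x : Fin 3 → ℝ) (hx : ∃ t, 0 ≤ t ∧ 1 ≤ nsq (shear t x)) :
    ∃ τ, 0 ≤ τ ∧ 1 ≤ nsq (shear τ x) ∧ ∀ s ∈ Set.Icc 0 τ, nsq (shear s x) ≤ 1 ∨ τ = 0 := by
  have hc : IsClosed {t | 0 ≤ t ∧ 1 ≤ nsq (shear t x)} :=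
    isClosed_Ici.inter (isClosed_le continuous_const (continuous_nsq_shear x))
  have hbdd : BddBelow {t | 0 ≤ t ∧ 1 ≤ nsq (shear t x)} := ⟨0, fun t ht => ht.1⟩
  obtain ⟨h0, h1⟩ := hc.csInf_mem hx hbdd
  set τ := sInf {t | 0 ≤ t ∧ 1 ≤ nsq (shear t x)} with hτ
  refine ⟨τ, h0, h1, fun s hs => ?_⟩
  by_cases hτ0 : τ = 0
  · exact Or.inr hτ0
  left
  have hlt : ∀ s ∈ Set.Ico 0 τ, nsq (shear s x) ≤ 1 := fun s hs => by
    by_contra! hcon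
    exact absurd (csInf_le hbdd ⟨hs.1, hcon.le⟩) (not_le.mpr hs.2)
  have hpos : 0 < τ := lt_of_le_of_ne h0 (Ne.symm hτ0)
  have hcl : IsClosed {s | nsq (shear s x) ≤ 1} :=
    isClosed_le (continuous_nsq_shear x) continuous_const
  have := hcl.closure_subset_iff.mpr (fun s hs => hlt s hs : Set.Ico 0 τ ⊆ _)
  rw [closure_Ico hpos.ne] at this
  exact this hs

/-- Nondivergence: if no vector fixed by the shear group is short, some shear pushes the lattice
and its dual away from the cusp. -/
theorem DualPair.nondivergence (h : DualPair g g')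
    (hg : ∀ m : Fin 3 → ℤ, m ≠ 0 → g (toR m) 1 = 0 → g (toR m) 2 = 0 → 1 ≤ nsq (g (toR m)))
    (hg' : ∀ m : Fin 3 → ℤ, m ≠ 0 → g' (toR m) 1 = 0 → g' (toR m) 2 = 0 →
      1 ≤ nsq (g' (toR m))) :
    ∃ t, 0 ≤ t ∧ ∀ m : Fin 3 → ℤ, m ≠ 0 →
      eta ≤ nsq (shear t (g (toR m))) ∧ eta ≤ nsq (shear t (g' (toR m))) := by
  let G : Bool → (Fin 3 → ℝ) →ₗ[ℝ] (Fin 3 → ℝ) := fun c => if c then g else g'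
  have hzero : ∀ x, shear 0 x = x := fun x => by ext i; fin_cases i <;> simp [shear]
  have hex : ∀ (o : Bool × (Fin 3 → ℤ)), ∃ τ, o.2 ≠ 0 → 0 ≤ τ ∧
      1 ≤ nsq (shear τ (G o.1 (toR o.2))) ∧
      ∀ s ∈ Set.Icc 0 τ, nsq (shear s (G o.1 (toR o.2))) ≤ 1 ∨ τ = 0 := by
    rintro ⟨c, m⟩
    by_cases hm : m = 0
    · exact ⟨0, fun h => absurd hm h⟩
    obtain ⟨τ, hτ⟩ := exists_first_time (G c (toR m)) (by
      by_cases hf : G c (toR m) 1 = 0 ∧ G c (toR m) 2 = 0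
      · refine ⟨0, le_rfl, ?_⟩
        rw [hzero]
        cases c
        · exact hg' m hm (by simpa [G] using hf.1) (by simpa [G] using hf.2)
        · exact hg m hm (by simpa [G] using hf.1) (by simpa [G] using hf.2)
      · exact exists_one_le_nsq_shear (by tauto))
    exact ⟨τ, fun _ => hτ⟩
  choose τ hτ using hex
  let F : Set (Bool × (Fin 3 → ℤ)) := {o | o.2 ≠ 0 ∧ nsq (G o.1 (toR o.2)) < 1}
  have hF : F.Finite := by
    refine ((h.finite_lt_one.image (Prod.mk true)).union
      (h.symm.finite_lt_one.image (Prod.mk false))).subset ?_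
    rintro ⟨c, m⟩ ⟨_, hlt⟩
    cases c
    · exact Or.inr ⟨m, by simpa [G] using hlt, rfl⟩
    · exact Or.inl ⟨m, by simpa [G] using hlt, rfl⟩
  have hout : ∀ o : Bool × (Fin 3 → ℤ), o.2 ≠ 0 → o ∉ F → 1 ≤ nsq (shear 0 (G o.1 (toR o.2))) :=
    fun o ho hn => by
      rw [hzero]; by_contra! hlt; exact hn ⟨ho, hlt⟩
  have e1 : eta ≤ 1 := by unfold eta; norm_num
  rcases F.eq_empty_or_nonempty with hE | hne
  · refine ⟨0, le_rfl, fun m hm => ⟨e1.trans ?_, e1.trans ?_⟩⟩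
    · simpa [G] using hout (true, m) hm (by simp [hE])
    · simpa [G] using hout (false, m) hm (by simp [hE])
  · obtain ⟨⟨c, v⟩, ho, hmax⟩ := Set.exists_max_image F τ hF hne
    obtain ⟨h0, h1, h2⟩ := hτ (c, v) ho.1
    set b := τ (c, v) with hb
    have hbne : b ≠ 0 := fun hb0 => by
      rw [hb0, hzero] at h1
      exact absurd h1 (not_le.mpr ho.2)
    have hbpos : 0 < b := lt_of_le_of_ne h0 (Ne.symm hbne)
    have hv : ∀ s ∈ Set.Icc 0 b, nsq (shear s (G c (toR v))) ≤ 1 :=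
      fun s hs => (h2 s hs).resolve_right hbne
    have hreach : ∀ (c' : Bool) (m : Fin 3 → ℤ), m ≠ 0 →
        ∃ t ∈ Set.Icc 0 b, 1 ≤ nsq (shear t (G c' (toR m))) := by
      intro c' m hm
      by_cases hF' : (c', m) ∈ F
      · obtain ⟨k0, k1, -⟩ := hτ (c', m) hm
        exact ⟨_, ⟨k0, hmax _ hF'⟩, k1⟩
      · exact ⟨0, ⟨le_rfl, h0⟩, hout (c', m) hm hF'⟩
    cases c
    · obtain ⟨t, ht, hh⟩ := h.symm.exists_all_large hbpos ho.1 (by simpa [G] using hv)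
        (by simpa [G] using h1) (by simpa [G] using hreach false) (by simpa [G] using hreach true)
      exact ⟨t, ht, fun m hm => (hh m hm).symm⟩
    · exact h.exists_all_large hbpos ho.1 (by simpa [G] using hv)
        (by simpa [G] using h1) (by simpa [G] using hreach true) (by simpa [G] using hreach false)

end

end IrratQuad

namespace IrratQuad

open Matrix

/-- The cross product, in coordinates. -/
def crs {R : Type*} [CommRing R] (x y : Fin 3 → R) : Fin 3 → R :=
  ![x 1 * y 2 - x 2 * y 1, x 2 * y 0 - x 0 * y 2, x 0 * y 1 - x 1 * y 0]

lemma nsq_dia (x y : Fin 3 → ℝ) : nsq (dia x y) = nsq (crs x y) := by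
  simp [nsq, dia, crs]; ring

lemma exists_int_reduce (x y : Fin 3 → ℝ) (hx : x ≠ 0) :
    ∃ k : ℤ, nsq x * nsq (y - (k : ℝ) • x) ≤ nsq (crs x y) + nsq x ^ 2 / 4 := by
  have hN := nsq_pos hx
  set d := x 0 * y 0 + x 1 * y 1 + x 2 * y 2 with hd
  refine ⟨round (d / nsq x), ?_⟩
  have h1 := abs_sub_round (d / nsq x)
  set k : ℝ := (round (d / nsq x) : ℝ)
  have h2 : |d - k * nsq x| ≤ nsq x / 2 := by
    have : d - k * nsq x = (d / nsq x - k) * nsq x := by field_simp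
    rw [this, abs_mul, abs_of_pos hN]
    nlinarith
  have h3 : nsq x * nsq (y - k • x) = nsq (crs x y) + (d - k * nsq x) ^ 2 := by
    simp [nsq, crs, hd]; ring
  rw [h3]
  have := sq_le_sq' (abs_le.mp h2).1 (abs_le.mp h2).2
  nlinarith

lemma nsq_crs_crs (x y z : Fin 3 → ℝ) :
    nsq (crs (crs x y) (crs x z)) = (crs x y 0 * z 0 + crs x y 1 * z 1 + crs x y 2 * z 2) ^ 2 * nsq x := by
  simp [nsq, crs]; ring

/-- The matrix with the three given columns. -/
def ofCols {R : Type*} (x y z : Fin 3 → R) : Matrix (Fin 3) (Fin 3) R :=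
  (Matrix.of ![x, y, z])ᵀ

lemma det_ofCols {R : Type*} [CommRing R] (x y z : Fin 3 → R) :
    (ofCols x y z).det = crs x y 0 * z 0 + crs x y 1 * z 1 + crs x y 2 * z 2 := by
  simp [ofCols, Matrix.det_fin_three, crs]; ring

/-- A reduction theory statement: a unimodular lattice in `ℝ³` without short vectors or
short wedge products has a basis of bounded vectors. -/
theorem exists_reduced_basis (g : (Fin 3 → ℝ) →ₗ[ℝ] (Fin 3 → ℝ)) {δ : ℝ} (hδ : 0 < δ)
    (hdet : ∀ x y z, (ofCols (g x) (g y) (g z)).det = (ofCols x y z).det)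
    (h1 : ∀ m : Fin 3 → ℤ, m ≠ 0 → δ ≤ nsq (g (toR m)))
    (h2 : ∀ m m' : Fin 3 → ℤ, crs m m' ≠ 0 → δ ≤ nsq (crs (g (toR m)) (g (toR m')))) :
    ∃ x y z : Fin 3 → ℤ, (ofCols x y z).det = 1 ∧ nsq (g (toR x)) ≤ 2 ∧
      nsq (g (toR y)) ≤ (3 / δ + 1) / δ + 1 ∧ nsq (g (toR z)) ≤ (3 / δ + 1) / δ + 1 := by
  let T := {p : (Fin 3 → ℤ) × (Fin 3 → ℤ) × (Fin 3 → ℤ) // (ofCols p.1 p.2.1 p.2.2).det = 1}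
  let Φ : T → ℝ := fun p => nsq (g (toR p.1.1)) * nsq (crs (g (toR p.1.1)) (g (toR p.1.2.1)))
  have hx0 : ∀ x y z : Fin 3 → ℤ, (ofCols x y z).det = 1 → x ≠ 0 := by
    rintro x y z h rfl
    simp [det_ofCols, crs] at h
  have hxy0 : ∀ x y z : Fin 3 → ℤ, (ofCols x y z).det = 1 → crs x y ≠ 0 := by
    intro x y z h h0
    rw [det_ofCols, h0] at h; simp at h
  have hΦ : ∀ p, δ * δ ≤ Φ p := fun p =>
    mul_le_mul (h1 _ (hx0 _ _ _ p.2)) (h2 _ _ (hxy0 _ _ _ p.2)) hδ.le (nsq_nonneg _)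
  have : Nonempty T := ⟨⟨(![1, 0, 0], ![0, 1, 0], ![0, 0, 1]), by simp [det_ofCols, crs]⟩⟩
  have hinf : δ * δ ≤ ⨅ p, Φ p := le_ciInf hΦ
  have hbdd : BddBelow (Set.range Φ) := ⟨δ * δ, by rintro _ ⟨p, rfl⟩; exact hΦ p⟩
  obtain ⟨⟨⟨x, y, z⟩, hp⟩, hlt⟩ := exists_lt_of_ciInf_lt
    (show (⨅ p, Φ p) < 4 / 3 * ⨅ p, Φ p by nlinarith [mul_pos hδ hδ])
  have hmin : ∀ p', Φ ⟨(x, y, z), hp⟩ ≤ 4 / 3 * Φ p' := fun p' =>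
    hlt.le.trans (by linarith [ciInf_le hbdd p'])
  simp only at hp
  set X := g (toR x) with hX
  set Y := g (toR y) with hY
  set Z := g (toR z) with hZ
  set A := nsq X with hA
  set B := nsq (crs X Y) with hB
  have hAδ : δ ≤ A := h1 _ (hx0 _ _ _ hp)
  have hBδ : δ ≤ B := h2 _ _ (hxy0 _ _ _ hp)
  have hXne : X ≠ 0 := fun h0 => by
    rw [hA, h0] at hAδ; simp [nsq] at hAδ; linarith
  have hCne : crs X Y ≠ 0 := fun h0 => by
    rw [hB, h0] at hBδ; simp [nsq] at hBδ; linarith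
  have hgsub : ∀ (u v : Fin 3 → ℤ) (k : ℤ), g (toR (u - k • v)) = g (toR u) - (k : ℝ) • g (toR v) := by
    intro u v k
    rw [← map_smul, ← map_sub]; congr 1; ext i; simp
  have hgneg : ∀ u : Fin 3 → ℤ, g (toR (-u)) = - g (toR u) := by
    intro u; rw [← map_neg]; congr 1; ext i; simp
  have hdetR : (ofCols X Y Z).det = 1 := by
    rw [hdet]
    have : (ofCols (toR x) (toR y) (toR z)).det = (((ofCols x y z).det : ℤ) : ℝ) := by
      simp [det_ofCols, crs]
    rw [this, hp]; simp
  have hk1 : ∀ k : ℤ, 3 / 4 * A ≤ nsq (Y - (k : ℝ) • X) := by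
    intro k
    have hd : (ofCols (y - k • x) (-x) z).det = 1 := by
      rw [← hp]; simp [det_ofCols, crs]; ring
    have := hmin ⟨(y - k • x, -x, z), hd⟩
    simp only [Φ] at this
    rw [hgsub, hgneg] at this
    have e : nsq (crs (Y - (k : ℝ) • X) (-X)) = B := by
      simp [hB, nsq, crs]; ring
    rw [← hX, ← hY, ← hA, ← hB, e] at this
    have hBp : 0 < B := by linarith
    nlinarith
  have hk2 : ∀ k : ℤ, 3 / 4 * B ≤ nsq (crs X Z - (k : ℝ) • crs X Y) := by
    intro k
    have hd : (ofCols x (z - k • y) (-y)).det = 1 := by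
      rw [← hp]; simp [det_ofCols, crs]; ring
    have := hmin ⟨(x, z - k • y, -y), hd⟩
    simp only [Φ] at this
    rw [hgsub] at this
    have e : crs X (Z - (k : ℝ) • Y) = crs X Z - (k : ℝ) • crs X Y := by
      ext i; fin_cases i <;> simp [crs] <;> ring
    rw [← hX, ← hY, ← hZ, ← hA, ← hB, e] at this
    have hAp : 0 < A := by linarith
    nlinarith
  obtain ⟨k, hk⟩ := exists_int_reduce X Y hXne
  obtain ⟨l, hl⟩ := exists_int_reduce (crs X Y) (crs X Z) hCne
  rw [nsq_crs_crs, ← det_ofCols, hdetR, one_pow, one_mul, ← hA, ← hB] at hl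
  rw [← hA, ← hB] at hk
  have hAp : 0 < A := by linarith
  have hBp : 0 < B := by linarith
  have hBA : A ^ 2 / 2 ≤ B := by nlinarith [hk1 k]
  have hAB : B ^ 2 / 2 ≤ A := by nlinarith [hk2 l]
  have hA2 : A ≤ 2 := by
    by_contra! h
    have hAB' : A < B := by nlinarith
    nlinarith
  have hB2 : B ≤ 2 := by
    by_contra! h
    nlinarith
  have hdiv : ∀ {u v : ℝ}, 0 ≤ v → δ ≤ u → ∀ c, u * v ≤ c → v ≤ c / δ := by
    intro u v hv hu c hc
    rw [le_div_iff₀ hδ]; nlinarith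
  obtain ⟨j, hj⟩ := exists_int_reduce X (Z - (l : ℝ) • Y) hXne
  have eZ : crs X (Z - (l : ℝ) • Y) = crs X Z - (l : ℝ) • crs X Y := by
    ext i; fin_cases i <;> simp [crs] <;> ring
  rw [eZ, ← hA] at hj
  have hl' : nsq (crs X Z - (l : ℝ) • crs X Y) ≤ 3 / δ := 
    hdiv (nsq_nonneg _) hBδ _ (hl.trans (by nlinarith))
  have h3δ : 0 ≤ 3 / δ := by positivity
  have hδ2 : 1 ≤ 2 / δ := by rw [le_div_iff₀ hδ]; linarith
  refine ⟨x, y - k • x, z - l • y - j • x, ?_, hA2, ?_, ?_⟩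
  · rw [← hp]; simp [det_ofCols, crs]; ring
  · rw [hgsub, ← hX, ← hY]
    have : nsq (Y - (k : ℝ) • X) ≤ 3 / δ :=
      hdiv (nsq_nonneg _) hAδ _ (hk.trans (by nlinarith))
    refine this.trans ?_
    have : 3 / δ ≤ (3 / δ + 1) / δ + 1 := by
      have e : (3 / δ + 1) / δ + 1 = 3 / (δ * δ) + 1 / δ + 1 := by field_simp
      rw [e]
      have e2 : 3 / δ = 3 * (1 / δ) := by ring
      have e3 : 3 / (δ * δ) = 3 * (1 / δ) ^ 2 := by field_simp
      rw [e2, e3]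
      nlinarith [sq_nonneg (1 / δ - 1 / 3), sq_nonneg (1 / δ)]
    exact this
  · rw [hgsub, hgsub, ← hX, ← hY, ← hZ]
    have : nsq (Z - (l : ℝ) • Y - (j : ℝ) • X) ≤ (3 / δ + 1) / δ :=
      hdiv (nsq_nonneg _) hAδ _ (hj.trans (by nlinarith))
    linarith

end IrratQuad

namespace IrratQuad

open Matrix Topology

/-- The ambient group. -/
abbrev G4 := Matrix.SpecialLinearGroup (Fin 4) ℝ

lemma coe_ext {a b : G4} (h : (a : Matrix (Fin 4) (Fin 4) ℝ) = b) : a = b := Subtype.ext h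

/-- Unimodular affine transformations of `ℝ³`, as `4 × 4` matrices. -/
def affineGroup : Subgroup G4 where
  carrier := {g | (g : Matrix (Fin 4) (Fin 4) ℝ) 3 = Pi.single 3 1}
  one_mem' := by
    ext j; fin_cases j <;> simp
  mul_mem' := by
    intro a b ha hb
    change (a : Matrix (Fin 4) (Fin 4) ℝ) 3 = Pi.single 3 1 at ha
    change (b : Matrix (Fin 4) (Fin 4) ℝ) 3 = Pi.single 3 1 at hb
    change ((a * b : G4) : Matrix (Fin 4) (Fin 4) ℝ) 3 = Pi.single 3 1
    rw [Matrix.SpecialLinearGroup.coe_mul, Matrix.mul_apply_eq_vecMul, ha, Matrix.single_one_vecMul]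
    exact hb
  inv_mem' := by
    intro a ha
    change (a : Matrix (Fin 4) (Fin 4) ℝ) 3 = Pi.single 3 1 at ha
    change ((a⁻¹ : G4) : Matrix (Fin 4) (Fin 4) ℝ) 3 = Pi.single 3 1
    have h : ((a * a⁻¹ : G4) : Matrix (Fin 4) (Fin 4) ℝ) 3 = Pi.single 3 1 := by
      rw [mul_inv_cancel]; ext j; fin_cases j <;> simp
    rwa [Matrix.SpecialLinearGroup.coe_mul, Matrix.mul_apply_eq_vecMul, ha,
      Matrix.single_one_vecMul] at h

/-- Integral unimodular affine transformations. -/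
def latticeGroup : Subgroup G4 :=
  affineGroup ⊓ (Matrix.SpecialLinearGroup.map (n := Fin 4) (Int.castRingHom ℝ)).range

lemma mem_affineGroup {g : G4} : g ∈ affineGroup ↔
    g 3 0 = 0 ∧ g 3 1 = 0 ∧ g 3 2 = 0 ∧ g 3 3 = 1 := by
  change (g : Matrix (Fin 4) (Fin 4) ℝ) 3 = Pi.single 3 1 ↔ _
  constructor
  · intro h
    refine ⟨?_, ?_, ?_, ?_⟩
    · simpa using congrFun h 0
    · simpa using congrFun h 1
    · simpa using congrFun h 2
    · simpa using congrFun h 3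
  · rintro ⟨h0, h1, h2, h3⟩
    ext j; fin_cases j <;> simp [*]

lemma continuous_entry (i j : Fin 4) : Continuous fun g : G4 => g i j := by
  have : Continuous fun g : G4 => (g : Matrix (Fin 4) (Fin 4) ℝ) := continuous_subtype_val
  exact this.matrix_elem i j

lemma isClosed_affineGroup : IsClosed (affineGroup : Set G4) := by
  have : (affineGroup : Set G4) = {g | g 3 0 = 0 ∧ g 3 1 = 0 ∧ g 3 2 = 0 ∧ g 3 3 = 1} := by
    ext g; exact mem_affineGroup
  rw [this]
  exact (isClosed_eq (continuous_entry _ _) continuous_const).inter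
    ((isClosed_eq (continuous_entry _ _) continuous_const).inter
    ((isClosed_eq (continuous_entry _ _) continuous_const).inter
    (isClosed_eq (continuous_entry _ _) continuous_const)))

lemma isClosed_latticeGroup : IsClosed (latticeGroup : Set G4) := by
  refine isClosed_affineGroup.inter ?_
  have := (Topology.IsClosedEmbedding.specialLinearGroup_map (n := Fin 4)
    (f := Int.castRingHom ℝ) Int.isClosedEmbedding_coe_real).isClosed_range
  simpa using this

lemma mem_latticeGroup_iff {g : G4} : g ∈ latticeGroup ↔
    g ∈ affineGroup ∧ ∀ i j, ∃ k : ℤ, g i j = k := by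
  constructor
  · rintro ⟨h, ⟨γ, rfl⟩⟩
    exact ⟨h, fun i j => ⟨γ i j, by simp⟩⟩
  · rintro ⟨h, hi⟩
    refine ⟨h, ?_⟩
    choose k hk using hi
    have hd : (Matrix.of k).det = 1 := by
      have h1 := g.det_coe
      have h2 : (g : Matrix (Fin 4) (Fin 4) ℝ) = (Int.castRingHom ℝ).mapMatrix (Matrix.of k) := by
        ext i j; simp [hk i j]
      rw [h2, ← RingHom.map_det] at h1
      exact Int.cast_injective (α := ℝ) (by simpa using h1)
    let γ : Matrix.SpecialLinearGroup (Fin 4) ℤ := ⟨Matrix.of k, hd⟩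
    refine ⟨γ, ?_⟩
    ext i j
    rw [Matrix.SpecialLinearGroup.map_apply_coe, RingHom.mapMatrix_apply, Matrix.map_apply, hk i j]
    rfl

/-- The set of matrices with entries bounded by `R`. -/
def box (R : ℝ) : Set G4 := {g | ∀ i j, |g i j| ≤ R}

lemma isCompact_box (R : ℝ) : IsCompact (box R) := by
  have h1 : IsCompact (Set.pi Set.univ fun _ : Fin 4 => Set.pi Set.univ fun _ : Fin 4 =>
      Set.Icc (-R) R) := isCompact_univ_pi fun _ => isCompact_univ_pi fun _ => isCompact_Icc
  refine ((Matrix.SpecialLinearGroup.isClosedEmbedding_val (n := Fin 4)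
    (R := ℝ)).isCompact_preimage h1).of_isClosed_subset ?_ fun g hg i _ j _ => abs_le.mp (hg i j)
  have : box R = ⋂ i, ⋂ j, {g : G4 | |g i j| ≤ R} := by
    ext g; simp [box]
  rw [this]
  exact isClosed_iInter fun i => isClosed_iInter fun j =>
    isClosed_le (continuous_entry i j).abs continuous_const

lemma exists_mem_box (g : G4) : ∃ R, g ∈ box R := by
  refine ⟨∑ i, ∑ j, |g i j|, fun i j => ?_⟩
  exact (Finset.single_le_sum (f := fun j => |g i j|) (fun _ _ => abs_nonneg _)
    (Finset.mem_univ j)).trans (Finset.single_le_sum (f := fun i => ∑ j, |g i j|)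
    (fun _ _ => Finset.sum_nonneg fun _ _ => abs_nonneg _) (Finset.mem_univ i))

/-- The unipotent one-parameter group. -/
noncomputable def un (t : ℝ) : G4 :=
  ⟨!![1, t, t ^ 2 / 2, 0; 0, 1, t, 0; 0, 0, 1, 0; 0, 0, 0, 1], by
    simp [Matrix.det_succ_row_zero, Fin.sum_univ_succ, Fin.succAbove]⟩

/-- The diagonal one-parameter group. -/
noncomputable def dg (s : ℝ) : G4 :=
  ⟨!![Real.exp s, 0, 0, 0; 0, 1, 0, 0; 0, 0, Real.exp (-s), 0; 0, 0, 0, 1], by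
    simp [Matrix.det_succ_row_zero, Fin.sum_univ_succ, Fin.succAbove, ← Real.exp_add]⟩

lemma coe_un (t : ℝ) : (un t : Matrix (Fin 4) (Fin 4) ℝ) =
    !![1, t, t ^ 2 / 2, 0; 0, 1, t, 0; 0, 0, 1, 0; 0, 0, 0, 1] := rfl

lemma coe_dg (s : ℝ) : (dg s : Matrix (Fin 4) (Fin 4) ℝ) =
    !![Real.exp s, 0, 0, 0; 0, 1, 0, 0; 0, 0, Real.exp (-s), 0; 0, 0, 0, 1] := rfl

lemma un_add (s t : ℝ) : un (s + t) = un s * un t := by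
  apply coe_ext
  rw [Matrix.SpecialLinearGroup.coe_mul, coe_un, coe_un, coe_un]
  ext i j; fin_cases i <;> fin_cases j <;> simp [Matrix.mul_apply, Fin.sum_univ_four] <;> ring

lemma un_zero : un 0 = 1 := by
  apply coe_ext
  rw [coe_un, Matrix.SpecialLinearGroup.coe_one]
  ext i j; fin_cases i <;> fin_cases j <;> simp

lemma un_neg (t : ℝ) : un (-t) = (un t)⁻¹ := by
  rw [eq_inv_iff_mul_eq_one, ← un_add, neg_add_cancel, un_zero]

lemma dg_add (s t : ℝ) : dg (s + t) = dg s * dg t := by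
  apply coe_ext
  rw [Matrix.SpecialLinearGroup.coe_mul, coe_dg, coe_dg, coe_dg]
  ext i j; fin_cases i <;> fin_cases j <;>
    simp [Matrix.mul_apply, Fin.sum_univ_four, Real.exp_add, mul_comm]

lemma dg_zero : dg 0 = 1 := by
  apply coe_ext
  rw [coe_dg, Matrix.SpecialLinearGroup.coe_one]
  ext i j; fin_cases i <;> fin_cases j <;> simp

lemma dg_neg (t : ℝ) : dg (-t) = (dg t)⁻¹ := by
  rw [eq_inv_iff_mul_eq_one, ← dg_add, neg_add_cancel, dg_zero]

lemma dg_mul_un (s t : ℝ) : dg s * un t = un (Real.exp s * t) * dg s := by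
  apply coe_ext
  rw [Matrix.SpecialLinearGroup.coe_mul, Matrix.SpecialLinearGroup.coe_mul, coe_dg, coe_un, coe_un]
  have h : Real.exp s * Real.exp (-s) = 1 := by rw [← Real.exp_add]; simp
  ext i j; fin_cases i <;> fin_cases j <;>
    simp [Matrix.mul_apply, Fin.sum_univ_four]
  · linear_combination (-(Real.exp s * t ^ 2 / 2)) * h
  · linear_combination (-t) * h

lemma un_mem (t : ℝ) : un t ∈ affineGroup := by
  rw [mem_affineGroup, coe_un]; simp

lemma dg_mem (s : ℝ) : dg s ∈ affineGroup := by
  rw [mem_affineGroup, coe_dg]; simp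

lemma continuous_un : Continuous un := by
  refine Continuous.subtype_mk (continuous_matrix fun i j => ?_) _
  fin_cases i <;> fin_cases j <;> simp <;> fun_prop

/-- The linear part of an affine transformation. -/
def linPart (g : G4) : (Fin 3 → ℝ) →ₗ[ℝ] (Fin 3 → ℝ) :=
  Matrix.mulVecLin !![g 0 0, g 0 1, g 0 2; g 1 0, g 1 1, g 1 2; g 2 0, g 2 1, g 2 2]

/-- The dual of the linear part. -/
def dualPart (g : G4) : (Fin 3 → ℝ) →ₗ[ℝ] (Fin 3 → ℝ) :=
  Matrix.mulVecLin !![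
    g 0 0 * g 1 1 - g 1 0 * g 0 1, g 0 0 * g 1 2 - g 1 0 * g 0 2, g 0 1 * g 1 2 - g 1 1 * g 0 2;
    g 0 0 * g 2 1 - g 2 0 * g 0 1, g 0 0 * g 2 2 - g 2 0 * g 0 2, g 0 1 * g 2 2 - g 2 1 * g 0 2;
    g 1 0 * g 2 1 - g 2 0 * g 1 1, g 1 0 * g 2 2 - g 2 0 * g 1 2, g 1 1 * g 2 2 - g 2 1 * g 1 2]

lemma linPart_apply (g : G4) (x : Fin 3 → ℝ) : linPart g x =
    ![g 0 0 * x 0 + g 0 1 * x 1 + g 0 2 * x 2, g 1 0 * x 0 + g 1 1 * x 1 + g 1 2 * x 2,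
      g 2 0 * x 0 + g 2 1 * x 1 + g 2 2 * x 2] := by
  ext i; fin_cases i <;> simp [linPart, Matrix.mulVec, dotProduct, Fin.sum_univ_three]

lemma dualPart_apply (g : G4) (x : Fin 3 → ℝ) : dualPart g x =
    ![(g 0 0 * g 1 1 - g 1 0 * g 0 1) * x 0 + (g 0 0 * g 1 2 - g 1 0 * g 0 2) * x 1 +
        (g 0 1 * g 1 2 - g 1 1 * g 0 2) * x 2,
      (g 0 0 * g 2 1 - g 2 0 * g 0 1) * x 0 + (g 0 0 * g 2 2 - g 2 0 * g 0 2) * x 1 +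
        (g 0 1 * g 2 2 - g 2 1 * g 0 2) * x 2,
      (g 1 0 * g 2 1 - g 2 0 * g 1 1) * x 0 + (g 1 0 * g 2 2 - g 2 0 * g 1 2) * x 1 +
        (g 1 1 * g 2 2 - g 2 1 * g 1 2) * x 2] := by
  ext i; fin_cases i <;> simp [dualPart, Matrix.mulVec, dotProduct, Fin.sum_univ_three]

lemma det_linPart {g : G4} (hg : g ∈ affineGroup) :
    g 0 0 * (g 1 1 * g 2 2 - g 1 2 * g 2 1) - g 0 1 * (g 1 0 * g 2 2 - g 1 2 * g 2 0)
      + g 0 2 * (g 1 0 * g 2 1 - g 1 1 * g 2 0) = 1 := by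
  obtain ⟨h0, h1, h2, h3⟩ := mem_affineGroup.mp hg
  have h := g.det_coe
  have e : (g : Matrix (Fin 4) (Fin 4) ℝ) = !![g 0 0, g 0 1, g 0 2, g 0 3;
      g 1 0, g 1 1, g 1 2, g 1 3; g 2 0, g 2 1, g 2 2, g 2 3; 0, 0, 0, 1] := by
    ext i j; fin_cases i <;> fin_cases j <;> simp [*]
  rw [e] at h
  simp [Matrix.det_succ_row_zero, Fin.sum_univ_succ, Fin.succAbove] at h
  linarith

lemma dualPair {g : G4} (hg : g ∈ affineGroup) : DualPair (linPart g) (dualPart g) := by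
  have h := det_linPart hg
  refine ⟨fun x y => ?_, fun x y => ?_, fun x y => ?_⟩
  · rw [linPart_apply, linPart_apply, dualPart_apply]
    ext i; fin_cases i <;> simp [dia] <;> ring
  · rw [linPart_apply, dualPart_apply, dualPart_apply]
    ext i; fin_cases i <;> simp [dia]
    · linear_combination (g 0 0 * (x 0 * y 1 - x 1 * y 0) + g 0 1 * (x 0 * y 2 - x 2 * y 0)
        + g 0 2 * (x 1 * y 2 - x 2 * y 1)) * h
    · linear_combination (g 1 0 * (x 0 * y 1 - x 1 * y 0) + g 1 1 * (x 0 * y 2 - x 2 * y 0)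
        + g 1 2 * (x 1 * y 2 - x 2 * y 1)) * h
    · linear_combination (g 2 0 * (x 0 * y 1 - x 1 * y 0) + g 2 1 * (x 0 * y 2 - x 2 * y 0)
        + g 2 2 * (x 1 * y 2 - x 2 * y 1)) * h
  · rw [linPart_apply, dualPart_apply]
    simp [bil]
    linear_combination (x 0 * y 2 + x 2 * y 0 - x 1 * y 1) * h

lemma linPart_mul {a b : G4} (hb : b ∈ affineGroup) (x : Fin 3 → ℝ) :
    linPart (a * b) x = linPart a (linPart b x) := by
  obtain ⟨h0, h1, h2, -⟩ := mem_affineGroup.mp hb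
  rw [linPart_apply, linPart_apply, linPart_apply]
  ext i; fin_cases i <;>
    simp [Matrix.mul_apply, Fin.sum_univ_four, h0, h1, h2] <;> ring

lemma dualPart_mul {a b : G4} (hb : b ∈ affineGroup) (x : Fin 3 → ℝ) :
    dualPart (a * b) x = dualPart a (dualPart b x) := by
  obtain ⟨h0, h1, h2, -⟩ := mem_affineGroup.mp hb
  rw [dualPart_apply, dualPart_apply, dualPart_apply]
  ext i; fin_cases i <;>
    simp [Matrix.mul_apply, Fin.sum_univ_four, h0, h1, h2] <;> ring

lemma linPart_un (t : ℝ) (x : Fin 3 → ℝ) : linPart (un t) x = shear t x := by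
  rw [linPart_apply, coe_un]
  ext i; fin_cases i <;> simp [shear]

lemma dualPart_un (t : ℝ) (x : Fin 3 → ℝ) : dualPart (un t) x = shear t x := by
  rw [dualPart_apply, coe_un]
  have e : t * t - t ^ 2 / 2 = t ^ 2 / 2 := by ring
  ext i; fin_cases i <;> simp [shear, e]

lemma linPart_dg (s : ℝ) (x : Fin 3 → ℝ) :
    linPart (dg s) x = ![Real.exp s * x 0, x 1, Real.exp (-s) * x 2] := by
  rw [linPart_apply, coe_dg]
  ext i; fin_cases i <;> simp

lemma dualPart_dg (s : ℝ) (x : Fin 3 → ℝ) :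
    dualPart (dg s) x = ![Real.exp s * x 0, x 1, Real.exp (-s) * x 2] := by
  have h : Real.exp s * Real.exp (-s) = 1 := by rw [← Real.exp_add]; simp
  rw [dualPart_apply, coe_dg]
  ext i; fin_cases i <;> simp [h]

end IrratQuad

namespace IrratQuad

open Matrix Topology

lemma abs_le_of_nsq_le {x : Fin 3 → ℝ} {C : ℝ} (h : nsq x ≤ C) (i : Fin 3) : |x i| ≤ C + 1 := by
  have h2 : (x i) ^ 2 ≤ C := by
    unfold nsq at h
    fin_cases i <;> simp <;> nlinarith [sq_nonneg (x 0), sq_nonneg (x 1), sq_nonneg (x 2)]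
  rw [abs_le]; constructor <;> nlinarith [sq_nonneg (x i + 1), sq_nonneg (x i - 1)]

lemma DualPair.exists_pos_le {g g' : (Fin 3 → ℝ) →ₗ[ℝ] (Fin 3 → ℝ)} (h : DualPair g g') :
    ∃ c, 0 < c ∧ ∀ m : Fin 3 → ℤ, m ≠ 0 → c ≤ nsq (g (toR m)) := by
  set D := nsq (g' ![1, 0, 0]) + nsq (g' ![0, 1, 0]) + nsq (g' ![0, 0, 1]) + 1 with hD
  have n0 := nsq_nonneg (g' ![1, 0, 0])
  have n1 := nsq_nonneg (g' ![0, 1, 0])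
  have n2 := nsq_nonneg (g' ![0, 0, 1])
  have hD0 : 0 < D := by positivity
  refine ⟨1 / D, by positivity, fun m hm => ?_⟩
  have hx := nsq_nonneg (g (toR m))
  rw [div_le_iff₀ hD0]
  have key : ∀ e, bil (toR m) e ^ 2 ≤ nsq (g (toR m)) * nsq (g' e) := fun e => by
    rw [← h.bil_eq]; exact bil_sq_le _ _
  have hi : ∃ i, m i ≠ 0 := by
    by_contra! hc; exact hm (funext hc)
  have sq1 : ∀ k : ℤ, k ≠ 0 → (1 : ℝ) ≤ (k : ℝ) ^ 2 := fun k hk => by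
    have : (1 : ℤ) ≤ k ^ 2 := by have := sq_pos_of_ne_zero hk; lia
    exact_mod_cast this
  have k0 := key ![1, 0, 0]
  have k1 := key ![0, 1, 0]
  have k2 := key ![0, 0, 1]
  simp [bil] at k0 k1 k2
  obtain ⟨i, hi⟩ := hi
  have := sq1 _ hi
  fin_cases i <;> simp only [Fin.mk_zero, Fin.mk_one, Fin.reduceFinMk] at this <;>
    nlinarith

/-- The lattice of `g` is `δ`-thick, together with its dual. -/
def Thick (δ : ℝ) (g : G4) : Prop := ∀ m : Fin 3 → ℤ, m ≠ 0 →
  δ ≤ nsq (linPart g (toR m)) ∧ δ ≤ nsq (dualPart g (toR m))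

/-- The matrix of an affine map with columns `x, y, z` and translation part `w`. -/
def affMat {R : Type*} [Zero R] [One R] (x y z w : Fin 3 → R) : Matrix (Fin 4) (Fin 4) R :=
  !![x 0, y 0, z 0, w 0; x 1, y 1, z 1, w 1; x 2, y 2, z 2, w 2; 0, 0, 0, 1]

lemma det_affMat {R : Type*} [CommRing R] (x y z w : Fin 3 → R) :
    (affMat x y z w).det = (ofCols x y z).det := by
  rw [det_ofCols]
  simp [affMat, Matrix.det_succ_row_zero, Fin.sum_univ_succ, Fin.succAbove, crs]
  ring

lemma exists_lattice_affMat (x y z w : Fin 3 → ℤ) (h : (ofCols x y z).det = 1) :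
    ∃ γ ∈ latticeGroup, (γ : Matrix (Fin 4) (Fin 4) ℝ) =
      affMat (toR x) (toR y) (toR z) (toR w) := by
  have hd : (affMat (toR x) (toR y) (toR z) (toR w)).det = 1 := by
    rw [det_affMat, det_ofCols]
    rw [det_ofCols] at h
    have := congrArg (Int.cast : ℤ → ℝ) h
    simpa [crs] using this
  suffices H : ∀ γ : G4, (γ : Matrix (Fin 4) (Fin 4) ℝ) =
      affMat (toR x) (toR y) (toR z) (toR w) → γ ∈ latticeGroup from ⟨⟨_, hd⟩, H _ rfl, rfl⟩
  intro γ e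
  rw [mem_latticeGroup_iff, mem_affineGroup, e]
  refine ⟨by simp [affMat], fun i j => ?_⟩
  fin_cases i <;> fin_cases j <;> simp [affMat] <;>
    first | exact ⟨_, rfl⟩ | exact ⟨0, Int.cast_zero.symm⟩ | exact ⟨1, Int.cast_one.symm⟩

/-- Compactness criterion in the space of affine lattices. -/
theorem exists_mul_mem_box {δ : ℝ} (hδ : 0 < δ) : ∃ R, ∀ g ∈ affineGroup, Thick δ g →
    ∃ γ ∈ latticeGroup, g * γ ∈ box R := by
  set C := (3 / δ + 1) / δ + 3 with hC
  have hC0 : 0 ≤ (3 / δ + 1) / δ := by positivity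
  refine ⟨3 * (C + 1), fun g hg hT => ?_⟩
  have hdet := det_linPart hg
  obtain ⟨x, y, z, h1, hx, hy, hz⟩ := exists_reduced_basis (linPart g) hδ
    (fun x y z => by
      rw [det_ofCols, det_ofCols, linPart_apply, linPart_apply, linPart_apply]
      simp [crs]
      linear_combination ((x 1 * y 2 - x 2 * y 1) * z 0 + (x 2 * y 0 - x 0 * y 2) * z 1
        + (x 0 * y 1 - x 1 * y 0) * z 2) * hdet)
    (fun m hm => (hT m hm).1)
    (fun m m' hm => by
      rw [← nsq_dia, (dualPair hg).dia_left, ← toR_dia]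
      refine (hT _ fun h0 => hm ?_).2
      have e0 := congrFun h0 0
      have e1 := congrFun h0 1
      have e2 := congrFun h0 2
      simp [dia] at e0 e1 e2
      ext i; fin_cases i <;> simp [crs] <;> lia)
  obtain ⟨γ₀, hγ₀, e₀⟩ := exists_lattice_affMat x y z 0 h1
  have hA : g * γ₀ ∈ affineGroup := affineGroup.mul_mem hg hγ₀.1
  set A := g * γ₀ with hAdef
  have bound : ∀ v : Fin 3 → ℝ, nsq (linPart g v) ≤ C → ∀ i : Fin 4,
      |g i 0 * v 0 + g i 1 * v 1 + g i 2 * v 2| ≤ C + 1 := by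
    intro v hv i
    obtain ⟨a0, a1, a2, a3⟩ := mem_affineGroup.mp hg
    have b := abs_le_of_nsq_le hv
    rw [linPart_apply] at b
    fin_cases i
    · simpa using b 0
    · simpa using b 1
    · simpa using b 2
    · simp [a0, a1, a2]; linarith
  have A0 : ∀ i, |A i 0| ≤ C + 1 := fun i => by
    have := bound (toR x) (by linarith) i
    simpa [A, Matrix.mul_apply, Fin.sum_univ_four, e₀, affMat] using this
  have A1 : ∀ i, |A i 1| ≤ C + 1 := fun i => by
    have := bound (toR y) (by linarith) i
    simpa [A, Matrix.mul_apply, Fin.sum_univ_four, e₀, affMat] using this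
  have A2 : ∀ i, |A i 2| ≤ C + 1 := fun i => by
    have := bound (toR z) (by linarith) i
    simpa [A, Matrix.mul_apply, Fin.sum_univ_four, e₀, affMat] using this
  have hu : ∀ i : Fin 3, A i.castSucc 0 * A⁻¹ 0 3 + A i.castSucc 1 * A⁻¹ 1 3
      + A i.castSucc 2 * A⁻¹ 2 3 + A i.castSucc 3 = 0 := by
    intro i
    have h33 := (mem_affineGroup.mp (affineGroup.inv_mem hA)).2.2.2
    have e : (A * A⁻¹) i.castSucc 3 = 0 := by
      rw [mul_inv_cancel]; fin_cases i <;> simp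
    rw [Matrix.SpecialLinearGroup.coe_mul, Matrix.mul_apply, Fin.sum_univ_four, h33, mul_one] at e
    exact e
  obtain ⟨τ, hτ, eτ⟩ := exists_lattice_affMat ![1, 0, 0] ![0, 1, 0] ![0, 0, 1]
    ![⌊A⁻¹ 0 3⌋, ⌊A⁻¹ 1 3⌋, ⌊A⁻¹ 2 3⌋] (by simp [det_ofCols, crs])
  refine ⟨γ₀ * τ, latticeGroup.mul_mem hγ₀ hτ, fun i j => ?_⟩
  rw [← mul_assoc, ← hAdef]
  have C1 : 0 ≤ C + 1 := by linarith
  fin_cases j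
  · have := A0 i
    simp [Matrix.mul_apply, Fin.sum_univ_four, eτ, affMat]; linarith
  · have := A1 i
    simp [Matrix.mul_apply, Fin.sum_univ_four, eτ, affMat]; linarith
  · have := A2 i
    simp [Matrix.mul_apply, Fin.sum_univ_four, eτ, affMat]; linarith
  · have last : ∀ i : Fin 3, |A i.castSucc 0 * ⌊A⁻¹ 0 3⌋ + A i.castSucc 1 * ⌊A⁻¹ 1 3⌋
        + A i.castSucc 2 * ⌊A⁻¹ 2 3⌋ + A i.castSucc 3| ≤ 3 * (C + 1) := by
      intro i
      have e : A i.castSucc 0 * ⌊A⁻¹ 0 3⌋ + A i.castSucc 1 * ⌊A⁻¹ 1 3⌋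
        + A i.castSucc 2 * ⌊A⁻¹ 2 3⌋ + A i.castSucc 3 = -(A i.castSucc 0 * Int.fract (A⁻¹ 0 3)
        + A i.castSucc 1 * Int.fract (A⁻¹ 1 3) + A i.castSucc 2 * Int.fract (A⁻¹ 2 3)) := by
        have := hu i
        simp only [Int.fract]
        linarith
      have f : ∀ a r : ℝ, |a| ≤ C + 1 → |a * Int.fract r| ≤ C + 1 := fun a r ha => by
        rw [abs_mul, abs_of_nonneg (Int.fract_nonneg r)]
        exact (mul_le_of_le_one_right (abs_nonneg a) (Int.fract_lt_one r).le).trans ha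
      rw [e, abs_neg]
      have := f _ (A⁻¹ 0 3) (A0 i.castSucc)
      have := f _ (A⁻¹ 1 3) (A1 i.castSucc)
      have := f _ (A⁻¹ 2 3) (A2 i.castSucc)
      refine (abs_add_le _ _).trans ?_
      have := abs_add_le (A i.castSucc 0 * Int.fract (A⁻¹ 0 3))
        (A i.castSucc 1 * Int.fract (A⁻¹ 1 3))
      linarith
    obtain ⟨a0, a1, a2, a3⟩ := mem_affineGroup.mp hA
    fin_cases i
    · simpa [Matrix.mul_apply, Fin.sum_univ_four, eτ, affMat] using last 0
    · simpa [Matrix.mul_apply, Fin.sum_univ_four, eτ, affMat] using last 1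
    · simpa [Matrix.mul_apply, Fin.sum_univ_four, eτ, affMat] using last 2
    · simp [Matrix.mul_apply, Fin.sum_univ_four, eτ, affMat, a0, a1, a2, a3]; linarith

/-- Nonzero lattice vectors of the linear map `f` fixed by the unipotent flow have length at
least `c`. -/
def FixGe (c : ℝ) (f : (Fin 3 → ℝ) →ₗ[ℝ] (Fin 3 → ℝ)) : Prop :=
  ∀ m : Fin 3 → ℤ, m ≠ 0 → f (toR m) 1 = 0 → f (toR m) 2 = 0 → c ≤ |f (toR m) 0|

lemma nsq_of_fixed {x : Fin 3 → ℝ} (h1 : x 1 = 0) (h2 : x 2 = 0) : nsq x = |x 0| ^ 2 := by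
  simp [nsq, h1, h2]

lemma exists_fixGe {g : G4} (hg : g ∈ affineGroup) :
    ∃ c, 0 < c ∧ FixGe c (linPart g) ∧ FixGe c (dualPart g) := by
  have aux : ∀ {f f' : (Fin 3 → ℝ) →ₗ[ℝ] (Fin 3 → ℝ)}, DualPair f f' → ∃ c, 0 < c ∧ FixGe c f := by
    intro f f' h
    obtain ⟨c, hc, H⟩ := h.exists_pos_le
    refine ⟨√c, Real.sqrt_pos.mpr hc, fun m hm h1 h2 => ?_⟩
    have := H m hm
    rw [nsq_of_fixed h1 h2] at this
    exact Real.sqrt_le_iff.mpr ⟨abs_nonneg _, this⟩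
  obtain ⟨c, hc, h⟩ := aux (dualPair hg)
  obtain ⟨d, hd, h'⟩ := aux (dualPair hg).symm
  exact ⟨min c d, lt_min hc hd, fun m a b e => (min_le_left _ _).trans (h m a b e),
    fun m a b e => (min_le_right _ _).trans (h' m a b e)⟩

lemma exists_thick {g : G4} (hg : g ∈ affineGroup) {c : ℝ} (h : FixGe c (linPart g))
    (h' : FixGe c (dualPart g)) {s : ℝ} (hs : 1 ≤ Real.exp s * c) (T : ℝ) :
    ∃ t, 0 ≤ t ∧ Thick eta (un t * (dg s * (un T * g))) := by
  have hT : un T * g ∈ affineGroup := affineGroup.mul_mem (un_mem T) hg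
  have hs' : dg s * (un T * g) ∈ affineGroup := affineGroup.mul_mem (dg_mem s) hT
  have ne : ∀ t, Real.exp t ≠ 0 := fun t => (Real.exp_pos t).ne'
  obtain ⟨t, ht, H⟩ := (dualPair hs').nondivergence
    (fun m hm e1 e2 => by
      rw [nsq_of_fixed e1 e2]
      rw [linPart_mul hT, linPart_dg, linPart_mul hg, linPart_un] at e1 e2 ⊢
      simp [shear, ne] at e1 e2
      have h1 : linPart g (toR m) 1 = 0 := by simpa [e2] using e1
      have := h m hm h1 e2
      simp only [shear, h1, e2, Matrix.cons_val_zero, mul_zero, add_zero, abs_mul, Real.abs_exp]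
      apply one_le_pow₀
      exact hs.trans (by gcongr))
    (fun m hm e1 e2 => by
      rw [nsq_of_fixed e1 e2]
      rw [dualPart_mul hT, dualPart_dg, dualPart_mul hg, dualPart_un] at e1 e2 ⊢
      simp [shear, ne] at e1 e2
      have h1 : dualPart g (toR m) 1 = 0 := by simpa [e2] using e1
      have := h' m hm h1 e2
      simp only [shear, h1, e2, Matrix.cons_val_zero, mul_zero, add_zero, abs_mul, Real.abs_exp]
      apply one_le_pow₀
      exact hs.trans (by gcongr))
  refine ⟨t, ht, fun m hm => ?_⟩
  rw [linPart_mul hs', linPart_un, dualPart_mul hs', dualPart_un]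
  exact H m hm

lemma eta_pos : 0 < eta := by norm_num [eta]

/-- Late returns of unipotent orbits to a compact set. -/
theorem exists_return {c : ℝ} (hc : 0 < c) : ∃ K : Set G4, IsCompact K ∧ ∀ g ∈ affineGroup,
    FixGe c (linPart g) → FixGe c (dualPart g) → ∀ T, ∃ t, T ≤ t ∧ ∃ γ ∈ latticeGroup,
      un t * g * γ ∈ K := by
  obtain ⟨R, hR⟩ := exists_mul_mem_box eta_pos
  have hs : Real.exp (-Real.log c) * c = 1 := by
    rw [Real.exp_neg, Real.exp_log hc]; field_simp
  set s := -Real.log c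
  refine ⟨(fun k => dg (-s) * k) '' box R, (isCompact_box R).image (continuous_const_mul _), ?_⟩
  intro g hg h h' T
  obtain ⟨t, ht, hth⟩ := exists_thick hg h h' hs.ge T
  have hmem : un t * (dg s * (un T * g)) ∈ affineGroup := affineGroup.mul_mem (un_mem t)
    (affineGroup.mul_mem (dg_mem s) (affineGroup.mul_mem (un_mem T) hg))
  obtain ⟨γ, hγ, hb⟩ := hR _ hmem hth
  refine ⟨Real.exp (-s) * t + T, by have := Real.exp_pos (-s); nlinarith [mul_nonneg this.le ht],
    γ, hγ, _, hb, ?_⟩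
  have := dg_mul_un (-s) t
  simp only [un_add, ← mul_assoc]
  rw [this, mul_assoc (un _) (dg (-s)) (dg s), ← dg_add, neg_add_cancel, dg_zero, mul_one]

/-- Returns under the group generated by the diagonal and the unipotent flow. -/
theorem exists_return_dg : ∃ K : Set G4, IsCompact K ∧ ∀ g ∈ affineGroup, ∀ L, ∃ s, L ≤ s ∧
    ∃ t, ∃ γ ∈ latticeGroup, un t * dg s * g * γ ∈ K := by
  obtain ⟨R, hR⟩ := exists_mul_mem_box eta_pos
  refine ⟨box R, isCompact_box R, fun g hg L => ?_⟩
  obtain ⟨c, hc, h, h'⟩ := exists_fixGe hg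
  have hs : 1 ≤ Real.exp (max L (-Real.log c)) * c := by
    have : Real.exp (-Real.log c) ≤ Real.exp (max L (-Real.log c)) :=
      Real.exp_le_exp.mpr (le_max_right _ _)
    rw [Real.exp_neg, Real.exp_log hc] at this
    calc 1 = c⁻¹ * c := by field_simp
      _ ≤ _ := by gcongr
  obtain ⟨t, ht, hth⟩ := exists_thick hg h h' hs 0
  rw [un_zero, one_mul] at hth
  obtain ⟨γ, hγ, hb⟩ := hR _ (affineGroup.mul_mem (un_mem t)
    (affineGroup.mul_mem (dg_mem _) hg)) hth
  exact ⟨_, le_max_left _ _, t, γ, hγ, by simpa [mul_assoc] using hb⟩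

end IrratQuad

namespace IrratQuad

open Topology Filter Pointwise

section Minimal

variable {G : Type*} [Group G] [TopologicalSpace G]

lemma nonempty_inter_of_directed {X : Type*} [TopologicalSpace X] {K : Set X} (hK : IsCompact K)
    {ι : Type*} [Nonempty ι] (t : ι → Set X) (hc : ∀ i, IsClosed (t i))
    (hd : Directed (· ⊇ ·) t) (hne : ∀ i, (K ∩ t i).Nonempty) : (K ∩ ⋂ i, t i).Nonempty := by
  by_contra h
  obtain ⟨i, hi⟩ := hK.elim_directed_family_closed t hc (Set.not_nonempty_iff_eq_empty.mp h) hd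
  exact (hne i).ne_empty hi

/-- Nonempty closed sets invariant under `H` on the left and `Γ` on the right. -/
structure InvClosed (H : Set G) (Γ : Subgroup G) (X : Set G) : Prop where
  closed : IsClosed X
  nonempty : X.Nonempty
  left : ∀ h ∈ H, ∀ y ∈ X, h * y ∈ X
  right : ∀ γ ∈ Γ, ∀ y ∈ X, y * γ ∈ X

/-- Minimal nonempty closed invariant sets. -/
structure IsMinInv (H : Set G) (Γ : Subgroup G) (X : Set G) : Prop extends InvClosed H Γ X where
  eq_of_subset : ∀ X', InvClosed H Γ X' → X' ⊆ X → X' = X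

theorem exists_isMinInv {H : Set G} {Γ : Subgroup G} {X K : Set G} (hX : InvClosed H Γ X)
    (hK : IsCompact K) (hret : ∀ y ∈ X, ∃ h ∈ H, ∃ γ ∈ Γ, h * y * γ ∈ K) :
    ∃ Z ⊆ X, IsMinInv H Γ Z := by
  obtain ⟨Z, hZX, hZ⟩ := zorn_superset_nonempty {Z | Z ⊆ X ∧ InvClosed H Γ Z}
    (fun c hc hchain hne => by
      have hne' := hne.to_subtype
      refine ⟨⋂₀ c, ⟨(Set.sInter_subset_of_mem hne.some_mem).trans (hc hne.some_mem).1, ?_, ?_,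
        ?_, ?_⟩, fun s hs => Set.sInter_subset_of_mem hs⟩
      · exact isClosed_sInter fun s hs => (hc hs).2.closed
      · rw [Set.sInter_eq_iInter]
        refine (nonempty_inter_of_directed hK (fun s : c => (s : Set G))
          (fun s => (hc s.2).2.closed) ?_ fun s => ?_).mono Set.inter_subset_right
        · intro s t
          rcases hchain.total s.2 t.2 with h | h
          · exact ⟨s, subset_rfl, h⟩
          · exact ⟨t, h, subset_rfl⟩
        · obtain ⟨y, hy⟩ := (hc s.2).2.nonempty
          obtain ⟨h, hh, γ, hγ, hk⟩ := hret y ((hc s.2).1 hy)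
          exact ⟨_, hk, (hc s.2).2.right γ hγ _ ((hc s.2).2.left h hh y hy)⟩
      · exact fun h hh y hy s hs => (hc hs).2.left h hh y (hy s hs)
      · exact fun γ hγ y hy s hs => (hc hs).2.right γ hγ y (hy s hs))
    X ⟨subset_rfl, hX⟩
  refine ⟨Z, hZX, hZ.prop.2, fun X' hX' hs => ?_⟩
  exact hs.antisymm (hZ.le_of_le ⟨hs.trans hZX, hX'⟩ hs)

/-- The double orbit of a point under a set on the left and a subgroup on the right. -/
def dorbit (A : Set G) (Γ : Subgroup G) (y : G) : Set G := {z | ∃ h ∈ A, ∃ γ ∈ Γ, z = h * y * γ}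

variable [IsTopologicalGroup G]

lemma invClosed_closure {H : Set G} {Γ : Subgroup G} {X : Set G} (hne : X.Nonempty)
    (hl : ∀ h ∈ H, ∀ y ∈ X, h * y ∈ X) (hr : ∀ γ ∈ Γ, ∀ y ∈ X, y * γ ∈ X) :
    InvClosed H Γ (closure X) where
  closed := isClosed_closure
  nonempty := hne.closure
  left h hh _ hy := map_mem_closure (continuous_const_mul h) hy fun y hy => hl h hh y hy
  right γ hγ _ hy := map_mem_closure (f := fun x => x * γ) (continuous_mul_const γ) hy fun y hy => hr γ hγ y hy

/-- Points of a minimal set are recurrent to all points of the set. -/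
theorem IsMinInv.mem_closure_dorbit {H : Set G} {Γ : Subgroup G} {Y K : Set G}
    (hY : IsMinInv H Γ Y) (hK : IsCompact K) {A : ℕ → Set G} (hA : Antitone A)
    (hAH : ∀ n, A n ⊆ H) (hinv : ∀ h ∈ H, ∀ n, ∃ m, ∀ a ∈ A m, h * a ∈ A n)
    {y : G} (hy : y ∈ Y) (hret : ∀ n, ∃ h ∈ A n, ∃ γ ∈ Γ, h * y * γ ∈ K)
    {z : G} (hz : z ∈ Y) (n : ℕ) : z ∈ closure (dorbit (A n) Γ y) := by
  have hsub : ∀ n, closure (dorbit (A n) Γ y) ⊆ Y := fun n => by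
    refine closure_minimal ?_ hY.closed
    rintro _ ⟨h, hh, γ, hγ, rfl⟩
    exact hY.right γ hγ _ (hY.left h (hAH n hh) y hy)
  have key : (⋂ n, closure (dorbit (A n) Γ y)) = Y := by
    refine hY.eq_of_subset _ ⟨isClosed_iInter fun n => isClosed_closure, ?_, ?_, ?_⟩
      ((Set.iInter_subset _ 0).trans (hsub 0))
    · refine (nonempty_inter_of_directed hK _ (fun n => isClosed_closure) ?_ fun n => ?_).mono
        Set.inter_subset_right
      · refine directed_of_isDirected_le fun i j hij => closure_mono ?_
        rintro _ ⟨h, hh, γ, hγ, rfl⟩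
        exact ⟨h, hA hij hh, γ, hγ, rfl⟩
      · obtain ⟨h, hh, γ, hγ, hk⟩ := hret n
        exact ⟨_, hk, subset_closure ⟨h, hh, γ, hγ, rfl⟩⟩
    · intro h hh w hw
      rw [Set.mem_iInter] at hw ⊢
      intro n
      obtain ⟨m, hm⟩ := hinv h hh n
      refine map_mem_closure (continuous_const_mul h) (hw m) ?_
      rintro _ ⟨a, ha, γ, hγ, rfl⟩
      exact ⟨h * a, hm a ha, γ, hγ, by simp only [mul_assoc]⟩
    · intro δ hδ w hw
      rw [Set.mem_iInter] at hw ⊢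
      intro n
      refine map_mem_closure (f := fun x => x * δ) (continuous_mul_const δ) (hw n) ?_
      rintro _ ⟨a, ha, γ, hγ, rfl⟩
      exact ⟨a, ha, γ * δ, Γ.mul_mem hγ hδ, by simp only [mul_assoc]⟩
  rw [← key, Set.mem_iInter] at hz
  exact hz n

/-- Recurrence of points of a minimal set. -/
theorem IsMinInv.exists_recurrent [FirstCountableTopology G] {H : Set G} {Γ : Subgroup G}
    {Y K : Set G} (hY : IsMinInv H Γ Y) (hK : IsCompact K) {A : ℕ → Set G} (hA : Antitone A)
    (hAH : ∀ n, A n ⊆ H) (hinv : ∀ h ∈ H, ∀ n, ∃ m, ∀ a ∈ A m, h * a ∈ A n)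
    {y : G} (hy : y ∈ Y) (hret : ∀ n, ∃ h ∈ A n, ∃ γ ∈ Γ, h * y * γ ∈ K) :
    ∃ h γ g : ℕ → G, (∀ n, h n ∈ A n) ∧ (∀ n, γ n ∈ Γ) ∧ (∀ n, g n * y = h n * y * γ n) ∧
      Tendsto g atTop (𝓝 1) := by
  have hcl : ∀ n, y ∈ closure (dorbit (A n) Γ y) :=
    fun n => hY.mem_closure_dorbit hK hA hAH hinv hy hret hy n
  obtain ⟨U, hU⟩ := (𝓝 y).exists_antitone_basis
  have : ∀ n, ∃ h ∈ A n, ∃ γ ∈ Γ, h * y * γ ∈ U n := fun n => by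
    obtain ⟨_, h1, h, hh, γ, hγ, rfl⟩ := mem_closure_iff_nhds.mp (hcl n) (U n) (hU.mem n)
    exact ⟨h, hh, γ, hγ, h1⟩
  choose h hh γ hγ hU' using this
  refine ⟨h, γ, fun n => h n * y * γ n * y⁻¹, hh, hγ, fun n => by simp, ?_⟩
  have h1 : Tendsto (fun n => h n * y * γ n) atTop (𝓝 y) := hU.tendsto hU'
  simpa using h1.mul_const y⁻¹

/-- A minimal set for a one-parameter group whose points all return to a compact set at
arbitrarily late times is bounded modulo `Γ`. -/
theorem IsMinInv.exists_bounded [WeaklyLocallyCompactSpace G] {Γ : Subgroup G}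
    (hΓ : IsClosed (Γ : Set G)) {u : ℝ → G} (hu : Continuous u)
    (hadd : ∀ s t, u (s + t) = u s * u t) {Y K : Set G} (hY : IsMinInv (Set.range u) Γ Y)
    (hK : IsCompact K) (hret : ∀ y ∈ Y, ∀ T, ∃ t, T ≤ t ∧ ∃ γ ∈ Γ, u t * y * γ ∈ K) :
    ∃ L, IsCompact L ∧ ∀ y ∈ Y, ∃ γ ∈ Γ, y * γ ∈ L := by
  have h0 : u 0 = 1 := by have := hadd 0 0; simpa using this
  obtain ⟨K', hK', hsub⟩ := exists_compact_superset hK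
  obtain ⟨F, hF⟩ := (hK'.inter_right hY.closed).elim_finite_subcover
    (fun p : {t : ℝ // 1 ≤ t} × Γ => (fun y => u p.1 * y * p.2) ⁻¹' interior K')
    (fun p => isOpen_interior.preimage (by fun_prop))
    (fun y hy => by
      obtain ⟨t, ht, γ, hγ, hk⟩ := hret y hy.2 1
      exact Set.mem_iUnion.mpr ⟨⟨⟨t, ht⟩, ⟨γ, hγ⟩⟩, hsub hk⟩)
  obtain ⟨T, hT⟩ : ∃ T : ℝ, ∀ p ∈ F, (p.1 : ℝ) ≤ T := by
    obtain ⟨T, hT⟩ := (F.image fun p => (p.1 : ℝ)).bddAbove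
    exact ⟨T, fun p hp => hT (Finset.mem_coe.mpr (Finset.mem_image_of_mem _ hp))⟩
  have step : ∀ y ∈ K' ∩ Y, ∃ t, 1 ≤ t ∧ t ≤ T ∧ ∃ γ ∈ Γ, u t * y * γ ∈ K' ∩ Y := fun y hy => by
    obtain ⟨p, hp, h⟩ := Set.mem_iUnion₂.mp (hF hy)
    exact ⟨p.1, p.1.2, hT p hp, p.2, p.2.2, interior_subset h,
      hY.right _ p.2.2 _ (hY.left _ ⟨_, rfl⟩ y hy.2)⟩
  set L := (fun p : ℝ × G => u p.1 * p.2) '' (Set.Icc 0 T ×ˢ K') with hL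
  have hLc : IsCompact L := (isCompact_Icc.prod hK').image (by fun_prop)
  have main : ∀ n : ℕ, ∀ t : ℝ, 0 ≤ t → t ≤ n → ∀ y ∈ K' ∩ Y, ∃ γ ∈ Γ, u t * y * γ ∈ L := by
    intro n
    induction n with
    | zero =>
      intro t h1 h2 y hy
      obtain ⟨t', h3, h4, -⟩ := step y hy
      have : t = 0 := le_antisymm (by simpa using h2) h1
      exact ⟨1, Γ.one_mem, (t, y), ⟨⟨h1, by linarith⟩, hy.1⟩, by simp⟩
    | succ n ih =>
      intro t h1 h2 y hy
      obtain ⟨s, h3, h4, γ, hγ, hk⟩ := step y hy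
      rcases le_or_gt t T with h | h
      · exact ⟨1, Γ.one_mem, (t, y), ⟨⟨h1, h⟩, hy.1⟩, by simp⟩
      · push_cast at h2
        obtain ⟨δ, hδ, hl⟩ := ih (t - s) (by linarith) (by linarith) _ hk
        refine ⟨γ * δ, Γ.mul_mem hγ hδ, ?_⟩
        have : u t = u (t - s) * u s := by rw [← hadd, sub_add_cancel]
        rw [this]
        simpa [mul_assoc] using hl
  obtain ⟨y₀, hy₀⟩ := hY.nonempty
  obtain ⟨t₀, -, γ₀, hγ₀, hk₀⟩ := hret y₀ hy₀ 0
  have hy₁ : u t₀ * y₀ * γ₀ ∈ K' ∩ Y :=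
    ⟨interior_subset (hsub hk₀), hY.right _ hγ₀ _ (hY.left _ ⟨_, rfl⟩ _ hy₀)⟩
  refine ⟨L, hLc, fun z hz => ?_⟩
  have hcl := hY.mem_closure_dorbit hK (A := fun n => u '' Set.Ici (n : ℝ))
    (fun i j hij => Set.image_mono (Set.Ici_subset_Ici.mpr (by exact_mod_cast hij)))
    (fun n => Set.image_subset_range _ _)
    (by
      rintro _ ⟨s, rfl⟩ n
      obtain ⟨m, hm⟩ := exists_nat_ge (n - s)
      refine ⟨m, ?_⟩
      rintro _ ⟨t, ht, rfl⟩
      exact ⟨s + t, by simp at ht ⊢; linarith, hadd s t⟩)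
    hy₁.2 (fun n => by
      obtain ⟨t, ht, γ, hγ, hk⟩ := hret _ hy₁.2 n
      exact ⟨_, ⟨t, ht, rfl⟩, γ, hγ, hk⟩) hz 0
  have hclosed : IsClosed (L * (Γ : Set G)) := hΓ.mul_left_of_isCompact hLc
  have : dorbit (u '' Set.Ici ((0 : ℕ) : ℝ)) Γ (u t₀ * y₀ * γ₀) ⊆ L * (Γ : Set G) := by
    rintro _ ⟨_, ⟨t, ht, rfl⟩, γ, hγ, rfl⟩
    obtain ⟨n, hn⟩ := exists_nat_ge t
    obtain ⟨δ, hδ, hl⟩ := main n t (by simpa using ht) hn _ hy₁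
    exact ⟨_, hl, δ⁻¹ * γ, Γ.mul_mem (Γ.inv_mem hδ) hγ, by simp [mul_assoc]⟩
  obtain ⟨l, hl, γ, hγ, e⟩ := closure_minimal this hclosed hcl
  exact ⟨γ⁻¹, Γ.inv_mem hγ, by rw [← e]; simpa using hl⟩

end Minimal

instance : LocallyCompactSpace G4 :=
  have : LocallyCompactSpace (Matrix (Fin 4) (Fin 4) ℝ) :=
    inferInstanceAs (LocallyCompactSpace (Fin 4 → Fin 4 → ℝ))
  (Matrix.SpecialLinearGroup.isClosedEmbedding_val (n := Fin 4) (R := ℝ)).locallyCompactSpace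

instance : FirstCountableTopology G4 :=
  have : FirstCountableTopology (Matrix (Fin 4) (Fin 4) ℝ) :=
    inferInstanceAs (FirstCountableTopology (Fin 4 → Fin 4 → ℝ))
  (Matrix.SpecialLinearGroup.isClosedEmbedding_val (n := Fin 4)
    (R := ℝ)).isInducing.firstCountableTopology

end IrratQuad

namespace IrratQuad

open Matrix Topology Filter

/-- Quadratic polynomials in three variables, represented by square matrices of size four. -/
abbrev M4 := Matrix (Fin 4) (Fin 4) ℝ

/-- The value of the quadratic form of `p`. -/
def qv (p : M4) (z : Fin 4 → ℝ) : ℝ := z ⬝ᵥ p *ᵥ z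

/-- Change of variables. -/
def pull (p : M4) (a : G4) : M4 := (a : M4)ᵀ * p * (a : M4)

/-- The matrix of `2 x₀ x₂ - x₁²`. -/
def jm : M4 := !![0, 0, 1, 0; 0, -1, 0, 0; 1, 0, 0, 0; 0, 0, 0, 0]

/-- The matrix of `2 s x₂² + 2 β x₂`. -/
def tm (s β : ℝ) : M4 := !![0, 0, 0, 0; 0, 0, 0, 0; 0, 0, 2 * s, β; 0, 0, β, 0]

/-- The matrix of the constant polynomial `1`. -/
def em : M4 := !![0, 0, 0, 0; 0, 0, 0, 0; 0, 0, 0, 0; 0, 0, 0, 1]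

/-- The nilpotent generator of the unipotent flow. -/
def nm : M4 := !![0, 1, 0, 0; 0, 0, 1, 0; 0, 0, 0, 0; 0, 0, 0, 0]

/-- The derivation given by the unipotent flow. -/
def der : M4 →ₗ[ℝ] M4 where
  toFun p := nmᵀ * p + p * nm
  map_add' p q := by rw [mul_add, add_mul]; abel
  map_smul' c p := by simp

lemma der_apply (p : M4) : der p = nmᵀ * p + p * nm := rfl

lemma der_eq (p : M4) : der p = !![0, p 0 0, p 0 1, 0; p 0 0, p 0 1 + p 1 0, p 0 2 + p 1 1, p 0 3;
    p 1 0, p 1 1 + p 2 0, p 1 2 + p 2 1, p 1 3; 0, p 3 0, p 3 1, 0] := by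
  rw [der_apply, nm]
  ext i j; fin_cases i <;> fin_cases j <;>
    simp [Matrix.mul_apply, Fin.sum_univ_four]

lemma pull_mul (p : M4) (a b : G4) : pull p (a * b) = pull (pull p a) b := by
  simp [pull, Matrix.mul_assoc]

lemma pull_one (p : M4) : pull p 1 = p := by simp [pull]

lemma pull_add (p q : M4) (a : G4) : pull (p + q) a = pull p a + pull q a := by
  simp [pull, Matrix.mul_add, Matrix.add_mul]

lemma pull_smul (c : ℝ) (p : M4) (a : G4) : pull (c • p) a = c • pull p a := by
  simp [pull]

lemma transpose_pull (p : M4) (a : G4) : (pull p a)ᵀ = pull pᵀ a := by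
  simp [pull, Matrix.mul_assoc]

lemma transpose_jm : jmᵀ = jm := by
  ext i j; fin_cases i <;> fin_cases j <;> simp [jm]

lemma transpose_tm (s β : ℝ) : (tm s β)ᵀ = tm s β := by
  ext i j; fin_cases i <;> fin_cases j <;> simp [tm]

lemma pull_jm_un (t : ℝ) : pull jm (un t) = jm := by
  rw [pull, coe_un]
  ext i j; fin_cases i <;> fin_cases j <;> simp [jm, Matrix.mul_apply, Fin.sum_univ_four]
  ring

lemma pull_jm_dg (t : ℝ) : pull jm (dg t) = jm := by
  rw [pull, coe_dg]
  ext i j; fin_cases i <;> fin_cases j <;>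
    simp [jm, Matrix.mul_apply, Fin.sum_univ_four, ← Real.exp_add]

lemma pull_tm_un (s β t : ℝ) : pull (tm s β) (un t) = tm s β := by
  rw [pull, coe_un]
  ext i j; fin_cases i <;> fin_cases j <;> simp [tm, Matrix.mul_apply, Fin.sum_univ_four]

lemma pull_tm_dg (s β t : ℝ) : pull (tm s β) (dg t) =
    tm (Real.exp (-t) ^ 2 * s) (Real.exp (-t) * β) := by
  rw [pull, coe_dg]
  ext i j; fin_cases i <;> fin_cases j <;>
    simp [tm, Matrix.mul_apply, Fin.sum_univ_four] <;> ring

lemma pull_em {a : G4} (ha : a ∈ affineGroup) : pull em a = em := by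
  obtain ⟨h0, h1, h2, h3⟩ := mem_affineGroup.mp ha
  rw [pull]
  ext i j; fin_cases i <;> fin_cases j <;>
    simp [em, Matrix.mul_apply, Fin.sum_univ_four, h0, h1, h2, h3]

lemma pull_un (p : M4) (t : ℝ) : pull p (un t) = p + t • der p + (t ^ 2 / 2) • der (der p) +
    (t ^ 3 / 6) • der (der (der p)) + (t ^ 4 / 24) • der (der (der (der p))) := by
  rw [pull, coe_un]
  simp only [der_eq]
  ext i j; fin_cases i <;> fin_cases j <;>
    simp [Matrix.mul_apply, Fin.sum_univ_four] <;> ring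

lemma der_five (p : M4) : der (der (der (der (der p)))) = 0 := by
  simp only [der_eq]
  ext i j; fin_cases i <;> fin_cases j <;> simp

lemma der_jm : der jm = 0 := by
  simp only [der_apply, nm, jm]
  ext i j; fin_cases i <;> fin_cases j <;>
    simp [Matrix.mul_apply, Fin.sum_univ_four]

lemma der_tm (s β : ℝ) : der (tm s β) = 0 := by
  simp only [der_apply, nm, tm]
  ext i j; fin_cases i <;> fin_cases j <;>
    simp [Matrix.mul_apply, Fin.sum_univ_four]

lemma der_trace (p : M4) : der p 0 2 + der p 2 0 - der p 1 1 = 0 ∧ der p 3 3 = 0 := by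
  rw [der_eq]
  constructor <;> simp

lemma eq_of_der_eq_zero {p : M4} (hp : pᵀ = p) (h : der p = 0) :
    p = p 0 2 • jm + tm (p 2 2 / 2) (p 2 3) + p 3 3 • em := by
  have hs : ∀ i j, p i j = p j i := fun i j => congrFun (congrFun hp.symm i) j
  have H : ∀ i j, (nmᵀ * p + p * nm) i j = 0 := fun i j => congrFun (congrFun h i) j
  have h01 := H 0 1
  have h02 := H 0 2
  have h11 := H 1 1
  have h12 := H 1 2
  have h22 := H 2 2
  have h13 := H 1 3
  have h23 := H 2 3
  simp [nm, Matrix.mul_apply, Fin.sum_univ_four] at h01 h02 h11 h12 h22 h13 h23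
  have := hs 1 0
  have := hs 2 0
  have := hs 2 1
  have := hs 3 0
  have := hs 3 1
  have := hs 3 2
  ext i j; fin_cases i <;> fin_cases j <;> simp [jm, tm, em] <;> linarith

lemma det_pull (p : M4) (a : G4) : (pull p a).det = p.det := by
  simp [pull, Matrix.det_mul, Matrix.det_transpose, a.det_coe]

/-- A pullback of the standard form that is invariant under the unipotent flow. -/
lemma exists_of_der_pull_eq_zero {a : G4} (ha : a ∈ affineGroup) (h : der (pull jm a) = 0) :
    ∃ s β, pull jm a = jm + tm s β := by
  set p := pull jm a with hp
  have hs : pᵀ = p := by rw [hp, transpose_pull, transpose_jm]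
  have e := eq_of_der_eq_zero hs h
  have hdet : ∀ x : ℝ, (p + x • em).det = x := fun x => by
    have : p + x • em = pull (jm + x • em) a := by rw [pull_add, pull_smul, pull_em ha]
    rw [this, det_pull]
    simp [jm, em, Matrix.det_succ_row_zero, Fin.sum_univ_succ, Fin.succAbove]
  have hdet' : ∀ x : ℝ, (p + x • em).det = (p 3 3 + x) * p 0 2 ^ 3 := fun x => by
    rw [e]
    simp [jm, em, tm, Matrix.det_succ_row_zero, Fin.sum_univ_succ, Fin.succAbove]
    ring
  have h0 := (hdet 0).symm.trans (hdet' 0)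
  have h1 := (hdet 1).symm.trans (hdet' 1)
  have hc : p 0 2 ^ 3 = 1 := by linarith
  have hc1 : p 0 2 = 1 := by
    have : (p 0 2 - 1) * (p 0 2 ^ 2 + p 0 2 + 1) = 0 := by linear_combination hc
    rcases mul_eq_zero.mp this with h | h
    · linarith
    · nlinarith [sq_nonneg (p 0 2 + 1 / 2)]
  have h33 : p 3 3 = 0 := by rw [hc] at h0; linarith
  exact ⟨p 2 2 / 2, p 2 3, by rw [e, hc1, h33]; simp [jm, tm, em]⟩

lemma qv_pull (p : M4) (a : G4) (z : Fin 4 → ℝ) : qv (pull p a) z = qv p ((a : M4) *ᵥ z) := by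
  simp only [qv, pull]
  rw [Matrix.mul_assoc, ← Matrix.mulVec_mulVec, Matrix.dotProduct_mulVec, Matrix.vecMul_transpose,
    ← Matrix.mulVec_mulVec]

/-- The polynomial of `p` takes values in `S` on the affine lattice of `y`. -/
def Good (S : Set ℝ) (p : M4) (y : G4) : Prop :=
  ∀ m : Fin 4 → ℤ, m 3 = 1 → qv p ((y : M4) *ᵥ toR m) ∈ S

lemma good_mul {S : Set ℝ} {p : M4} {a y : G4} : Good S p (a * y) ↔ Good S (pull p a) y := by
  simp [Good, qv_pull, Matrix.mulVec_mulVec]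

lemma Good.mul_lattice {S : Set ℝ} {p : M4} {y γ : G4} (h : Good S p y) (hγ : γ ∈ latticeGroup) :
    Good S p (y * γ) := by
  intro m hm
  obtain ⟨hA, hI⟩ := mem_latticeGroup_iff.mp hγ
  obtain ⟨h0, h1, h2, h3⟩ := mem_affineGroup.mp hA
  choose k hk using hI
  have e : (γ : M4) *ᵥ toR m = toR (Matrix.of k *ᵥ m) := by
    ext i
    simp [Matrix.mulVec, dotProduct, hk]
  rw [Matrix.SpecialLinearGroup.coe_mul, ← Matrix.mulVec_mulVec, e]
  refine h _ ?_
  have : ((γ : M4) *ᵥ toR m) 3 = 1 := by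
    simp [Matrix.mulVec, dotProduct, Fin.sum_univ_four, h0, h1, h2, h3, hm]
  rw [e] at this
  simpa using this

lemma continuous_coe_G4 : Continuous fun g : G4 => (g : M4) := continuous_subtype_val

lemma continuous_pull : Continuous fun x : M4 × G4 => pull x.1 x.2 := by
  have := continuous_coe_G4
  unfold pull
  fun_prop

lemma isClosed_good {S : Set ℝ} (hS : IsClosed S) : IsClosed {x : M4 × G4 | Good S x.1 x.2} := by
  have e : {x : M4 × G4 | Good S x.1 x.2} = ⋂ m : Fin 4 → ℤ, ⋂ _ : m 3 = 1,
      (fun x : M4 × G4 => qv x.1 ((x.2 : M4) *ᵥ toR m)) ⁻¹' S := by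
    ext x; simp [Good]
  rw [e]
  refine isClosed_iInter fun m => isClosed_iInter fun _ => hS.preimage ?_
  have := continuous_coe_G4
  unfold qv
  fun_prop

lemma Good.of_tendsto {S : Set ℝ} (hS : IsClosed S) {ι : Type*} {l : Filter ι} [l.NeBot]
    {p : ι → M4} {y : ι → G4} {p₀ : M4} {y₀ : G4} (hp : Tendsto p l (𝓝 p₀))
    (hy : Tendsto y l (𝓝 y₀)) (h : ∀ i, Good S (p i) (y i)) : Good S p₀ y₀ :=
  (isClosed_good hS).mem_of_tendsto (hp.prodMk_nhds hy) (Eventually.of_forall h)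

lemma qv_jm_add_tm (s β : ℝ) {z : Fin 4 → ℝ} (hz : z 3 = 1) :
    qv (jm + tm s β) z = 2 * z 0 * z 2 - z 1 ^ 2 + 2 * s * z 2 ^ 2 + 2 * β * z 2 := by
  simp [qv, jm, tm, Matrix.mulVec, dotProduct, Fin.sum_univ_four, hz]
  ring

lemma affine_mulVec_three {y : G4} (hy : y ∈ affineGroup) {m : Fin 4 → ℤ} (hm : m 3 = 1) :
    ((y : M4) *ᵥ toR m) 3 = 1 := by
  obtain ⟨h0, h1, h2, h3⟩ := mem_affineGroup.mp hy
  simp [Matrix.mulVec, dotProduct, Fin.sum_univ_four, h0, h1, h2, h3, hm]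

end IrratQuad

namespace IrratQuad

open Matrix Topology Filter

lemma affine_mulVec_castSucc {y : G4} {z z' : Fin 4 → ℝ} (i : Fin 4) :
    ((y : M4) *ᵥ z) i - ((y : M4) *ᵥ z') i = ∑ j, y i j * (z j - z' j) := by
  simp [Matrix.mulVec, dotProduct, Fin.sum_univ_four]; ring

/-- Affine lattices are relatively dense. -/
lemma exists_grid_near {y : G4} (hy : y ∈ affineGroup) : ∃ D, 0 < D ∧ ∀ w : Fin 4 → ℝ, w 3 = 1 →
    ∃ m : Fin 4 → ℤ, m 3 = 1 ∧ ∀ i, |((y : M4) *ᵥ toR m) i - w i| ≤ D := by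
  obtain ⟨R, hR⟩ := exists_mem_box y
  have hR0 : 0 ≤ R := (abs_nonneg _).trans (hR 0 0)
  refine ⟨4 * R + 1, by linarith, fun w hw => ?_⟩
  set v := (y⁻¹ : G4).1 *ᵥ w with hv
  have hyv : (y : M4) *ᵥ v = w := by
    rw [hv, Matrix.mulVec_mulVec]
    have : (y : M4) * (y⁻¹ : G4).1 = 1 := by
      rw [← Matrix.SpecialLinearGroup.coe_mul, mul_inv_cancel, Matrix.SpecialLinearGroup.coe_one]
    rw [this, Matrix.one_mulVec]
  obtain ⟨h0, h1, h2, h3⟩ := mem_affineGroup.mp (affineGroup.inv_mem hy)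
  have hv3 : v 3 = 1 := by
    have : v 3 = ∑ j, (y⁻¹ : G4) 3 j * w j := rfl
    rw [this, Fin.sum_univ_four, h0, h1, h2, h3, hw]; ring
  refine ⟨fun j => ⌊v j⌋, by simp [hv3], fun i => ?_⟩
  rw [← hyv, affine_mulVec_castSucc]
  have hj : ∀ j, |y i j * (toR (fun j => ⌊v j⌋) j - v j)| ≤ R := fun j => by
    rw [abs_mul]
    have h1 : |toR (fun j => ⌊v j⌋) j - v j| ≤ 1 := by
      rw [toR_apply, abs_le]
      constructor <;> linarith [Int.floor_le (v j), Int.lt_floor_add_one (v j)]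
    calc _ ≤ R * 1 := mul_le_mul (hR i j) h1 (abs_nonneg _) hR0
      _ = R := mul_one R
  calc _ ≤ ∑ j, |y i j * (toR (fun j => ⌊v j⌋) j - v j)| := Finset.abs_sum_le_sum_abs _ _
    _ ≤ ∑ _j : Fin 4, R := Finset.sum_le_sum fun j _ => hj j
    _ ≤ _ := by simp

/-- Grid points in prescribed parts of the space. -/
lemma exists_grid_signs {y : G4} (hy : y ∈ affineGroup) (B σ τ : ℝ) (hσ : σ ^ 2 = 1)
    (hτ : τ ^ 2 = 1) : ∃ m : Fin 4 → ℤ, m 3 = 1 ∧ ∃ x q : ℝ, 1 < σ * x ∧ B < τ * q ∧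
      ∀ s β, qv (jm + tm s β) ((y : M4) *ᵥ toR m) = q + 2 * s * x ^ 2 + 2 * β * x := by
  obtain ⟨D, hD, H⟩ := exists_grid_near hy
  set X := D + D ^ 2 + |B| + 1 with hX
  obtain ⟨m, hm, h⟩ := H ![σ * τ * X, 0, σ * (D + 2), 1] (by simp)
  set z := (y : M4) *ᵥ toR m with hz
  have e0 := abs_le.mp (h 0)
  have e1 := abs_le.mp (h 1)
  have e2 := abs_le.mp (h 2)
  simp only [Matrix.cons_val_zero, Matrix.cons_val_one, Matrix.cons_val, sub_zero] at e0 e1 e2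
  have hBa := le_abs_self B
  have hB0 := abs_nonneg B
  refine ⟨m, hm, z 2, 2 * z 0 * z 2 - z 1 ^ 2, ?_, ?_, fun s β =>
    qv_jm_add_tm s β (affine_mulVec_three hy hm)⟩
  · have : σ = 1 ∨ σ = -1 := sq_eq_one_iff.mp hσ
    rcases this with rfl | rfl <;> linarith
  · have hz1 : z 1 ^ 2 ≤ D ^ 2 := sq_le_sq' e1.1 e1.2
    have key : ∀ a b : ℝ, X - D ≤ a → 2 ≤ b → B + D ^ 2 < 2 * a * b := fun a b ha hb => by
      have : 0 ≤ a := by nlinarith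
      nlinarith
    have hσ' : σ = 1 ∨ σ = -1 := sq_eq_one_iff.mp hσ
    have hτ' : τ = 1 ∨ τ = -1 := sq_eq_one_iff.mp hτ
    rcases hσ' with rfl | rfl <;> rcases hτ' with rfl | rfl
    · have := key (z 0) (z 2) (by linarith) (by linarith); linarith
    · have := key (-z 0) (z 2) (by linarith) (by linarith); linarith [sq_nonneg (z 1)]
    · have := key (-z 0) (-z 2) (by linarith) (by linarith); linarith
    · have := key (z 0) (-z 2) (by linarith) (by linarith); linarith [sq_nonneg (z 1)]

lemma abs_le_of_four {x₁ x₂ x₃ x₄ s β A : ℝ} (hx₁ : 1 < 1 * x₁) (hx₂ : 1 < -1 * x₂)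
    (hx₃ : 1 < 1 * x₃) (hx₄ : 1 < -1 * x₄) (h1 : 2 * s * x₁ ^ 2 + 2 * β * x₁ < 2 * A)
    (h2 : 2 * s * x₂ ^ 2 + 2 * β * x₂ < 2 * A) (h3 : -(2 * A) < 2 * s * x₃ ^ 2 + 2 * β * x₃)
    (h4 : -(2 * A) < 2 * s * x₄ ^ 2 + 2 * β * x₄) :
    |s| ≤ |A| ∧ |β| ≤ |A| + |A| * (|x₁| + |x₂|) := by
  have hA0 := abs_nonneg A
  have hA1 := le_abs_self A
  set B := |A|
  have up : ∀ x u : ℝ, 1 < x → x * u < B → u ≤ B := fun x u hx h => by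
    by_contra! hc
    nlinarith
  have d1 := up x₁ (s * x₁ + β) (by linarith) (by linarith)
  have d2 := up (-x₂) (s * (-x₂) - β) (by linarith) (by linarith)
  have d3 := up x₃ (-(s * x₃ + β)) (by linarith) (by linarith)
  have d4 := up (-x₄) (-(s * (-x₄) - β)) (by linarith) (by linarith)
  have s1 : s ≤ B := by
    by_contra! hc
    nlinarith [mul_pos (sub_pos.mpr hc) (show 0 < x₁ - x₂ by linarith)]
  have s2 : -B ≤ s := by
    by_contra! hc
    nlinarith [mul_pos (sub_pos.mpr hc) (show 0 < x₃ - x₄ by linarith)]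
  have hs : |s| ≤ B := abs_le.mpr ⟨s2, s1⟩
  have e1 : |s * x₁| ≤ B * |x₁| := by rw [abs_mul]; gcongr
  have e2 : |s * x₂| ≤ B * |x₂| := by rw [abs_mul]; gcongr
  have f1 := abs_le.mp (le_refl |s * x₁|)
  have f2 := abs_le.mp (le_refl |s * x₂|)
  exact ⟨hs, abs_le.mpr ⟨by linarith, by linarith⟩⟩

/-- A property of the perturbations `(s, β)` which is stable under small steps through
perturbations taking values in `S`, and which bounds the perturbation. -/
theorem exists_barrier {S : Set ℝ} (hS : IsClosed S) (hne : S ≠ Set.univ) {y : G4}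
    (hy : y ∈ affineGroup) : ∃ (P : ℝ → ℝ → Prop) (R ε : ℝ), 0 < ε ∧
      (∀ s β, |s| ≤ ε → |β| ≤ ε → P s β) ∧ (∀ s β, P s β → |s| ≤ R ∧ |β| ≤ R) ∧
      ∀ s β s' β', Good S (jm + tm s β) y → Good S (jm + tm s' β') y → P s β →
        |s - s'| ≤ ε → |β - β'| ≤ ε → P s' β' := by
  obtain ⟨r, hr⟩ := (Set.ne_univ_iff_exists_notMem S).mp hne
  obtain ⟨η, hη, hball⟩ := Metric.isOpen_iff.mp hS.isOpen_compl r hr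
  have hgap : ∀ v ∈ S, η ≤ |v - r| := fun v hv => by
    by_contra! h
    exact hball (Metric.mem_ball.mpr (by rwa [Real.dist_eq])) hv
  obtain ⟨m₁, hm₁, x₁, q₁, hx₁, hq₁, F₁⟩ := exists_grid_signs hy (|r| + 1) 1 (-1) (by norm_num)
    (by norm_num)
  obtain ⟨m₂, hm₂, x₂, q₂, hx₂, hq₂, F₂⟩ := exists_grid_signs hy (|r| + 1) (-1) (-1) (by norm_num)
    (by norm_num)
  obtain ⟨m₃, hm₃, x₃, q₃, hx₃, hq₃, F₃⟩ := exists_grid_signs hy (|r| + 1) 1 1 (by norm_num)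
    (by norm_num)
  obtain ⟨m₄, hm₄, x₄, q₄, hx₄, hq₄, F₄⟩ := exists_grid_signs hy (|r| + 1) (-1) 1 (by norm_num)
    (by norm_num)
  have r1 := neg_abs_le r
  have r2 := le_abs_self r
  set K := (2 * x₁ ^ 2 + 2 * |x₁|) + (2 * x₂ ^ 2 + 2 * |x₂|) + (2 * x₃ ^ 2 + 2 * |x₃|) +
    (2 * x₄ ^ 2 + 2 * |x₄|) + 1 with hK
  have p1 : 0 ≤ 2 * x₁ ^ 2 + 2 * |x₁| := by positivity
  have p2 : 0 ≤ 2 * x₂ ^ 2 + 2 * |x₂| := by positivity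
  have p3 : 0 ≤ 2 * x₃ ^ 2 + 2 * |x₃| := by positivity
  have p4 : 0 ≤ 2 * x₄ ^ 2 + 2 * |x₄| := by positivity
  have hK0 : 0 < K := by linarith
  set ε := min 1 (η / 2) / K with hε
  have hε0 : 0 < ε := by positivity
  have hεK : K * ε = min 1 (η / 2) := by rw [hε]; field_simp
  have small : ∀ x s β : ℝ, 2 * x ^ 2 + 2 * |x| ≤ K → |s| ≤ ε → |β| ≤ ε →
      |2 * s * x ^ 2 + 2 * β * x| ≤ min 1 (η / 2) := fun x s β hx hs hβ => by
    rw [← hεK]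
    calc _ ≤ |2 * s * x ^ 2| + |2 * β * x| := abs_add_le _ _
      _ = 2 * x ^ 2 * |s| + 2 * |x| * |β| := by
        rw [abs_mul, abs_mul, abs_mul, abs_mul, abs_two, abs_of_nonneg (sq_nonneg x)]; ring
      _ ≤ 2 * x ^ 2 * ε + 2 * |x| * ε := by gcongr
      _ = (2 * x ^ 2 + 2 * |x|) * ε := by ring
      _ ≤ K * ε := by gcongr
  have b1 : 2 * x₁ ^ 2 + 2 * |x₁| ≤ K := by linarith
  have b2 : 2 * x₂ ^ 2 + 2 * |x₂| ≤ K := by linarith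
  have b3 : 2 * x₃ ^ 2 + 2 * |x₃| ≤ K := by linarith
  have b4 : 2 * x₄ ^ 2 + 2 * |x₄| ≤ K := by linarith
  set A := |r - q₁| + |r - q₂| + |r - q₃| + |r - q₄| with hA
  refine ⟨fun s β => q₁ + 2 * s * x₁ ^ 2 + 2 * β * x₁ < r ∧ q₂ + 2 * s * x₂ ^ 2 + 2 * β * x₂ < r ∧
    r < q₃ + 2 * s * x₃ ^ 2 + 2 * β * x₃ ∧ r < q₄ + 2 * s * x₄ ^ 2 + 2 * β * x₄,
    |A| + |A| * (|x₁| + |x₂|), ε, hε0, ?_, ?_, ?_⟩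
  · intro s β hs hβ
    have s1 := abs_le.mp ((small x₁ s β b1 hs hβ).trans (min_le_left _ _))
    have s2 := abs_le.mp ((small x₂ s β b2 hs hβ).trans (min_le_left _ _))
    have s3 := abs_le.mp ((small x₃ s β b3 hs hβ).trans (min_le_left _ _))
    have s4 := abs_le.mp ((small x₄ s β b4 hs hβ).trans (min_le_left _ _))
    refine ⟨?_, ?_, ?_, ?_⟩ <;> linarith
  · rintro s β ⟨h1, h2, h3, h4⟩
    suffices H : |s| ≤ |A| ∧ |β| ≤ |A| + |A| * (|x₁| + |x₂|) from
      ⟨H.1.trans (le_add_of_nonneg_right (by positivity)), H.2⟩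
    refine abs_le_of_four (A := A) hx₁ hx₂ hx₃ hx₄ ?_ ?_ ?_ ?_ <;>
    linarith [abs_nonneg (r - q₁), abs_nonneg (r - q₂), abs_nonneg (r - q₃), abs_nonneg (r - q₄),
      le_abs_self (r - q₁), le_abs_self (r - q₂), neg_abs_le (r - q₃), neg_abs_le (r - q₄)]
  · rintro s β s' β' hG hG' ⟨h1, h2, h3, h4⟩ hs hβ
    have g1 := hgap _ (hG m₁ hm₁)
    have g2 := hgap _ (hG m₂ hm₂)
    have g3 := hgap _ (hG m₃ hm₃)
    have g4 := hgap _ (hG m₄ hm₄)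
    rw [F₁, abs_of_neg (by linarith)] at g1
    rw [F₂, abs_of_neg (by linarith)] at g2
    rw [F₃, abs_of_pos (by linarith)] at g3
    rw [F₄, abs_of_pos (by linarith)] at g4
    have s1 := abs_le.mp ((small x₁ _ _ b1 hs hβ).trans (min_le_right _ _))
    have s2 := abs_le.mp ((small x₂ _ _ b2 hs hβ).trans (min_le_right _ _))
    have s3 := abs_le.mp ((small x₃ _ _ b3 hs hβ).trans (min_le_right _ _))
    have s4 := abs_le.mp ((small x₄ _ _ b4 hs hβ).trans (min_le_right _ _))
    refine ⟨?_, ?_, ?_, ?_⟩ <;> linarith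

end IrratQuad

namespace IrratQuad

open Matrix Topology Filter

/-- The sum of the absolute values of the entries. -/
def mass (p : M4) : ℝ := ∑ i, ∑ k, |p i k|

lemma continuous_mass : Continuous mass := by
  unfold mass; fun_prop

lemma mass_nonneg (p : M4) : 0 ≤ mass p :=
  Finset.sum_nonneg fun _ _ => Finset.sum_nonneg fun _ _ => abs_nonneg _

lemma abs_le_mass (p : M4) (i k : Fin 4) : |p i k| ≤ mass p :=
  (Finset.single_le_sum (f := fun k => |p i k|) (fun _ _ => abs_nonneg _)
    (Finset.mem_univ k)).trans
  (Finset.single_le_sum (f := fun i => ∑ k, |p i k|)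
    (fun _ _ => Finset.sum_nonneg fun _ _ => abs_nonneg _) (Finset.mem_univ i))

lemma mass_smul (c : ℝ) (p : M4) : mass (c • p) = |c| * mass p := by
  simp [mass, abs_mul, Finset.mul_sum]

lemma mass_zero : mass 0 = 0 := by simp [mass]

lemma mass_pos {p : M4} (hp : p ≠ 0) : 0 < mass p := by
  obtain ⟨i, k, h⟩ : ∃ i k, p i k ≠ 0 := by
    by_contra! h
    exact hp (by ext i k; exact h i k)
  exact (abs_pos.mpr h).trans_le (abs_le_mass p i k)

lemma continuous_der : Continuous der := by
  have : (der : M4 → M4) = fun p => nmᵀ * p + p * nm := rfl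
  rw [this]; fun_prop

/-- The homogeneous components of the orbit of `p` under the unipotent flow. -/
noncomputable def expo (p : M4) (t : ℝ) : Fin 4 → M4 := ![t • der p, (t ^ 2 / 2) • der (der p),
  (t ^ 3 / 6) • der (der (der p)), (t ^ 4 / 24) • der (der (der (der p)))]

lemma pull_un_eq (p : M4) (t : ℝ) : pull p (un t) = p + ∑ j, expo p t j := by
  rw [pull_un, Fin.sum_univ_four]
  simp [expo, add_assoc]

lemma expo_mul (p : M4) (τ t : ℝ) (j : Fin 4) :
    expo p (τ * t) j = τ ^ (j.val + 1) • expo p t j := by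
  fin_cases j <;> simp [expo, smul_smul] <;> congr 1 <;> ring

lemma der_expo (p : M4) {t : ℝ} (ht : t ≠ 0) : der (expo p t 0) = t⁻¹ • (2 : ℝ) • expo p t 1 ∧
    der (expo p t 1) = t⁻¹ • (3 : ℝ) • expo p t 2 ∧
    der (expo p t 2) = t⁻¹ • (4 : ℝ) • expo p t 3 ∧ der (expo p t 3) = 0 := by
  refine ⟨?_, ?_, ?_, ?_⟩ <;> simp [expo, smul_smul, der_five] <;> congr 1 <;> field_simp <;> ring

lemma expo_trace (p : M4) (t : ℝ) (j : Fin 4) :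
    expo p t j 0 2 + expo p t j 2 0 - expo p t j 1 1 = 0 ∧ expo p t j 3 3 = 0 := by
  have aux : ∀ (c : ℝ) (p : M4), (c • der p) 0 2 + (c • der p) 2 0 - (c • der p) 1 1 = 0 ∧
      (c • der p) 3 3 = 0 := fun c p => by
    rw [← map_smul]; exact der_trace _
  fin_cases j <;> exact aux _ _

lemma transpose_der (p : M4) : (der p)ᵀ = der pᵀ := by
  simp [der_apply, add_comm]

lemma transpose_expo {p : M4} (hp : pᵀ = p) (t : ℝ) (j : Fin 4) : (expo p t j)ᵀ = expo p t j := by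
  fin_cases j <;> simp [expo, transpose_der, hp]

lemma continuous_expo (t : ℝ) (j : Fin 4) : Continuous fun p => expo p t j := by
  have := continuous_der
  fin_cases j <;> simp [expo] <;> fun_prop

lemma continuous_expo_right (p : M4) (j : Fin 4) : Continuous fun t => expo p t j := by
  fin_cases j <;> simp [expo] <;> fun_prop

/-- A limit of components of the flow is a perturbation in the centralizer directions. -/
lemma exists_tm_of_der_eq_zero {e : M4} (hs : eᵀ = e) (hd : der e = 0)
    (ht : e 0 2 + e 2 0 - e 1 1 = 0) (h3 : e 3 3 = 0) : ∃ s β, e = tm s β := by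
  have h := eq_of_der_eq_zero hs hd
  have h0 : e 2 0 = e 0 2 := congrFun (congrFun hs 0) 2
  have h1 : e 1 1 = -e 0 2 := by
    conv_lhs => rw [h]
    simp [jm, tm, em]
  have h02 : e 0 2 = 0 := by rw [h0, h1] at ht; linarith
  rw [h02, h3, zero_smul, zero_smul, zero_add, add_zero] at h
  exact ⟨_, _, h⟩

lemma coeff_eq_zero_of_bounded {s : Fin 4 → ℝ} {R : ℝ} {t : ℕ → ℝ} (ht : Tendsto t atTop atTop)
    (h : ∀ᶠ n in atTop, |∑ j, t n ^ (j.val + 1) * s j| ≤ R) (j : Fin 4) : s j = 0 := by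
  set P : Polynomial ℝ := ∑ j : Fin 4, Polynomial.C (s j) * Polynomial.X ^ (j.val + 1) with hP
  have hev : ∀ τ, P.eval τ = ∑ j, τ ^ (j.val + 1) * s j := fun τ => by
    simp only [hP, Polynomial.eval_finsetSum, Polynomial.eval_mul, Polynomial.eval_C,
      Polynomial.eval_pow, Polynomial.eval_X]
    exact Finset.sum_congr rfl fun _ _ => mul_comm _ _
  have hdeg : P.degree ≤ 0 := by
    by_contra! hd
    have := (P.abs_tendsto_atTop hd).comp ht
    obtain ⟨n, h1, h2⟩ := (h.and (this.eventually_gt_atTop R)).exists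
    rw [Function.comp_apply, hev] at h2
    exact absurd h1 (not_le.mpr h2)
  have hc : P.coeff (j.val + 1) = s j := by
    simp only [hP, Polynomial.finsetSum_coeff, Polynomial.coeff_C_mul, Polynomial.coeff_X_pow]
    fin_cases j <;> simp [Fin.sum_univ_four]
  rw [← hc]
  exact Polynomial.coeff_eq_zero_of_degree_lt (hdeg.trans_lt (by exact_mod_cast Nat.succ_pos _))

/-- Invariant polynomials that are good at one point of a minimal set are good everywhere. -/
lemma IsMinInv.good {S : Set ℝ} (hS : IsClosed S) {Y : Set G4}
    (hY : IsMinInv (Set.range un) latticeGroup Y) {p : M4} (hp : ∀ t, pull p (un t) = p)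
    {z : G4} (hz : z ∈ Y) (h : Good S p z) : ∀ y ∈ Y, Good S p y := by
  have : {y ∈ Y | Good S p y} = Y := by
    refine hY.eq_of_subset _ ⟨?_, ⟨z, hz, h⟩, ?_, ?_⟩ (Set.sep_subset _ _)
    · exact hY.closed.inter ((isClosed_good hS).preimage (f := fun y => (p, y)) (by fun_prop))
    · rintro _ ⟨t, rfl⟩ y ⟨hy, hg⟩
      exact ⟨hY.left _ ⟨t, rfl⟩ _ hy, good_mul.mpr (by rwa [hp])⟩
    · intro γ hγ y ⟨hy, hg⟩
      exact ⟨hY.right γ hγ _ hy, hg.mul_lattice hγ⟩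
  intro y hy
  rw [← this] at hy
  exact hy.2

lemma pull_jm_add_tm_un (s β t : ℝ) : pull (jm + tm s β) (un t) = jm + tm s β := by
  rw [pull_add, pull_jm_un, pull_tm_un]

lemma sum_smul_tm (c s β : Fin 4 → ℝ) :
    ∑ j, c j • tm (s j) (β j) = tm (∑ j, c j * s j) (∑ j, c j * β j) := by
  ext i k; fin_cases i <;> fin_cases k <;> simp [tm, Matrix.sum_apply, Finset.mul_sum]
  exact Finset.sum_congr rfl fun _ _ => by ring

instance : FirstCountableTopology M4 :=
  inferInstanceAs (FirstCountableTopology (Fin 4 → Fin 4 → ℝ))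

/-- Polynomials close to the standard one that are good at a point of a bounded minimal set are
invariant under the unipotent flow. -/
theorem IsMinInv.der_eventually_zero {S : Set ℝ} (hS : IsClosed S) (hne : S ≠ Set.univ)
    {Y L : Set G4} (hY : IsMinInv (Set.range un) latticeGroup Y) (hYA : Y ⊆ affineGroup)
    (hL : IsCompact L) (hLY : ∀ y ∈ Y, ∃ γ ∈ latticeGroup, y * γ ∈ L) {y : G4} (hy : y ∈ Y)
    {p : ℕ → M4} (hps : ∀ n, (p n)ᵀ = p n) (hp : Tendsto p atTop (𝓝 jm))
    (hg : ∀ n, Good S (p n) y) : ∃ n, der (p n) = 0 := by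
  by_contra! hd
  set f : M4 → ℝ → ℝ := fun q t => ∑ j, mass (expo q t j) with hf
  have hfc : ∀ q, Continuous (f q) := fun q => by
    have := continuous_mass
    have := continuous_expo_right q
    simp only [hf]; fun_prop
  have hfc' : ∀ t, Continuous fun q => f q t := fun t => by
    have := continuous_mass
    have := continuous_expo t
    simp only [hf]; fun_prop
  have ex : ∀ n, ∃ t, 0 < t ∧ f (p n) t = 1 := fun n => by
    have hm := mass_pos (hd n)
    have h1 : 1 ≤ f (p n) (mass (der (p n)))⁻¹ := by
      have : mass (expo (p n) (mass (der (p n)))⁻¹ 0) = 1 := by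
        simp only [expo, Matrix.cons_val_zero, mass_smul]
        rw [abs_of_pos (inv_pos.mpr hm), inv_mul_cancel₀ hm.ne']
      rw [← this]
      exact Finset.single_le_sum (f := fun j => mass (expo (p n) (mass (der (p n)))⁻¹ j))
        (fun _ _ => mass_nonneg _) (Finset.mem_univ 0)
    have h0 : f (p n) 0 = 0 := by
      refine Finset.sum_eq_zero fun j _ => ?_
      have := expo_mul (p n) 0 0 j
      rw [mul_zero, zero_pow (Nat.succ_ne_zero _), zero_smul] at this
      rw [this, mass_zero]
    obtain ⟨t, ht, h⟩ := intermediate_value_Icc (inv_pos.mpr hm).le (hfc (p n)).continuousOn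
      (show (1 : ℝ) ∈ Set.Icc _ _ from ⟨by rw [h0]; norm_num, h1⟩)
    refine ⟨t, lt_of_le_of_ne ht.1 ?_, h⟩
    rintro rfl
    rw [h0] at h; norm_num at h
  choose t ht0 ht1 using ex
  have htop : Tendsto t atTop atTop := by
    refine tendsto_atTop.mpr fun T => ?_
    have hT : (0 : ℝ) < max T 1 := lt_max_of_lt_right one_pos
    have h0 : Tendsto (fun n => f (p n) (max T 1)) atTop (𝓝 0) := by
      have := ((hfc' (max T 1)).tendsto jm).comp hp
      have h0 : f jm (max T 1) = 0 := by
        refine Finset.sum_eq_zero fun j _ => ?_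
        fin_cases j <;> simp [expo, der_jm, mass_zero]
      rwa [h0] at this
    filter_upwards [h0.eventually (gt_mem_nhds one_pos)] with n hn
    by_contra! hlt
    refine (ht1 n).not_lt (lt_of_le_of_lt (Finset.sum_le_sum fun j _ => ?_) hn)
    have e : t n = t n / max T 1 * max T 1 := by field_simp
    have h1 : t n / max T 1 ≤ 1 := (div_le_one hT).mpr (hlt.le.trans (le_max_left _ _))
    have h2 : 0 ≤ t n / max T 1 := div_nonneg (ht0 n).le hT.le
    rw [e, expo_mul, mass_smul, abs_of_nonneg (pow_nonneg h2 _)]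
    exact mul_le_of_le_one_left (mass_nonneg _) (pow_le_one₀ h2 h1)
  have hcpt0 : IsCompact {e : M4 | ∀ i k, e i k ∈ Set.Icc (-1 : ℝ) 1} := by
    have h : IsCompact {e : Fin 4 → Fin 4 → ℝ | ∀ i k, e i k ∈ Set.Icc (-1 : ℝ) 1} := by
      have := isCompact_univ_pi fun _ : Fin 4 => isCompact_univ_pi fun _ : Fin 4 =>
        isCompact_Icc (a := (-1 : ℝ)) (b := 1)
      convert this using 1
      ext e; simp only [Set.mem_pi, Set.mem_ofPred_eq, Set.mem_univ, true_imp_iff]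
    exact h
  have hcpt : IsCompact {e : Fin 4 → M4 | ∀ j i k, e j i k ∈ Set.Icc (-1 : ℝ) 1} := by
    have := isCompact_univ_pi fun _ : Fin 4 => hcpt0
    convert this using 1
    ext e; simp only [Set.mem_pi, Set.mem_ofPred_eq, Set.mem_univ, true_imp_iff]
  obtain ⟨E, -, φ, hφ, hE⟩ := hcpt.tendsto_subseq (x := fun n j => expo (p n) (t n) j)
    (fun n j i k => by
      change expo (p n) (t n) j i k ∈ _
      rw [Set.mem_Icc, ← abs_le, ← ht1 n]
      exact (abs_le_mass _ i k).trans (Finset.single_le_sum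
        (f := fun j => mass (expo (p n) (t n) j)) (fun _ _ => mass_nonneg _) (Finset.mem_univ j)))
  have hEj : ∀ j, Tendsto (fun n => expo (p (φ n)) (t (φ n)) j) atTop (𝓝 (E j)) := fun j =>
    ((continuous_apply j).tendsto E).comp hE
  have hinv : Tendsto (fun n => (t (φ n))⁻¹) atTop (𝓝 0) :=
    (tendsto_inv_atTop_zero.comp htop).comp hφ.tendsto_atTop
  have hmass : ∑ j, mass (E j) = 1 := by
    refine tendsto_nhds_unique (tendsto_finsetSum _ fun j _ =>
      (continuous_mass.tendsto _).comp (hEj j)) ?_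
    refine tendsto_const_nhds.congr fun n => (ht1 (φ n)).symm
  have hder : ∀ j, der (E j) = 0 := by
    have aux : ∀ (j k : Fin 4) (c : ℝ),
        (∀ n, der (expo (p n) (t n) j) = (t n)⁻¹ • c • expo (p n) (t n) k) → der (E j) = 0 := by
      intro j k c h
      refine tendsto_nhds_unique ((continuous_der.tendsto _).comp (hEj j)) ?_
      have := hinv.smul ((hEj k).const_smul c)
      rw [zero_smul] at this
      exact this.congr fun n => (h (φ n)).symm
    intro j
    fin_cases j
    · exact aux 0 1 2 fun n => (der_expo _ (ht0 n).ne').1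
    · exact aux 1 2 3 fun n => (der_expo _ (ht0 n).ne').2.1
    · exact aux 2 3 4 fun n => (der_expo _ (ht0 n).ne').2.2.1
    · exact aux 3 3 0 fun n => by rw [(der_expo _ (ht0 n).ne').2.2.2]; simp
  have hEs : ∀ j, (E j)ᵀ = E j := fun j => by
    refine tendsto_nhds_unique (((continuous_id.matrix_transpose).tendsto _).comp (hEj j)) ?_
    exact (hEj j).congr fun n => (transpose_expo (hps _) _ j).symm
  have hcoord : ∀ j i k, Tendsto (fun n => expo (p (φ n)) (t (φ n)) j i k) atTop (𝓝 (E j i k)) :=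
    fun j i k => ((continuous_apply k).tendsto _).comp
      (((continuous_apply i).tendsto _).comp (hEj j))
  have hEt : ∀ j, E j 0 2 + E j 2 0 - E j 1 1 = 0 ∧ E j 3 3 = 0 := fun j => by
    constructor
    · refine tendsto_nhds_unique (((hcoord j 0 2).add (hcoord j 2 0)).sub (hcoord j 1 1)) ?_
      exact tendsto_const_nhds.congr fun n => (expo_trace _ _ j).1.symm
    · refine tendsto_nhds_unique (hcoord j 3 3) ?_
      exact tendsto_const_nhds.congr fun n => (expo_trace _ _ j).2.symm
  have : ∀ j, ∃ s β, E j = tm s β := fun j =>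
    exists_tm_of_der_eq_zero (hEs j) (hder j) (hEt j).1 (hEt j).2
  choose s β hsβ using this
  have hgood : ∀ τ : ℝ, Good S (jm + tm (∑ j, τ ^ (j.val + 1) * s j)
      (∑ j, τ ^ (j.val + 1) * β j)) y := by
    intro τ
    have hmem : ∀ n, un (-(τ * t n)) * y ∈ Y := fun n => hY.left _ ⟨_, rfl⟩ _ hy
    choose γ hγ hγL using fun n => hLY _ (hmem n)
    obtain ⟨z, -, ψ, hψ, hz⟩ := hL.tendsto_subseq
      (x := fun n => un (-(τ * t (φ n))) * y * γ (φ n)) (fun n => hγL _)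
    have hzY : z ∈ Y := hY.closed.mem_of_tendsto hz
      (Eventually.of_forall fun n => hY.right _ (hγ _) _ (hmem _))
    refine hY.good hS (pull_jm_add_tm_un _ _) hzY ?_ y hy
    refine Good.of_tendsto hS (p := fun n => pull (p (φ (ψ n))) (un (τ * t (φ (ψ n))))) ?_ hz ?_
    · have h1 : Tendsto (fun n => p (φ n) + ∑ j, τ ^ (j.val + 1) • expo (p (φ n)) (t (φ n)) j)
          atTop (𝓝 (jm + ∑ j, τ ^ (j.val + 1) • E j)) :=
        (hp.comp hφ.tendsto_atTop).add (tendsto_finsetSum _ fun j _ => (hEj j).const_smul _)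
      rw [← sum_smul_tm]
      simp only [← hsβ]
      refine (h1.comp hψ.tendsto_atTop).congr fun n => ?_
      simp only [Function.comp_apply, pull_un_eq, expo_mul]
    · intro n
      refine Good.mul_lattice ?_ (hγ _)
      rw [← good_mul, ← mul_assoc, ← un_add, add_neg_cancel, un_zero, one_mul]
      exact hg _
  obtain ⟨P, R, ε, hε, hP0, hPR, hPstep⟩ := exists_barrier hS hne (hYA hy)
  set σ : ℝ → ℝ := fun τ => ∑ j, τ ^ (j.val + 1) * s j with hσ
  set ϑ : ℝ → ℝ := fun τ => ∑ j, τ ^ (j.val + 1) * β j with hϑ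
  have hσc : Continuous σ := by simp only [hσ]; fun_prop
  have hϑc : Continuous ϑ := by simp only [hϑ]; fun_prop
  have hnear : ∀ τ₀, ∀ᶠ τ in 𝓝 τ₀, |σ τ₀ - σ τ| ≤ ε ∧ |ϑ τ₀ - ϑ τ| ≤ ε := fun τ₀ => by
    have h1 := (hσc.tendsto τ₀).eventually (Metric.closedBall_mem_nhds _ hε)
    have h2 := (hϑc.tendsto τ₀).eventually (Metric.closedBall_mem_nhds _ hε)
    filter_upwards [h1, h2] with τ h1 h2
    rw [dist_comm, Real.dist_eq] at h1 h2
    exact ⟨h1, h2⟩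
  have hclopen : IsClopen {τ | P (σ τ) (ϑ τ)} := by
    constructor
    · rw [← isOpen_compl_iff, isOpen_iff_mem_nhds]
      intro τ₀ h0
      filter_upwards [hnear τ₀] with τ hτ h1
      exact h0 (hPstep _ _ _ _ (hgood τ) (hgood τ₀) h1 (by rw [abs_sub_comm]; exact hτ.1)
        (by rw [abs_sub_comm]; exact hτ.2))
    · rw [isOpen_iff_mem_nhds]
      intro τ₀ h0
      filter_upwards [hnear τ₀] with τ hτ
      exact hPstep _ _ _ _ (hgood τ₀) (hgood τ) h0 hτ.1 hτ.2
  have hall : ∀ τ, P (σ τ) (ϑ τ) := by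
    rcases isClopen_iff.mp hclopen with h | h
    · exfalso
      have : (0 : ℝ) ∈ {τ | P (σ τ) (ϑ τ)} := by
        refine hP0 _ _ ?_ ?_ <;> simp [hσ, hϑ, hε.le]
      rw [h] at this; exact this
    · intro τ
      have : τ ∈ {τ | P (σ τ) (ϑ τ)} := by rw [h]; trivial
      exact this
  have hs0 := fun j => coeff_eq_zero_of_bounded tendsto_natCast_atTop_atTop
    (Eventually.of_forall fun n => (hPR _ _ (hall n)).1) j
  have hβ0 := fun j => coeff_eq_zero_of_bounded tendsto_natCast_atTop_atTop
    (Eventually.of_forall fun n => (hPR _ _ (hall n)).2) j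
  have : ∑ j, mass (E j) = 0 := Finset.sum_eq_zero fun j _ => by
    rw [hsβ, hs0, hβ0]
    simp [mass, tm, Fin.sum_univ_four]
  rw [hmass] at this
  exact one_ne_zero this

theorem IsMinInv.eventually_eq_jm_add_tm {S : Set ℝ} (hS : IsClosed S) (hne : S ≠ Set.univ)
    {Y L : Set G4} (hY : IsMinInv (Set.range un) latticeGroup Y) (hYA : Y ⊆ affineGroup)
    (hL : IsCompact L) (hLY : ∀ y ∈ Y, ∃ γ ∈ latticeGroup, y * γ ∈ L) {y : G4} (hy : y ∈ Y) :
    ∀ᶠ p in 𝓝 jm, ∀ a ∈ affineGroup, p = pull jm a → Good S p y → ∃ s β, p = jm + tm s β := by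
  by_contra h
  obtain ⟨p, hp, hn⟩ := exists_seq_forall_of_frequently (not_eventually.mp h)
  push Not at hn
  choose a ha hpa hg hnot using hn
  obtain ⟨n, hd⟩ := hY.der_eventually_zero hS hne hYA hL hLY hy
    (fun n => by rw [hpa n, transpose_pull, transpose_jm]) hp hg
  rw [hpa n] at hd
  obtain ⟨s, β, e⟩ := exists_of_der_pull_eq_zero (ha n) hd
  exact hnot n s β ((hpa n).trans e)

end IrratQuad

namespace IrratQuad

open Matrix Topology Filter Pointwise

/-- The image of the integer lattice contains a nonzero vector fixed by the unipotent flow. -/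
def HasFix (f : (Fin 3 → ℝ) →ₗ[ℝ] (Fin 3 → ℝ)) : Prop :=
  ∃ m : Fin 3 → ℤ, m ≠ 0 ∧ f (toR m) 1 = 0 ∧ f (toR m) 2 = 0

lemma DualPair.fixed_ne_zero {f f' : (Fin 3 → ℝ) →ₗ[ℝ] (Fin 3 → ℝ)} (h : DualPair f f')
    {m : Fin 3 → ℤ} (hm : m ≠ 0) (h1 : f (toR m) 1 = 0) (h2 : f (toR m) 2 = 0) :
    f (toR m) 0 ≠ 0 := by
  intro h0
  have : toR m ≠ 0 := fun e => hm (toR_injective (by rw [e]; ext i; simp))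
  refine h.injective this ?_
  ext i; fin_cases i
  · exact h0
  · exact h1
  · exact h2

/-- If both a lattice and its dual contain fixed vectors then its whole unipotent orbit avoids
short vectors. -/
lemma DualPair.exists_thick {f f' : (Fin 3 → ℝ) →ₗ[ℝ] (Fin 3 → ℝ)} (h : DualPair f f') {c : ℝ}
    (hc : 0 < c) (hf : FixGe c f) (hf' : FixGe c f') (h1 : HasFix f) (h2 : HasFix f') :
    ∃ δ, 0 < δ ∧ ∀ t, ∀ m : Fin 3 → ℤ, m ≠ 0 → δ ≤ nsq (shear t (f (toR m))) := by
  obtain ⟨k, hk, hk1, hk2⟩ := h1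
  obtain ⟨l, hl, hl1, hl2⟩ := h2
  have ha := h.fixed_ne_zero hk hk1 hk2
  have hb := h.symm.fixed_ne_zero hl hl1 hl2
  set a := f (toR k) 0
  set b := f' (toR l) 0
  refine ⟨min (1 / b ^ 2) (min ((c / a) ^ 2) (c ^ 2)), by positivity, fun t m hm => ?_⟩
  have hx2 : f (toR m) 2 * b = (bil m l : ℤ) := by
    rw [toR_bil, ← h.bil_eq]; simp [bil, hl1, hl2, b]
  by_cases h2 : f (toR m) 2 = 0
  swap
  · refine (min_le_left _ _).trans ?_
    have hz : (bil m l : ℤ) ≠ 0 := by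
      intro e
      rw [e] at hx2
      simp [h2, hb] at hx2
    have h3 : (1 : ℝ) ≤ (f (toR m) 2 * b) ^ 2 := by
      rw [hx2, ← sq_abs]
      exact_mod_cast one_le_pow₀ (Int.one_le_abs hz)
    have h4 : 1 / b ^ 2 ≤ f (toR m) 2 ^ 2 := by
      rw [div_le_iff₀ (by positivity)]; linarith [mul_pow (f (toR m) 2) b 2]
    refine h4.trans ?_
    simp only [nsq, shear, Matrix.cons_val]
    nlinarith [sq_nonneg (f (toR m) 0 + t * f (toR m) 1 + t ^ 2 / 2 * f (toR m) 2),
      sq_nonneg (f (toR m) 1 + t * f (toR m) 2)]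
  refine (min_le_right _ _).trans ?_
  by_cases h1 : f (toR m) 1 = 0
  · refine (min_le_right _ _).trans ?_
    have := hf m hm h1 h2
    simp only [nsq, shear, Matrix.cons_val, h1, h2]
    rw [← sq_abs (f (toR m) 0 + t * 0 + t ^ 2 / 2 * 0)]
    simp only [mul_zero, add_zero]
    nlinarith
  · refine (min_le_left _ _).trans ?_
    have e := h.dia_left (toR m) (toR k)
    rw [← toR_dia] at e
    have e0 : f' (toR (dia m k)) 0 = -(f (toR m) 1 * a) := by
      rw [← e]; simp [dia, hk1, a]
    have hne : dia m k ≠ 0 := by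
      intro h0
      have : toR (0 : Fin 3 → ℤ) = 0 := by ext i; simp
      rw [h0, this, map_zero] at e0
      simp [h1, ha] at e0
    have := hf' _ hne (by rw [← e]; simp [dia, h2, hk2]) (by rw [← e]; simp [dia, h2, hk2])
    rw [e0, abs_neg] at this
    have h4 : (c / a) ^ 2 ≤ f (toR m) 1 ^ 2 := by
      rw [div_pow, div_le_iff₀ (by positivity), ← mul_pow, ← sq_abs (_ * a)]
      exact pow_le_pow_left₀ hc.le this 2
    refine h4.trans ?_
    simp only [nsq, shear, Matrix.cons_val, h2, mul_zero, add_zero]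
    nlinarith [sq_nonneg (f (toR m) 0 + t * f (toR m) 1)]

/-- A good lattice with a fixed vector and without fixed covector has dense values. -/
lemma Good.eq_univ {S : Set ℝ} (hS : IsClosed S) {y : G4} (hy : y ∈ affineGroup)
    (hg : Good S jm y) (h1 : HasFix (linPart y)) (h2 : ¬ HasFix (dualPart y)) :
    S = Set.univ := by
  obtain ⟨k, hk, hk1, hk2⟩ := h1
  have ha := (dualPair hy).fixed_ne_zero hk hk1 hk2
  set a := linPart y (toR k) 0 with ha_def
  set D := AddSubgroup.closure {y 2 0, y 2 1, y 2 2} with hD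
  have hmem : ∀ d ∈ D, ∃ m : Fin 3 → ℤ, d = y 2 0 * m 0 + y 2 1 * m 1 + y 2 2 * m 2 := by
    intro d hd
    induction hd using AddSubgroup.closure_induction with
    | mem x hx =>
      rcases hx with rfl | rfl | rfl
      · exact ⟨![1, 0, 0], by simp⟩
      · exact ⟨![0, 1, 0], by simp⟩
      · exact ⟨![0, 0, 1], by simp⟩
    | zero => exact ⟨0, by simp⟩
    | add x z _ _ hx hz =>
      obtain ⟨m, rfl⟩ := hx
      obtain ⟨m', rfl⟩ := hz
      exact ⟨m + m', by simp; ring⟩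
    | neg x _ hx =>
      obtain ⟨m, rfl⟩ := hx
      exact ⟨-m, by simp; ring⟩
  have hdense : Dense (D : Set ℝ) := by
    rcases D.dense_or_cyclic with h | ⟨g, hgD⟩
    · exact h
    exfalso
    have hj : ∀ j, y 2 j ∈ D → ∃ n : ℤ, y 2 j = n * g := fun j hj => by
      rw [hgD, AddSubgroup.mem_closure_singleton] at hj
      obtain ⟨n, hn⟩ := hj
      exact ⟨n, by rw [← hn]; simp⟩
    obtain ⟨n0, e0⟩ := hj 0 (AddSubgroup.subset_closure (by simp))
    obtain ⟨n1, e1⟩ := hj 1 (AddSubgroup.subset_closure (by simp))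
    obtain ⟨n2, e2⟩ := hj 2 (AddSubgroup.subset_closure (by simp))
    have hdet := det_linPart hy
    refine h2 ⟨![n2, -n1, n0], ?_, ?_, ?_⟩
    · intro h0
      have h00 := congrFun h0 0
      have h01 := congrFun h0 1
      have h02 := congrFun h0 2
      simp at h00 h01 h02
      rw [e0, e1, e2, h00, h01, h02] at hdet
      norm_num at hdet
    · rw [dualPart_apply]
      simp [e0, e1, e2]; ring
    · rw [dualPart_apply]
      simp [e0, e1, e2]; ring
  rw [Set.eq_univ_iff_forall]
  intro v
  rw [← hS.closure_eq, Metric.mem_closure_iff]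
  intro ε hε
  obtain ⟨d, hd1, hdD⟩ := hdense.exists_mem_open (isOpen_Ioo (a := -y 2 3)
    (b := -y 2 3 + ε / (2 * |a|))) (Set.nonempty_Ioo.mpr (by
      have := abs_pos.mpr ha
      have : 0 < ε / (2 * |a|) := by positivity
      linarith))
  obtain ⟨m, rfl⟩ := hmem d hd1
  set z2 := y 2 0 * m 0 + y 2 1 * m 1 + y 2 2 * m 2 + y 2 3 with hz2
  have hz0 : 0 < z2 := by rw [hz2]; linarith [hdD.1]
  have hzs : z2 < ε / (2 * |a|) := by rw [hz2]; linarith [hdD.2]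
  set w := 2 * a * z2 with hw
  have hw0 : w ≠ 0 := mul_ne_zero (mul_ne_zero two_ne_zero ha) hz0.ne'
  have hws : |w| < ε := by
    have := abs_pos.mpr ha
    rw [lt_div_iff₀ (by positivity)] at hzs
    rw [hw, abs_mul, abs_mul, abs_of_pos hz0, abs_two]
    linarith
  set M : ℤ → Fin 4 → ℤ := fun j => ![m 0 + j * k 0, m 1 + j * k 1, m 2 + j * k 2, 1] with hM
  set V := qv jm ((y : M4) *ᵥ toR (M 0)) with hV
  have hval : ∀ j, qv jm ((y : M4) *ᵥ toR (M j)) = V + j * w := by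
    intro j
    rw [linPart_apply] at hk1 hk2
    simp only [linPart_apply] at ha_def
    simp at hk1 hk2 ha_def
    have q : ∀ z, qv jm z = 2 * z 0 * z 2 - z 1 ^ 2 := fun z => by
      simp [qv, jm, Matrix.mulVec, dotProduct, Fin.sum_univ_four]; ring
    have c : ∀ (j : ℤ) (i : Fin 4), ((y : M4) *ᵥ toR (M j)) i =
        y i 0 * m 0 + y i 1 * m 1 + y i 2 * m 2 + y i 3 +
          j * (y i 0 * k 0 + y i 1 * k 1 + y i 2 * k 2) := fun j i => by
      simp [hM, Matrix.mulVec, dotProduct, Fin.sum_univ_four]; ring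
    rw [hV, q, q]
    simp only [c]
    rw [hk1, hk2, ← ha_def, hw, hz2]
    push_cast
    ring
  refine ⟨_, hg (M (round ((v - V) / w))) rfl, ?_⟩
  rw [hval, Real.dist_eq]
  have e : v - (V + round ((v - V) / w) * w) = ((v - V) / w - round ((v - V) / w)) * w := by
    field_simp
    ring
  rw [e, abs_mul]
  have := abs_sub_round ((v - V) / w)
  nlinarith [abs_nonneg w]

lemma exists_linPart_toR {γ : G4} (hγ : γ ∈ latticeGroup) (x : Fin 3 → ℤ) :
    ∃ x' : Fin 3 → ℤ, linPart γ (toR x) = toR x' := by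
  choose k hk using (mem_latticeGroup_iff.mp hγ).2
  refine ⟨![k 0 0 * x 0 + k 0 1 * x 1 + k 0 2 * x 2, k 1 0 * x 0 + k 1 1 * x 1 + k 1 2 * x 2,
      k 2 0 * x 0 + k 2 1 * x 1 + k 2 2 * x 2], ?_⟩
  rw [linPart_apply]
  ext i; fin_cases i <;> simp [hk]

/-- Affine transformations whose third row is, up to the factor `c`, a primitive vector. -/
def PrimRow (c : ℝ) (w : G4) : Prop :=
  ∃ k u : Fin 3 → ℤ, k 0 * u 0 + k 1 * u 1 + k 2 * u 2 = 1 ∧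
    c * w 2 0 = k 0 ∧ c * w 2 1 = k 1 ∧ c * w 2 2 = k 2

lemma isClosed_primRow (c : ℝ) : IsClosed {w : G4 | PrimRow c w} := by
  have hcl : IsClosed (toR '' {k : Fin 3 → ℤ | ∃ u : Fin 3 → ℤ,
      k 0 * u 0 + k 1 * u 1 + k 2 * u 2 = 1}) := by
    have h : IsClosedEmbedding (toR (n := 3)) :=
      IsClosedEmbedding.piMap fun _ => Int.isClosedEmbedding_coe_real
    exact h.isClosedMap _ (isClosed_discrete _)
  have := continuous_entry
  convert hcl.preimage (f := fun w : G4 => ![c * w 2 0, c * w 2 1, c * w 2 2])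
    (continuous_pi fun i => by
      fin_cases i
      · exact continuous_const.mul (continuous_entry 2 0)
      · exact continuous_const.mul (continuous_entry 2 1)
      · exact continuous_const.mul (continuous_entry 2 2)) using 1
  ext w
  constructor
  · rintro ⟨k, u, h, h0, h1, h2⟩
    refine ⟨k, ⟨u, h⟩, ?_⟩
    ext i; fin_cases i <;> simp [h0, h1, h2]
  · rintro ⟨k, ⟨u, h⟩, e⟩
    have h0 := congrFun e 0
    have h1 := congrFun e 1
    have h2 := congrFun e 2
    simp at h0 h1 h2
    exact ⟨k, u, h, h0.symm, h1.symm, h2.symm⟩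

lemma PrimRow.un_mul {c : ℝ} {w : G4} (hw : w ∈ affineGroup) (h : PrimRow c w) (t : ℝ) :
    PrimRow c (un t * w) := by
  obtain ⟨h0, h1, h2, h3⟩ := mem_affineGroup.mp hw
  have e : ∀ j, (un t * w) 2 j = w 2 j := fun j => by
    rw [Matrix.SpecialLinearGroup.coe_mul, Matrix.mul_apply, coe_un]
    simp [Fin.sum_univ_four]
  simpa only [PrimRow, e] using h

lemma PrimRow.mul_lattice {c : ℝ} {w γ : G4} (h : PrimRow c w) (hγ : γ ∈ latticeGroup) :
    PrimRow c (w * γ) := by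
  obtain ⟨k, u, hu, h0, h1, h2⟩ := h
  obtain ⟨hA, hI⟩ := mem_latticeGroup_iff.mp hγ
  obtain ⟨g0, g1, g2, g3⟩ := mem_affineGroup.mp hA
  choose l hl using hI
  obtain ⟨x, hx⟩ := exists_linPart_toR (inv_mem hγ) u
  have e : linPart γ (toR x) = toR u := by
    rw [← hx, ← linPart_mul (inv_mem hγ).1, mul_inv_cancel]
    rw [linPart_apply]; ext i; fin_cases i <;> simp
  have e0 := congrFun e 0
  have e1 := congrFun e 1
  have e2 := congrFun e 2
  rw [linPart_apply] at e0 e1 e2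
  simp [hl] at e0 e1 e2
  norm_cast at e0 e1 e2
  have m : ∀ j, j ≠ 3 → (w * γ) 2 j = w 2 0 * γ 0 j + w 2 1 * γ 1 j + w 2 2 * γ 2 j := by
    intro j hj
    rw [Matrix.SpecialLinearGroup.coe_mul, Matrix.mul_apply, Fin.sum_univ_four]
    fin_cases j <;> simp [g0, g1, g2] at hj ⊢
  refine ⟨![k 0 * l 0 0 + k 1 * l 1 0 + k 2 * l 2 0, k 0 * l 0 1 + k 1 * l 1 1 + k 2 * l 2 1,
    k 0 * l 0 2 + k 1 * l 1 2 + k 2 * l 2 2], x, ?_, ?_, ?_, ?_⟩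
  · simp only [Matrix.cons_val]
    linear_combination hu + k 0 * e0 + k 1 * e1 + k 2 * e2
  · rw [m 0 (by decide)]; simp [hl, ← h0, ← h1, ← h2]; ring
  · rw [m 1 (by decide)]; simp [hl, ← h0, ← h1, ← h2]; ring
  · rw [m 2 (by decide)]; simp [hl, ← h0, ← h1, ← h2]; ring

/-- A fixed vector of the dual lattice encodes the third row. -/
lemma row_of_fixed {w : G4} (hw : w ∈ affineGroup) {m : Fin 3 → ℤ}
    (h1 : dualPart w (toR m) 1 = 0) (h2 : dualPart w (toR m) 2 = 0) :
    dualPart w (toR m) 0 * w 2 0 = m 2 ∧ dualPart w (toR m) 0 * w 2 1 = -m 1 ∧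
      dualPart w (toR m) 0 * w 2 2 = m 0 := by
  have hb := fun x => (dualPair hw).bil_eq x (toR m)
  have b0 := hb ![1, 0, 0]
  have b1 := hb ![0, 1, 0]
  have b2 := hb ![0, 0, 1]
  simp only [bil, h1, h2] at b0 b1 b2
  rw [linPart_apply] at b0 b1 b2
  simp at b0 b1 b2
  refine ⟨?_, ?_, ?_⟩ <;> linarith

lemma exists_primRow {w : G4} (hw : w ∈ affineGroup) (h : HasFix (dualPart w)) :
    ∃ c, c ≠ 0 ∧ PrimRow c w := by
  obtain ⟨m, hm, h1, h2⟩ := h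
  have ha := (dualPair hw).symm.fixed_ne_zero hm h1 h2
  obtain ⟨e0, e1, e2⟩ := row_of_fixed hw h1 h2
  set a := dualPart w (toR m) 0
  obtain ⟨d, hd⟩ := (IsPrincipalIdealRing.principal (Ideal.span {m 2, -m 1, m 0})).principal
  have hdiv : ∀ x ∈ Ideal.span {m 2, -m 1, m 0}, ∃ k, x = k * d := fun x hx => by
    rw [hd, Submodule.mem_span_singleton] at hx
    obtain ⟨k, hk⟩ := hx
    exact ⟨k, hk.symm⟩
  obtain ⟨k0, hk0⟩ := hdiv _ (Ideal.subset_span (by simp : m 2 ∈ _))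
  obtain ⟨k1, hk1⟩ := hdiv _ (Ideal.subset_span (by simp : -m 1 ∈ _))
  obtain ⟨k2, hk2⟩ := hdiv _ (Ideal.subset_span (by simp : m 0 ∈ _))
  have hd0 : d ≠ 0 := by
    rintro rfl
    apply hm
    ext i; fin_cases i
    · simpa using hk2
    · simpa using hk1
    · simpa using hk0
  have hdm : d ∈ Ideal.span {m 2, -m 1, m 0} := by rw [hd]; exact Submodule.mem_span_singleton_self d
  obtain ⟨u0, z, hz, hu⟩ := Ideal.mem_span_insert.mp hdm
  obtain ⟨u1, u2, hu'⟩ := Ideal.mem_span_pair.mp hz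
  have hdR : (d : ℝ) ≠ 0 := by exact_mod_cast hd0
  refine ⟨a / d, div_ne_zero ha hdR, ![k0, k1, k2], ![u0, u1, u2], ?_, ?_, ?_, ?_⟩
  · simp only [Matrix.cons_val]
    refine mul_right_cancel₀ hd0 ?_
    rw [one_mul]
    conv_rhs => rw [hu, ← hu', hk0, hk1, hk2]
    ring
  · have := congrArg (Int.cast : ℤ → ℝ) hk0
    push_cast at this
    simp only [Matrix.cons_val]
    rw [div_mul_eq_mul_div, e0, this]; field_simp
  · have := congrArg (Int.cast : ℤ → ℝ) hk1
    push_cast at this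
    simp only [Matrix.cons_val]
    rw [div_mul_eq_mul_div, e1, this]; field_simp
  · have := congrArg (Int.cast : ℤ → ℝ) hk2
    push_cast at this
    simp only [Matrix.cons_val]
    rw [div_mul_eq_mul_div, e2, this]; field_simp

lemma PrimRow.fixGe {c : ℝ} {w : G4} (hw : w ∈ affineGroup) (h : PrimRow c w) :
    FixGe |c| (dualPart w) := by
  intro m hm h1 h2
  have ha := (dualPair hw).symm.fixed_ne_zero hm h1 h2
  obtain ⟨e0, e1, e2⟩ := row_of_fixed hw h1 h2
  obtain ⟨k, u, hu, h0, h1', h2'⟩ := h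
  set a := dualPart w (toR m) 0
  have huR : (k 0 * u 0 + k 1 * u 1 + k 2 * u 2 : ℝ) = 1 := by exact_mod_cast hu
  have key : a = c * ((m 2 * u 0 - m 1 * u 1 + m 0 * u 2 : ℤ) : ℝ) := by
    push_cast
    rw [← e0, ← e2, sub_eq_add_neg, ← neg_mul, ← e1]
    rw [← h0, ← h1', ← h2'] at huR
    linear_combination -a * huR
  have hne : m 2 * u 0 - m 1 * u 1 + m 0 * u 2 ≠ 0 := by
    intro h; rw [h] at key; simp at key; exact ha key
  rw [key, abs_mul]
  exact le_mul_of_one_le_right (abs_nonneg _) (by exact_mod_cast Int.one_le_abs hne)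

lemma dorbit_invClosed (y : G4) :
    InvClosed (Set.range un) latticeGroup (closure (dorbit (Set.range un) latticeGroup y)) := by
  refine invClosed_closure ⟨y, un 0, ⟨0, rfl⟩, 1, one_mem _, by rw [un_zero]; simp⟩ ?_ ?_
  · rintro _ ⟨t, rfl⟩ _ ⟨_, ⟨s, rfl⟩, γ, hγ, rfl⟩
    exact ⟨un (t + s), ⟨_, rfl⟩, γ, hγ, by rw [un_add]; simp only [mul_assoc]⟩
  · rintro γ hγ _ ⟨h, hh, γ', hγ', rfl⟩
    exact ⟨h, hh, γ' * γ, mul_mem hγ' hγ, by simp only [mul_assoc]⟩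

lemma closure_dorbit_subset {Z : Set G4} (hZ : InvClosed (Set.range un) latticeGroup Z) {y : G4}
    (hy : y ∈ Z) : closure (dorbit (Set.range un) latticeGroup y) ⊆ Z := by
  refine closure_minimal ?_ hZ.closed
  rintro _ ⟨h, hh, γ, hγ, rfl⟩
  exact hZ.right γ hγ _ (hZ.left h hh y hy)

/-- Invariant sets of good lattices contain minimal sets with uniformly recurrent flow. -/
theorem InvClosed.exists_isMinInv_un {S : Set ℝ} (hS : IsClosed S) (hne : S ≠ Set.univ)
    {Z : Set G4} (hZ : InvClosed (Set.range un) latticeGroup Z) (hZA : Z ⊆ affineGroup)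
    (hg : ∀ y ∈ Z, Good S jm y) : ∃ Y ⊆ Z, IsMinInv (Set.range un) latticeGroup Y ∧
      ∃ K, IsCompact K ∧ ∀ y ∈ Y, ∀ T, ∃ t, T ≤ t ∧ ∃ γ ∈ latticeGroup, un t * y * γ ∈ K := by
  suffices h : ∃ X ⊆ Z, InvClosed (Set.range un) latticeGroup X ∧
      ∃ K, IsCompact K ∧ ∀ y ∈ X, ∀ T, ∃ t, T ≤ t ∧ ∃ γ ∈ latticeGroup, un t * y * γ ∈ K by
    obtain ⟨X, hXZ, hX, K, hK, hret⟩ := h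
    obtain ⟨Y, hYX, hY⟩ := exists_isMinInv hX hK fun y hy => by
      obtain ⟨t, -, γ, hγ, h⟩ := hret y hy 0
      exact ⟨un t, ⟨t, rfl⟩, γ, hγ, h⟩
    exact ⟨Y, hYX.trans hXZ, hY, K, hK, fun y hy => hret y (hYX hy)⟩
  by_cases hboth : ∃ y ∈ Z, HasFix (linPart y)
  · obtain ⟨y, hy, h1⟩ := hboth
    have hyA := hZA hy
    have h2 : HasFix (dualPart y) := by
      by_contra h2
      exact hne ((hg y hy).eq_univ hS hyA h1 h2)
    obtain ⟨c, hc, hc1, hc2⟩ := exists_fixGe hyA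
    obtain ⟨δ, hδ, ht⟩ := (dualPair hyA).exists_thick hc hc1 hc2 h1 h2
    obtain ⟨δ', hδ', ht'⟩ := (dualPair hyA).symm.exists_thick hc hc2 hc1 h2 h1
    obtain ⟨R, hR⟩ := exists_mul_mem_box (lt_min hδ hδ')
    have hcl : IsClosed (box R * (latticeGroup : Set G4)) :=
      isClosed_latticeGroup.mul_left_of_isCompact (isCompact_box R)
    have hsub : closure (dorbit (Set.range un) latticeGroup y) ⊆
        box R * (latticeGroup : Set G4) := by
      refine closure_minimal ?_ hcl
      rintro _ ⟨_, ⟨t, rfl⟩, γ, hγ, rfl⟩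
      obtain ⟨γ', hγ', hb⟩ := hR (un t * y) (mul_mem (un_mem t) hyA) fun m hm => by
        rw [linPart_mul hyA, dualPart_mul hyA, linPart_un, dualPart_un]
        exact ⟨(min_le_left _ _).trans (ht t m hm), (min_le_right _ _).trans (ht' t m hm)⟩
      exact ⟨_, hb, γ'⁻¹ * γ, mul_mem (inv_mem hγ') hγ, by simp [mul_assoc]⟩
    refine ⟨_, closure_dorbit_subset hZ hy, dorbit_invClosed y, box R, isCompact_box R, ?_⟩
    intro z hz T
    obtain ⟨b, hb, γ, hγ, e⟩ := hsub ((dorbit_invClosed y).left _ ⟨T, rfl⟩ z hz)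
    refine ⟨T, le_rfl, γ⁻¹, inv_mem hγ, ?_⟩
    rw [← e]; simpa using hb
  push Not at hboth
  by_cases hdual : ∃ y ∈ Z, HasFix (dualPart y)
  · obtain ⟨y, hy, h2⟩ := hdual
    obtain ⟨c, hc, hrow⟩ := exists_primRow (hZA hy) h2
    obtain ⟨K, hK, hret⟩ := exists_return (abs_pos.mpr hc)
    have hsub := closure_dorbit_subset hZ hy
    have hrow' : closure (dorbit (Set.range un) latticeGroup y) ⊆ {w | PrimRow c w} := by
      refine closure_minimal ?_ (isClosed_primRow c)
      rintro _ ⟨_, ⟨t, rfl⟩, γ, hγ, rfl⟩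
      exact (hrow.un_mul (hZA hy) t).mul_lattice hγ
    refine ⟨_, hsub, dorbit_invClosed y, K, hK, fun z hz => hret z (hZA (hsub hz)) ?_
      (PrimRow.fixGe (hZA (hsub hz)) (hrow' hz))⟩
    intro m hm h1 h2
    exact absurd ⟨m, hm, h1, h2⟩ (hboth z (hsub hz))
  · push Not at hdual
    obtain ⟨K, hK, hret⟩ := exists_return one_pos
    refine ⟨Z, subset_rfl, hZ, K, hK, fun z hz => hret z (hZA hz) ?_ ?_⟩
    · intro m hm h1 h2
      exact absurd ⟨m, hm, h1, h2⟩ (hboth z hz)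
    · intro m hm h1 h2
      exact absurd ⟨m, hm, h1, h2⟩ (hdual z hz)

end IrratQuad

namespace IrratQuad

open Matrix Topology Filter

lemma continuous_pull_right (p : M4) : Continuous fun g : G4 => pull p g :=
  continuous_pull.comp (continuous_const.prodMk continuous_id)

lemma continuous_tm : Continuous fun x : ℝ × ℝ => tm x.1 x.2 := by
  refine continuous_matrix fun i j => ?_
  fin_cases i <;> fin_cases j <;> simp [tm] <;> fun_prop

lemma tm_zero : tm 0 0 = 0 := by
  ext i j; fin_cases i <;> fin_cases j <;> simp [tm]

/-- A unipotent pullback that stays bounded is constant. -/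
lemma der_eq_zero_of_tendsto {p p' : M4} {t : ℕ → ℝ} (ht : Tendsto t atTop atTop)
    (h : Tendsto (fun n => pull p (un (-t n))) atTop (𝓝 p')) : der p = 0 := by
  ext i k
  have hent : Tendsto (fun n => |(pull p (un (-t n)) - p) i k|) atTop (𝓝 |(p' - p) i k|) :=
    (((continuous_apply k).tendsto _).comp
      (((continuous_apply i).tendsto _).comp (h.sub_const p))).abs
  have hb : ∀ᶠ n in atTop, |∑ j : Fin 4, t n ^ (j.val + 1) *
      ((-1) ^ (j.val + 1) * expo p 1 j i k)| ≤ |(p' - p) i k| + 1 := by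
    filter_upwards [hent.eventually_lt_const (lt_add_one _)] with n hn
    refine le_of_eq_of_le ?_ hn.le
    congr 1
    rw [pull_un_eq, add_sub_cancel_left, Matrix.sum_apply]
    refine Finset.sum_congr rfl fun j _ => ?_
    have := expo_mul p (-t n) 1 j
    rw [mul_one] at this
    rw [this, Matrix.smul_apply, smul_eq_mul, neg_pow]
    ring
  have := coeff_eq_zero_of_bounded ht hb 0
  simpa [expo] using this

/-- The group elements normalizing the unipotent flow that occur as return elements. -/
structure Norm (g : G4) (κ s' β' : ℝ) : Prop where
  pos : 0 < κ
  pull_jm : pull jm g = jm + tm s' β'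
  pull_tm : ∀ s β, pull (tm s β) g = tm (κ ^ 2 * s) (κ * β)
  mul_un : ∀ t, g * un t = un (t / κ) * g
  eq_un : κ = 1 → s' = 0 → β' = 0 → g = un (g 0 1)

lemma pull_tm_apply {g : G4} (hg : g ∈ affineGroup) (s β : ℝ) : pull (tm s β) g =
    !![2 * s * g 2 0 ^ 2, 2 * s * g 2 0 * g 2 1, 2 * s * g 2 0 * g 2 2,
        (2 * s * g 2 3 + β) * g 2 0;
      2 * s * g 2 0 * g 2 1, 2 * s * g 2 1 ^ 2, 2 * s * g 2 1 * g 2 2, (2 * s * g 2 3 + β) * g 2 1;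
      2 * s * g 2 0 * g 2 2, 2 * s * g 2 1 * g 2 2, 2 * s * g 2 2 ^ 2, (2 * s * g 2 3 + β) * g 2 2;
      (2 * s * g 2 3 + β) * g 2 0, (2 * s * g 2 3 + β) * g 2 1, (2 * s * g 2 3 + β) * g 2 2,
        2 * s * g 2 3 ^ 2 + 2 * β * g 2 3] := by
  obtain ⟨h0, h1, h2, h3⟩ := mem_affineGroup.mp hg
  rw [pull]
  ext i j
  fin_cases i <;> fin_cases j <;>
    simp only [tm, Matrix.mul_apply, Fin.sum_univ_four, Matrix.transpose_apply, Matrix.of_apply,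
      Matrix.cons_val, Fin.zero_eta, Fin.mk_one, Fin.reduceFinMk, h0, h1, h2, h3] <;> ring

lemma row_of_der_eq_zero {g : G4} (hg : g ∈ affineGroup) {s β : ℝ} (hne : ¬(s = 0 ∧ β = 0))
    (h : der (pull (tm s β) g) = 0) : g 2 0 = 0 ∧ g 2 1 = 0 := by
  have e := eq_of_der_eq_zero (by rw [transpose_pull, transpose_tm]) h
  rw [pull_tm_apply hg] at e
  have e00 := congrFun (congrFun e 0) 0
  have e11 := congrFun (congrFun e 1) 1
  have e03 := congrFun (congrFun e 0) 3
  have e13 := congrFun (congrFun e 1) 3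
  simp [jm, tm, em] at e00 e11 e03 e13
  by_cases hs : s = 0
  · have hβ : β ≠ 0 := fun hβ => hne ⟨hs, hβ⟩
    simpa [hs, hβ] using And.intro e03 e13
  · have h0 : g 2 0 = 0 := by simpa [hs] using e00
    rw [h0] at e11
    exact ⟨h0, by simpa [hs] using e11⟩

lemma exists_norm {g : G4} (hg : g ∈ affineGroup) {s β s' β' : ℝ} (hne : ¬(s = 0 ∧ β = 0))
    (h : der (pull (tm s β) g) = 0) (h' : pull jm g = jm + tm s' β') (hpos : 0 < g 2 2) :
    Norm g (g 2 2) s' β' := by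
  obtain ⟨r0, r1⟩ := row_of_der_eq_zero hg hne h
  have hdet := det_linPart hg
  obtain ⟨h0, h1, h2, h3⟩ := mem_affineGroup.mp hg
  have H : ∀ i j, pull jm g i j = (jm + tm s' β') i j := fun i j => by rw [h']
  have H00 := H 0 0
  have H11 := H 1 1
  have H02 := H 0 2
  have H12 := H 1 2
  have H22 := H 2 2
  have H03 := H 0 3
  have H13 := H 1 3
  have H23 := H 2 3
  simp [pull, jm, tm, Matrix.mul_apply, Fin.sum_univ_four, r0, r1, h0, h1, h2, h3]
    at H00 H11 H02 H12 H22 H03 H13 H23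
  simp only [H00, r0, r1, zero_mul, mul_zero, neg_zero, zero_add, sub_zero, add_zero]
    at H02 H03 H23 hdet
  have hκ := hpos.ne'
  have ha : g 0 0 ≠ 0 := fun h => by simp [h] at H02
  have ρ0 : g 2 3 = 0 := (mul_eq_zero.mp H03).resolve_left ha
  have he : g 1 1 = 1 := by linear_combination hdet - g 1 1 * H02
  rw [he] at H12 H13
  rw [ρ0] at H13 H23
  have hh : g 1 3 = 0 := by linarith
  have hf : g 1 2 = g 0 1 * g 2 2 := by linarith
  rw [hh] at H23
  have ha' : g 0 0 = 1 / g 2 2 := by field_simp; exact H02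
  refine ⟨hpos, h', fun s β => ?_, fun t => ?_, fun k1 k2 k3 => ?_⟩
  · rw [pull_tm_apply hg]
    ext i j
    fin_cases i <;> fin_cases j <;> simp [tm, r0, r1, ρ0] <;> ring
  · apply coe_ext
    ext i j
    fin_cases i <;> fin_cases j <;>
      simp [coe_un, Matrix.mul_apply, Fin.sum_univ_four, H00, r0, r1, h0, h1, h2, h3, ρ0, he, hh,
        hf, ha'] <;> field_simp <;> ring
  · rw [k1] at hf ha' H22 H23
    have hc : g 0 2 = g 0 1 ^ 2 / 2 := by
      rw [hf] at H22
      linarith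
    have hp : g 0 3 = 0 := by linarith
    apply coe_ext
    ext i j
    fin_cases i <;> fin_cases j <;>
      simp [coe_un, H00, r0, r1, h0, h1, h2, h3, ρ0, he, hh, ha', hc, hp, hf, k1]

end IrratQuad

namespace IrratQuad

open Matrix Topology Filter

/-- The two-parameter group generated by the unipotent and diagonal flows. -/
def flow : Set G4 := {h | ∃ t s, h = un t * dg s}

lemma range_un_subset_flow : Set.range un ⊆ flow := by
  rintro _ ⟨t, rfl⟩
  exact ⟨t, 0, by rw [dg_zero, mul_one]⟩

lemma IsMinInv.exists_return_un {Y K : Set G4} (hY : IsMinInv (Set.range un) latticeGroup Y)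
    (hK : IsCompact K) (hret : ∀ y ∈ Y, ∀ T, ∃ t, T ≤ t ∧ ∃ γ ∈ latticeGroup, un t * y * γ ∈ K)
    {y : G4} (hy : y ∈ Y) : ∃ (t : ℕ → ℝ) (γ g : ℕ → G4), Tendsto t atTop atTop ∧
      (∀ n, γ n ∈ latticeGroup) ∧ (∀ n, g n * y = un (t n) * y * γ n) ∧
      Tendsto g atTop (𝓝 1) := by
  obtain ⟨h, γ, g, hA, hγ, hg, hlim⟩ := hY.exists_recurrent hK
    (A := fun n : ℕ => {h | ∃ t : ℝ, (n : ℝ) ≤ t ∧ h = un t})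
    (fun m n hmn h => by
      rintro ⟨t, ht, rfl⟩
      exact ⟨t, le_trans (by exact_mod_cast hmn) ht, rfl⟩)
    (fun n h => by
      rintro ⟨t, ht, rfl⟩
      exact ⟨t, rfl⟩)
    (by
      rintro _ ⟨τ, rfl⟩ n
      obtain ⟨m, hm⟩ := exists_nat_ge (n - τ)
      refine ⟨m, ?_⟩
      rintro _ ⟨t, ht, rfl⟩
      exact ⟨τ + t, by linarith, (un_add _ _).symm⟩)
    hy (fun n => by
      obtain ⟨t, ht, γ, hγ, hk⟩ := hret y hy n
      exact ⟨un t, ⟨t, ht, rfl⟩, γ, hγ, hk⟩)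
  choose t ht htu using hA
  exact ⟨t, γ, g, tendsto_atTop_mono ht tendsto_natCast_atTop_atTop, hγ,
    fun n => by rw [hg, htu], hlim⟩

lemma IsMinInv.exists_return_flow {Z : Set G4} (hZ : IsMinInv flow latticeGroup Z)
    (hZA : Z ⊆ affineGroup) {y : G4} (hy : y ∈ Z) : ∃ (s t : ℕ → ℝ) (γ g : ℕ → G4),
      Tendsto s atTop atTop ∧ (∀ n, γ n ∈ latticeGroup) ∧
      (∀ n, g n * y = un (t n) * dg (s n) * y * γ n) ∧ Tendsto g atTop (𝓝 1) := by
  obtain ⟨K, hK, hret⟩ := exists_return_dg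
  obtain ⟨h, γ, g, hA, hγ, hg, hlim⟩ := hZ.exists_recurrent hK
    (A := fun n : ℕ => {h | ∃ s : ℝ, (n : ℝ) ≤ s ∧ ∃ t, h = un t * dg s})
    (fun m n hmn h => by
      rintro ⟨s, hs, t, rfl⟩
      exact ⟨s, le_trans (by exact_mod_cast hmn) hs, t, rfl⟩)
    (fun n h => by
      rintro ⟨s, hs, t, rfl⟩
      exact ⟨t, s, rfl⟩)
    (by
      rintro _ ⟨τ, σ, rfl⟩ n
      obtain ⟨m, hm⟩ := exists_nat_ge (n - σ)
      refine ⟨m, ?_⟩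
      rintro _ ⟨s, hs, t, rfl⟩
      refine ⟨σ + s, by linarith, τ + Real.exp σ * t, ?_⟩
      rw [un_add, dg_add, mul_assoc, ← mul_assoc (dg σ), dg_mul_un]
      simp only [mul_assoc])
    hy (fun n => by
      obtain ⟨s, hs, t, γ, hγ, hk⟩ := hret y (hZA hy) n
      exact ⟨un t * dg s, ⟨s, hs, t, rfl⟩, γ, hγ, hk⟩)
  choose s hs t ht using hA
  exact ⟨s, t, γ, g, tendsto_atTop_mono hs tendsto_natCast_atTop_atTop, hγ,
    fun n => by rw [hg, ht], hlim⟩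

/-- Bounded orbits of an expanding affine map of the line are constant. -/
lemma eq_of_bounded_orbit {x : ℕ → ℝ} {κ c R : ℝ} (hκ : 1 ≤ κ) (hx : ∀ j, x (j + 1) = κ * x j + c)
    (hR : ∀ j, |x j| ≤ R) : x 1 = x 0 := by
  have hd : ∀ j, x (j + 1) - x j = κ ^ j * (x 1 - x 0) := fun j => by
    induction j with
    | zero => simp
    | succ j ih =>
      rw [pow_succ', mul_assoc, ← ih, hx (j + 1)]
      linear_combination -hx j
  have hsum : ∀ j, x j - x 0 = (∑ i ∈ Finset.range j, κ ^ i) * (x 1 - x 0) := fun j => by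
    rw [Finset.sum_mul, ← Finset.sum_range_sub]
    exact Finset.sum_congr rfl fun i _ => hd i
  by_contra hne
  have hpos : 0 < |x 1 - x 0| := abs_pos.mpr (sub_ne_zero.mpr hne)
  obtain ⟨j, hj⟩ := exists_nat_gt (2 * R / |x 1 - x 0|)
  rw [div_lt_iff₀ hpos] at hj
  have hG : (j : ℝ) ≤ ∑ i ∈ Finset.range j, κ ^ i := by
    calc (j : ℝ) = ∑ i ∈ Finset.range j, (1 : ℝ) := by simp
      _ ≤ _ := Finset.sum_le_sum fun i _ => one_le_pow₀ hκ
  have h1 : |x j - x 0| ≤ 2 * R := by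
    have := abs_sub (x j) (x 0)
    linarith [hR j, hR 0]
  rw [hsum, abs_mul] at h1
  have := mul_le_mul_of_nonneg_right (hG.trans (le_abs_self _)) hpos.le
  linarith

/-- A nearly trivial expanding affine map preserving a set of parameters confined by a barrier
is trivial. -/
lemma affine_trivial {Θ P : ℝ → ℝ → Prop} {R ε κ s' β' : ℝ} (hκ : 1 ≤ κ)
    (hsmall : ∀ s β, |s| ≤ ε → |β| ≤ ε → P s β) (hbd : ∀ s β, P s β → |s| ≤ R ∧ |β| ≤ R)
    (hstep : ∀ s β s' β', Θ s β → Θ s' β' → P s β → |s - s'| ≤ ε → |β - β'| ≤ ε → P s' β')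
    (hT : ∀ s β, Θ s β → Θ (κ ^ 2 * s + s') (κ * β + β')) (h0 : Θ 0 0)
    (hs1 : |κ ^ 2 - 1| * R + |s'| ≤ ε) (hs2 : |κ - 1| * R + |β'| ≤ ε)
    {s β : ℝ} (hΘ : Θ s β) (hs : |s| ≤ ε) (hβ : |β| ≤ ε) (hne : ¬(s = 0 ∧ β = 0)) :
    κ = 1 ∧ s' = 0 ∧ β' = 0 := by
  have key : ∀ s β, Θ s β → |s| ≤ ε → |β| ≤ ε →
      κ ^ 2 * s + s' = s ∧ κ * β + β' = β := fun s β hΘ hs hβ => by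
    let f : ℝ → ℝ := fun x => κ ^ 2 * x + s'
    let g : ℝ → ℝ := fun x => κ * x + β'
    have hf : ∀ j, f^[j + 1] s = κ ^ 2 * f^[j] s + s' := fun j => Function.iterate_succ_apply' f j s
    have hg : ∀ j, g^[j + 1] β = κ * g^[j] β + β' := fun j => Function.iterate_succ_apply' g j β
    have hall : ∀ j, Θ (f^[j] s) (g^[j] β) ∧ P (f^[j] s) (g^[j] β) := fun j => by
      induction j with
      | zero => exact ⟨hΘ, hsmall _ _ hs hβ⟩
      | succ j ih =>
        have hΘ' := hT _ _ ih.1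
        rw [← hf, ← hg] at hΘ'
        obtain ⟨b1, b2⟩ := hbd _ _ ih.2
        refine ⟨hΘ', hstep _ _ _ _ ih.1 hΘ' ih.2 ?_ ?_⟩
        · rw [hf, abs_sub_comm, show κ ^ 2 * f^[j] s + s' - f^[j] s = (κ ^ 2 - 1) * f^[j] s + s' by
            ring]
          refine (abs_add_le _ _).trans (le_trans ?_ hs1)
          rw [abs_mul]
          gcongr
        · rw [hg, abs_sub_comm, show κ * g^[j] β + β' - g^[j] β = (κ - 1) * g^[j] β + β' by ring]
          refine (abs_add_le _ _).trans (le_trans ?_ hs2)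
          rw [abs_mul]
          gcongr
    exact ⟨eq_of_bounded_orbit (one_le_pow₀ hκ) hf fun j => (hbd _ _ (hall j).2).1,
      eq_of_bounded_orbit hκ hg fun j => (hbd _ _ (hall j).2).2⟩
  have hε : 0 ≤ ε := (abs_nonneg _).trans hs
  obtain ⟨k1, k2⟩ := key 0 0 h0 (by simpa) (by simpa)
  obtain ⟨l1, l2⟩ := key s β hΘ hs hβ
  simp only [mul_zero, zero_add] at k1 k2
  subst k1 k2
  refine ⟨?_, rfl, rfl⟩
  by_cases h : s = 0
  · have hβ0 : β ≠ 0 := fun hβ => hne ⟨h, hβ⟩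
    exact mul_right_cancel₀ hβ0 (by linarith)
  · have : κ ^ 2 = 1 := mul_right_cancel₀ h (by linarith)
    nlinarith

lemma eq_one_of_mem_latticeGroup {γ : G4} (hγ : γ ∈ latticeGroup)
    (h : ∀ i j, |γ i j - (1 : M4) i j| < 1) : γ = 1 := by
  apply coe_ext
  ext i j
  obtain ⟨k, hk⟩ := (mem_latticeGroup_iff.mp hγ).2 i j
  obtain ⟨l, hl⟩ : ∃ l : ℤ, (1 : M4) i j = l := by
    rw [Matrix.one_apply]
    split_ifs
    · exact ⟨1, by simp⟩
    · exact ⟨0, by simp⟩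
  have := h i j
  rw [Matrix.SpecialLinearGroup.coe_one, hk, hl] at *
  have h1 : |k - l| < 1 := by exact_mod_cast this
  rw [show k = l by rw [Int.abs_lt_one_iff] at h1; omega]

lemma eventually_eq_one_of_tendsto {γ : ℕ → G4} (hγ : ∀ n, γ n ∈ latticeGroup)
    (h : Tendsto γ atTop (𝓝 1)) : ∀ᶠ n in atTop, γ n = 1 := by
  have : ∀ i j, ∀ᶠ n in atTop, |γ n i j - (1 : M4) i j| < 1 := fun i j => by
    have h1 : Tendsto (fun n => |γ n i j - (1 : M4) i j|) atTop (𝓝 0) := by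
      have := (((continuous_entry i j).tendsto _).comp h).sub_const ((1 : M4) i j) |>.abs
      simpa using this
    exact h1.eventually_lt_const one_pos
  filter_upwards [eventually_all.mpr fun i => eventually_all.mpr (this i)] with n hn
  exact eq_one_of_mem_latticeGroup (hγ n) hn

end IrratQuad

namespace IrratQuad

open Matrix Topology Filter

lemma InvClosed.mem_of_mul_un {Y : Set G4} (hY : IsMinInv (Set.range un) latticeGroup Y)
    {g : G4} {χ : ℝ} (hg : ∀ t, g * un t = un (χ * t) * g) {y : G4} (hy : y ∈ Y)
    (hgy : g * y ∈ Y) : ∀ z ∈ Y, g * z ∈ Y := by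
  have : {z ∈ Y | g * z ∈ Y} = Y := by
    refine hY.eq_of_subset _ ⟨?_, ⟨y, hy, hgy⟩, ?_, ?_⟩ (Set.sep_subset _ _)
    · exact hY.closed.inter (hY.closed.preimage (continuous_const_mul g))
    · rintro _ ⟨t, rfl⟩ z ⟨hz, hgz⟩
      refine ⟨hY.left _ ⟨t, rfl⟩ _ hz, ?_⟩
      rw [← mul_assoc, hg, mul_assoc]
      exact hY.left _ ⟨_, rfl⟩ _ hgz
    · intro γ hγ z ⟨hz, hgz⟩
      refine ⟨hY.right γ hγ _ hz, ?_⟩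
      rw [← mul_assoc]
      exact hY.right γ hγ _ hgz
  intro z hz
  rw [← this] at hz
  exact hz.2

lemma Norm.mul_un' {g : G4} {κ s' β' : ℝ} (hg : Norm g κ s' β') (t : ℝ) :
    g * un t = un (κ⁻¹ * t) * g := by
  rw [hg.mul_un, div_eq_inv_mul]

lemma Norm.inv_mul_un {g : G4} {κ s' β' : ℝ} (hg : Norm g κ s' β') (t : ℝ) :
    g⁻¹ * un t = un (κ * t) * g⁻¹ := by
  rw [inv_mul_eq_iff_eq_mul, ← mul_assoc, hg.mul_un, mul_div_cancel_left₀ _ hg.pos.ne',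
    mul_inv_cancel_right]

lemma tm_add (s β s' β' : ℝ) : tm (s + s') (β + β') = tm s β + tm s' β' := by
  ext i j
  fin_cases i <;> fin_cases j <;> simp [tm, mul_add]

lemma Norm.pull_jm_add_tm {g : G4} {κ s' β' : ℝ} (hg : Norm g κ s' β') (s β : ℝ) :
    pull (jm + tm s β) g = jm + tm (κ ^ 2 * s + s') (κ * β + β') := by
  rw [pull_add, hg.pull_jm, hg.pull_tm, add_assoc, ← tm_add, add_comm s', add_comm β']

lemma Norm.pull_jm_add_tm_inv {g : G4} {κ s' β' : ℝ} (hg : Norm g κ s' β') (s β : ℝ) :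
    pull (jm + tm s β) g⁻¹ =
      jm + tm (κ⁻¹ ^ 2 * s + -(κ⁻¹ ^ 2 * s')) (κ⁻¹ * β + -(κ⁻¹ * β')) := by
  have hκ := hg.pos.ne'
  have := hg.pull_jm_add_tm (κ⁻¹ ^ 2 * s + -(κ⁻¹ ^ 2 * s')) (κ⁻¹ * β + -(κ⁻¹ * β'))
  rw [show κ ^ 2 * (κ⁻¹ ^ 2 * s + -(κ⁻¹ ^ 2 * s')) + s' = s by field_simp; ring,
    show κ * (κ⁻¹ * β + -(κ⁻¹ * β')) + β' = β by field_simp; ring] at this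
  rw [← this, ← pull_mul, mul_inv_cancel, pull_one]

/-- Translation in the isotropic direction. -/
def pv (s β : ℝ) : G4 :=
  ⟨!![1, 0, s, β; 0, 1, 0, 0; 0, 0, 1, 0; 0, 0, 0, 1], by
    simp [Matrix.det_succ_row_zero, Fin.sum_univ_succ, Fin.succAbove]⟩

lemma pv_mem (s β : ℝ) : pv s β ∈ affineGroup := mem_affineGroup.mpr (by simp [pv])

lemma pull_jm_pv (s β : ℝ) : pull jm (pv s β) = jm + tm s β := by
  rw [pull]
  ext i j
  fin_cases i <;> fin_cases j <;>
    simp [pv, jm, tm, Matrix.mul_apply, Fin.sum_univ_four, two_mul]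

lemma exists_norm_of_good {S : Set ℝ} {y : G4} {U : Set M4}
    (hU : ∀ p ∈ U, ∀ a ∈ affineGroup, p = pull jm a → Good S p y → ∃ s β, p = jm + tm s β)
    {g : G4} (hg : g ∈ affineGroup) (hpos : 0 < g 2 2) {s β : ℝ} (hne : ¬(s = 0 ∧ β = 0))
    (h1 : pull jm g ∈ U) (h2 : pull (jm + tm s β) g ∈ U) (hj : Good S jm (g * y))
    (hs : Good S (jm + tm s β) (g * y)) : ∃ s' β', Norm g (g 2 2) s' β' := by
  obtain ⟨s1, β1, e1⟩ := hU _ h1 g hg rfl (good_mul.mp hj)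
  obtain ⟨s2, β2, e2⟩ := hU _ h2 (pv s β * g) (mul_mem (pv_mem s β) hg)
    (by rw [pull_mul, pull_jm_pv]) (good_mul.mp hs)
  refine ⟨s1, β1, exists_norm hg hne ?_ e1 hpos⟩
  rw [pull_add, e1, add_assoc, add_right_inj] at e2
  rw [eq_sub_of_add_eq' e2, map_sub, der_tm, der_tm, sub_self]

/-- The set of parameters of a minimal set is preserved by normalizing return elements, hence
these are trivial if they are close to the identity. -/
lemma Norm.trivial_of_barrier {S : Set ℝ} {Y : Set G4}
    (hY : IsMinInv (Set.range un) latticeGroup Y) (hJ : ∀ y ∈ Y, Good S jm y) {y : G4} (hy : y ∈ Y)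
    {P : ℝ → ℝ → Prop} {R ε : ℝ} (hε : 0 < ε)
    (hsmall : ∀ s β, |s| ≤ ε → |β| ≤ ε → P s β) (hbd : ∀ s β, P s β → |s| ≤ R ∧ |β| ≤ R)
    (hstep : ∀ s β s' β', Good S (jm + tm s β) y → Good S (jm + tm s' β') y → P s β →
      |s - s'| ≤ ε → |β - β'| ≤ ε → P s' β')
    {s β : ℝ} (hΘ : ∀ z ∈ Y, Good S (jm + tm s β) z) (hs : |s| ≤ ε) (hβ : |β| ≤ ε)
    (hne : ¬(s = 0 ∧ β = 0)) {g : ℕ → G4} (hg1 : Tendsto g atTop (𝓝 1)) (hgy : ∀ n, g n * y ∈ Y)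
    (hg : ∀ᶠ n in atTop, ∃ s' β', Norm (g n) (g n 2 2) s' β') :
    ∀ᶠ n in atTop, g n = un (g n 0 1) := by
  have hlim : Tendsto (fun n => pull jm (g n)) atTop (𝓝 jm) := by
    have := ((continuous_pull_right jm).tendsto 1).comp hg1
    rwa [pull_one] at this
  have hent : ∀ i j, Tendsto (fun n => pull jm (g n) i j) atTop (𝓝 (jm i j)) := fun i j =>
    ((continuous_apply j).tendsto _).comp (((continuous_apply i).tendsto _).comp hlim)
  have hκ : Tendsto (fun n => g n 2 2) atTop (𝓝 1) := by
    have := ((continuous_entry 2 2).tendsto _).comp hg1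
    simpa [Function.comp_def] using this
  have hκ' : Tendsto (fun n => (g n 2 2)⁻¹) atTop (𝓝 1) := by
    have := hκ.inv₀ one_ne_zero
    rwa [inv_one] at this
  have hs' : Tendsto (fun n => pull jm (g n) 2 2 / 2) atTop (𝓝 0) := by
    have := (hent 2 2).div_const 2
    simpa [jm] using this
  have hβ' : Tendsto (fun n => pull jm (g n) 2 3) atTop (𝓝 0) := by
    have := hent 2 3
    simpa [jm] using this
  have q1 : ∀ᶠ n in atTop, |g n 2 2 ^ 2 - 1| * R + |pull jm (g n) 2 2 / 2| ≤ ε := by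
    have := ((((hκ.pow 2).sub_const 1).abs.mul_const R).add hs'.abs)
    exact (this.eventually_lt_const (by simpa)).mono fun _ h => h.le
  have q2 : ∀ᶠ n in atTop, |g n 2 2 - 1| * R + |pull jm (g n) 2 3| ≤ ε := by
    have := (((hκ.sub_const 1).abs.mul_const R).add hβ'.abs)
    exact (this.eventually_lt_const (by simpa)).mono fun _ h => h.le
  have q3 : ∀ᶠ n in atTop, |(g n 2 2)⁻¹ ^ 2 - 1| * R +
      |-((g n 2 2)⁻¹ ^ 2 * (pull jm (g n) 2 2 / 2))| ≤ ε := by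
    have := ((((hκ'.pow 2).sub_const 1).abs.mul_const R).add ((hκ'.pow 2).mul hs').neg.abs)
    exact (this.eventually_lt_const (by simpa)).mono fun _ h => h.le
  have q4 : ∀ᶠ n in atTop, |(g n 2 2)⁻¹ - 1| * R + |-((g n 2 2)⁻¹ * pull jm (g n) 2 3)| ≤ ε := by
    have := (((hκ'.sub_const 1).abs.mul_const R).add (hκ'.mul hβ').neg.abs)
    exact (this.eventually_lt_const (by simpa)).mono fun _ h => h.le
  filter_upwards [q1, q2, q3, q4, hg] with n q1 q2 q3 q4 ⟨s', β', hN⟩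
  have es : pull jm (g n) 2 2 / 2 = s' := by rw [hN.pull_jm]; simp [jm, tm]
  have eβ : pull jm (g n) 2 3 = β' := by rw [hN.pull_jm]; simp [jm, tm]
  rw [es] at q1 q3
  rw [eβ] at q2 q4
  have inv1 : ∀ z ∈ Y, g n * z ∈ Y := InvClosed.mem_of_mul_un hY hN.mul_un' hy (hgy n)
  have inv2 : ∀ z ∈ Y, (g n)⁻¹ * z ∈ Y :=
    InvClosed.mem_of_mul_un hY hN.inv_mul_un (hgy n) (by rwa [inv_mul_cancel_left])
  have h0 : ∀ z ∈ Y, Good S (jm + tm 0 0) z := by rwa [tm_zero, add_zero]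
  have hκpos := hN.pos
  rcases le_total 1 (g n 2 2) with h | h
  · obtain ⟨k1, k2, k3⟩ := affine_trivial (Θ := fun s β => ∀ z ∈ Y, Good S (jm + tm s β) z) h
      hsmall hbd (fun s β s' β' h h' => hstep s β s' β' (h y hy) (h' y hy))
      (fun s β h z hz => by
        rw [← hN.pull_jm_add_tm, ← good_mul]
        exact h _ (inv1 z hz)) h0 q1 q2 hΘ hs hβ hne
    exact hN.eq_un k1 k2 k3
  · obtain ⟨k1, k2, k3⟩ := affine_trivial (Θ := fun s β => ∀ z ∈ Y, Good S (jm + tm s β) z)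
      ((one_le_inv₀ hκpos).mpr h)
      hsmall hbd (fun s β s' β' h h' => hstep s β s' β' (h y hy) (h' y hy))
      (fun s β h z hz => by
        rw [← hN.pull_jm_add_tm_inv, ← good_mul]
        exact h _ (inv2 z hz)) h0 q3 q4 hΘ hs hβ hne
    rw [inv_eq_one] at k1
    rw [k1] at k2 k3
    exact hN.eq_un k1 (by simpa using k2) (by simpa using k3)

/-- A point returning along the unipotent flow cannot have the flow periods shrunk. -/
lemma not_periodic {y γ a : G4} {t χ : ℝ} (ht : t ≠ 0) (hγ : γ ∈ latticeGroup)
    (hty : un t * y = y * γ) {γ' : G4} (hγ' : γ' ∈ latticeGroup) (hay : a * y = y * γ')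
    (ha : ∀ t, a * un t = un (χ * t) * a) (hχ0 : χ ≠ 0) (hχ : |χ| < 1) : False := by
  have hD : ∀ j : ℕ, ∃ δ ∈ latticeGroup, un (χ ^ j * t) * y = y * δ := fun j => by
    induction j with
    | zero => exact ⟨γ, hγ, by simpa⟩
    | succ j ih =>
      obtain ⟨δ, hδ, e⟩ := ih
      refine ⟨γ' * δ * γ'⁻¹, mul_mem (mul_mem hγ' hδ) (inv_mem hγ'), ?_⟩
      have h1 := ha (χ ^ j * t)
      rw [← mul_assoc, ← pow_succ'] at h1
      calc un (χ ^ (j + 1) * t) * y = un (χ ^ (j + 1) * t) * (a * y) * γ'⁻¹ := by rw [hay]; group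
        _ = a * (un (χ ^ j * t) * y) * γ'⁻¹ := by
          rw [← mul_assoc (un _), ← h1]
          simp only [mul_assoc]
        _ = y * (γ' * δ * γ'⁻¹) := by
          rw [e, ← mul_assoc a, hay]
          simp only [mul_assoc]
  choose δ hδ e using hD
  have hδ' : ∀ j, δ j = y⁻¹ * (un (χ ^ j * t) * y) := fun j => by rw [e]; group
  have hlim : Tendsto δ atTop (𝓝 1) := by
    have h0 : Tendsto (fun j : ℕ => χ ^ j * t) atTop (𝓝 0) := by
      simpa using (tendsto_pow_atTop_nhds_zero_of_abs_lt_one hχ).mul_const t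
    have hc : Continuous fun τ => y⁻¹ * (un τ * y) :=
      continuous_const.mul (continuous_un.mul continuous_const)
    have := (hc.tendsto 0).comp h0
    rw [un_zero, one_mul, inv_mul_cancel] at this
    exact this.congr fun j => (hδ' j).symm
  obtain ⟨j, hj⟩ := (eventually_eq_one_of_tendsto hδ hlim).exists
  have h1 := e j
  rw [hj, mul_one, mul_eq_right] at h1
  have h2 := congrArg (fun g : G4 => g 0 1) h1
  simp [coe_un, hχ0, ht] at h2

end IrratQuad

namespace IrratQuad

open Matrix Topology Filter

lemma mem_affine_of_mul_eq {g h y γ : G4} (hh : h ∈ affineGroup) (hy : y ∈ affineGroup)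
    (hγ : γ ∈ latticeGroup) (e : g * y = h * y * γ) : g ∈ affineGroup := by
  rw [← mul_inv_cancel_right g y, e]
  exact mul_mem (mul_mem (mul_mem hh hy) hγ.1) (inv_mem hy)

lemma flow_mem {h : G4} (hh : h ∈ flow) : h ∈ affineGroup := by
  obtain ⟨t, s, rfl⟩ := hh
  exact mul_mem (un_mem t) (dg_mem s)

lemma pull_jm_flow {h : G4} (hh : h ∈ flow) : pull jm h = jm := by
  obtain ⟨t, s, rfl⟩ := hh
  rw [pull_mul, pull_jm_un, pull_jm_dg]

lemma exists_forall_pull_mem {U : Set M4} {g : G4} (c : ℝ) (hU : U ∈ 𝓝 (pull jm g)) :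
    ∃ ε > 0, ∀ s β : ℝ, |s| ≤ ε → |β| ≤ ε → pull (jm + tm (c ^ 2 * s) (c * β)) g ∈ U := by
  have h1 : Continuous fun x : ℝ × ℝ => tm (c ^ 2 * x.1) (c * x.2) :=
    continuous_tm.comp (f := fun x : ℝ × ℝ => (c ^ 2 * x.1, c * x.2)) (by fun_prop)
  have h2 : Continuous fun x : ℝ × ℝ => jm + tm (c ^ 2 * x.1) (c * x.2) :=
    continuous_const.add h1
  have h3 : Continuous fun x : ℝ × ℝ => pull (jm + tm (c ^ 2 * x.1) (c * x.2)) g :=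
    continuous_pull.comp (h2.prodMk continuous_const)
  have hc := h3.tendsto 0
  simp only [Prod.fst_zero, Prod.snd_zero, mul_zero, tm_zero, add_zero] at hc
  obtain ⟨r, hr, h⟩ := Metric.eventually_nhds_iff.mp (hc.eventually_mem hU)
  refine ⟨r / 2, by positivity, fun s β hs hβ => h (y := (s, β)) ?_⟩
  rw [dist_zero_right, Prod.norm_def]
  exact max_lt (by simp only [Real.norm_eq_abs]; linarith)
    (by simp only [Real.norm_eq_abs]; linarith)

lemma eventually_pos_entry {g : ℕ → G4} (hg : Tendsto g atTop (𝓝 1)) :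
    ∀ᶠ n in atTop, 0 < g n 2 2 :=
  (((continuous_entry 2 2).tendsto _).comp hg).eventually_const_lt (by simp)

lemma tendsto_pull_one {g : ℕ → G4} (p : M4) (hg : Tendsto g atTop (𝓝 1)) :
    Tendsto (fun n => pull p (g n)) atTop (𝓝 p) := by
  have := ((continuous_pull_right p).tendsto 1).comp hg
  rwa [pull_one] at this

/-- Arbitrarily small parameters force the unipotent flow to be periodic. -/
lemma IsMinInv.exists_period {S : Set ℝ} (hS : IsClosed S) (hne : S ≠ Set.univ)
    {Y K : Set G4} (hYA : Y ⊆ affineGroup) (hY : IsMinInv (Set.range un) latticeGroup Y)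
    (hK : IsCompact K)
    (hret : ∀ y ∈ Y, ∀ T, ∃ t, T ≤ t ∧ ∃ γ ∈ latticeGroup, un t * y * γ ∈ K)
    (hJ : ∀ y ∈ Y, Good S jm y) {y : G4} (hy : y ∈ Y) {U : Set M4} (hU : U ∈ 𝓝 jm)
    (hUmem : ∀ p ∈ U, ∀ a ∈ affineGroup, p = pull jm a → Good S p y → ∃ s β, p = jm + tm s β)
    (hΘ : ∀ ε > 0, ∃ s β, ¬(s = 0 ∧ β = 0) ∧ |s| ≤ ε ∧ |β| ≤ ε ∧ Good S (jm + tm s β) y) :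
    ∃ t, t ≠ 0 ∧ ∃ γ ∈ latticeGroup, un t * y = y * γ := by
  have hyA := hYA hy
  obtain ⟨P, R, ε, hε, hsmall, hbd, hstep⟩ := exists_barrier hS hne hyA
  obtain ⟨t, γ, g, ht, hγ, hg, hg1⟩ := hY.exists_return_un hK hret hy
  have hgA : ∀ n, g n ∈ affineGroup := fun n =>
    mem_affine_of_mul_eq (un_mem (t n)) hyA (hγ n) (hg n)
  have hgY : ∀ n, g n * y ∈ Y := fun n => by
    rw [hg]
    exact hY.right _ (hγ n) _ (hY.left _ ⟨_, rfl⟩ _ hy)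
  obtain ⟨ε', hε', hε'U⟩ := exists_forall_pull_mem (g := 1) 1
    (by rw [pull_one]; exact interior_mem_nhds.mpr hU)
  obtain ⟨s, β, hsβ, hs, hβ, hθ⟩ := hΘ (min ε ε') (lt_min hε hε')
  have hθU := hε'U s β (hs.trans (min_le_right _ _)) (hβ.trans (min_le_right _ _))
  rw [pull_one, one_pow, one_mul, one_mul, mem_interior_iff_mem_nhds] at hθU
  have hall : ∀ z ∈ Y, Good S (jm + tm s β) z := hY.good hS (pull_jm_add_tm_un s β) hy hθ
  have hN : ∀ᶠ n in atTop, ∃ s' β', Norm (g n) (g n 2 2) s' β' := by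
    filter_upwards [eventually_pos_entry hg1, (tendsto_pull_one jm hg1).eventually_mem hU,
      (tendsto_pull_one _ hg1).eventually_mem hθU] with n h0 h1 h2
    exact exists_norm_of_good hUmem (hgA n) h0 hsβ h1 h2 (hJ _ (hgY n)) (hall _ (hgY n))
  have hun := Norm.trivial_of_barrier hY hJ hy hε hsmall hbd hstep hall
    (hs.trans (min_le_left _ _)) (hβ.trans (min_le_left _ _)) hsβ hg1 hgY hN
  have hb : Tendsto (fun n => g n 0 1) atTop (𝓝 0) := by
    have := ((continuous_entry 0 1).tendsto _).comp hg1
    simpa [Function.comp_def] using this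
  obtain ⟨k, hk, hk1, hk2⟩ := (hun.and ((hb.eventually_lt_const one_pos).and
    (ht.eventually_gt_atTop 1))).exists
  refine ⟨g k 0 1 - t k, by linarith, γ k, hγ k, ?_⟩
  rw [sub_eq_neg_add, un_add, ← hk, mul_assoc, hg, un_neg]
  group

/-- Arbitrarily small parameters cannot occur. -/
theorem IsMinInv.false_of_small_params {S : Set ℝ} (hS : IsClosed S) (hne : S ≠ Set.univ)
    {Y Z L K : Set G4} (hZ : IsMinInv flow latticeGroup Z) (hZA : Z ⊆ affineGroup) (hYZ : Y ⊆ Z)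
    (hY : IsMinInv (Set.range un) latticeGroup Y) (hL : IsCompact L)
    (hLY : ∀ y ∈ Y, ∃ γ ∈ latticeGroup, y * γ ∈ L) (hK : IsCompact K)
    (hret : ∀ y ∈ Y, ∀ T, ∃ t, T ≤ t ∧ ∃ γ ∈ latticeGroup, un t * y * γ ∈ K)
    (hJ : ∀ y ∈ Y, Good S jm y) {y : G4} (hy : y ∈ Y)
    (hΘ : ∀ ε > 0, ∃ s β, ¬(s = 0 ∧ β = 0) ∧ |s| ≤ ε ∧ |β| ≤ ε ∧ Good S (jm + tm s β) y) :
    False := by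
  have hyA := hZA (hYZ hy)
  have hnear := hY.eventually_eq_jm_add_tm hS hne (hYZ.trans hZA) hL hLY hy
  set U : Set M4 := {p | ∀ a ∈ affineGroup, p = pull jm a → Good S p y → ∃ s β, p = jm + tm s β}
    with hUdef
  have hU : U ∈ 𝓝 jm := hnear
  have hUmem : ∀ p ∈ U, ∀ a ∈ affineGroup, p = pull jm a → Good S p y →
    ∃ s β, p = jm + tm s β := fun p hp => hp
  clear_value U
  obtain ⟨t, ht, γ, hγ, hper⟩ := hY.exists_period hS hne (hYZ.trans hZA) hK hret hJ hy hU hUmem hΘ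
  obtain ⟨σ, τ, γ', g', hσ, hγ', hg', hg1'⟩ := hZ.exists_return_flow hZA (hYZ hy)
  have hκ' : Tendsto (fun n => Real.exp (-σ n) * (g' n 2 2)⁻¹) atTop (𝓝 0) := by
    have h1 : Tendsto (fun n => g' n 2 2) atTop (𝓝 1) := by
      have := ((continuous_entry 2 2).tendsto _).comp hg1'
      simpa [Function.comp_def] using this
    have := (Real.tendsto_exp_neg_atTop_nhds_zero.comp hσ).mul (h1.inv₀ one_ne_zero)
    simpa [Function.comp_def] using this
  obtain ⟨n, hn0, hn1, hn2⟩ := ((eventually_pos_entry hg1').and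
    (((tendsto_pull_one jm hg1').eventually_mem (interior_mem_nhds.mpr hU)).and (hκ'.eventually_lt_const one_pos))).exists
  have hfl : un (τ n) * dg (σ n) ∈ flow := ⟨_, _, rfl⟩
  obtain ⟨ε, hε, hεU⟩ := exists_forall_pull_mem (Real.exp (σ n))
    (mem_interior_iff_mem_nhds.mp hn1)
  obtain ⟨s, β, hsβ, hs, hβ, hθ⟩ := hΘ ε hε
  obtain ⟨s', β', hN'⟩ := exists_norm_of_good hUmem
    (mem_affine_of_mul_eq (flow_mem hfl) hyA (hγ' n) (hg' n)) hn0
    (s := Real.exp (σ n) ^ 2 * s) (β := Real.exp (σ n) * β) (by simpa using hsβ)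
    (interior_subset hn1) (hεU s β hs hβ)
    (by
      rw [hg']
      refine Good.mul_lattice ?_ (hγ' n)
      rw [good_mul, pull_jm_flow hfl]
      exact hJ y hy)
    (by
      rw [hg']
      refine Good.mul_lattice ?_ (hγ' n)
      rw [good_mul, pull_add, pull_jm_flow hfl, pull_mul, pull_tm_un, pull_tm_dg, ← mul_assoc,
        ← mul_assoc, ← mul_pow, ← Real.exp_add, neg_add_cancel, Real.exp_zero, one_pow, one_mul,
        one_mul]
      exact hθ)
  have hχ : 0 < Real.exp (-σ n) * (g' n 2 2)⁻¹ := mul_pos (Real.exp_pos _) (inv_pos.mpr hn0)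
  refine not_periodic ht hγ hper (hγ' n)
    (a := (un (τ n) * dg (σ n))⁻¹ * g' n) (χ := Real.exp (-σ n) * (g' n 2 2)⁻¹) ?_ ?_ hχ.ne'
    (by rwa [abs_of_pos hχ])
  · rw [mul_assoc, hg']
    group
  · intro t
    rw [mul_assoc, hN'.mul_un', _root_.mul_inv_rev, ← un_neg, ← dg_neg, ← mul_assoc, mul_assoc (dg _),
      ← un_add, add_comm, un_add, ← mul_assoc (dg _), dg_mul_un]
    simp only [mul_assoc]

end IrratQuad

namespace IrratQuad

open Matrix Topology Filter

/-- Rationality of the nonconstant part of an inhomogeneous quadratic form up to scaling. -/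
def RatProp (q : M4) : Prop :=
  ∃ (t : ℝ) (A : Matrix (Fin 4) (Fin 4) ℚ), ∀ i j, ¬(i = 3 ∧ j = 3) → q i j = t * (A i j : ℝ)

lemma RatProp.pull_lattice {q : M4} (h : RatProp q) {γ : G4} (hγ : γ ∈ latticeGroup) :
    RatProp (pull q γ) := by
  obtain ⟨t, A, hA⟩ := h
  obtain ⟨hγA, h_int⟩ := mem_latticeGroup_iff.mp hγ
  choose B hB using h_int
  let C : Matrix (Fin 4) (Fin 4) ℚ := (Matrix.of B).map (Int.cast : ℤ → ℚ)
  have hC : (γ : M4) = C.map (Rat.castHom ℝ) := by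
    ext i j
    rw [hB]
    simp [C]
  have hq : q = t • A.map (Rat.castHom ℝ) + (q 3 3 - t * A 3 3) • em := by
    ext i j
    by_cases h : i = 3 ∧ j = 3
    · rw [h.1, h.2]
      simp [em]
    · rw [hA i j h]
      have : em i j = 0 := by fin_cases i <;> fin_cases j <;> first | rfl | exact absurd ⟨rfl, rfl⟩ h
      simp [this]
  refine ⟨t, Cᵀ * A * C, fun i j h => ?_⟩
  have he : em i j = 0 := by fin_cases i <;> fin_cases j <;> first | rfl | exact absurd ⟨rfl, rfl⟩ h
  have h1 : pull (A.map (Rat.castHom ℝ)) γ = (Cᵀ * A * C).map (Rat.castHom ℝ) := by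
    rw [pull, hC, Matrix.map_mul, Matrix.map_mul, Matrix.transpose_map]
  rw [hq, pull_add, pull_smul, pull_smul, pull_em hγA, h1]
  simp [he]

lemma ratProp_of_rigid {q : M4} (hq : qᵀ = q) (h : ∀ S' : M4, S'ᵀ = S' →
    (∀ γ ∈ latticeGroup, pull q γ = q → pull S' γ = S') → ∃ c d : ℝ, S' = c • q + d • em) :
    RatProp q := by
  by_cases hz : ∀ i j, ¬(i = 3 ∧ j = 3) → q i j = 0
  · exact ⟨0, 0, fun i j hij => by simp [hz i j hij]⟩
  push Not at hz
  obtain ⟨i, j, hij, hne⟩ := hz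
  obtain ⟨f, hf⟩ : ∃ f : Module.Dual ℚ ℝ, f (q i j) ≠ 0 := by
    by_contra! hf
    exact hne ((Module.forall_dual_apply_eq_zero_iff ℚ (q i j)).mp hf)
  have he : ∀ i j : Fin 4, ¬(i = 3 ∧ j = 3) → em i j = 0 := fun i j h => by
    fin_cases i <;> fin_cases j <;> first | rfl | exact absurd ⟨rfl, rfl⟩ h
  obtain ⟨c, d, hcd⟩ := h (Matrix.of fun i j => ((f (q i j) : ℚ) : ℝ))
    (by
      ext i j
      have := congrFun (congrFun hq i) j
      rw [Matrix.transpose_apply] at this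
      simp [this])
    (fun γ hγ hqγ => by
      choose B hB using (mem_latticeGroup_iff.mp hγ).2
      ext i j
      have hent : ∀ p : M4, pull p γ i j = ∑ l, ∑ k, ((B k i * B l j : ℤ) : ℝ) * p k l := fun p => by
        rw [pull, Matrix.mul_apply]
        refine Finset.sum_congr rfl fun l _ => ?_
        rw [Matrix.mul_apply, Finset.sum_mul]
        refine Finset.sum_congr rfl fun k _ => ?_
        rw [Matrix.transpose_apply, hB, hB]
        push_cast
        ring
      have h1 := hent q
      rw [hqγ] at h1
      rw [hent, Matrix.of_apply, h1]
      simp only [map_sum, ← zsmul_eq_mul, map_zsmul]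
      push_cast
      simp [zsmul_eq_mul])
  have hent : ∀ i j : Fin 4, ¬(i = 3 ∧ j = 3) → ((f (q i j) : ℚ) : ℝ) = c * q i j :=
    fun i j hij => by
      have := congrFun (congrFun hcd i) j
      simpa [he i j hij] using this
  have hc : c ≠ 0 := fun hc => hf (by simpa [hc] using hent i j fun h => hij h.1 h.2)
  refine ⟨c⁻¹, Matrix.of fun i j => f (q i j), fun i j hij => ?_⟩
  rw [Matrix.of_apply, hent i j hij, inv_mul_cancel_left₀ hc]

lemma eq_zero_of_tendsto_mul {u : ℕ → ℝ} {x l : ℝ} (hu : Tendsto u atTop atTop)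
    (h : Tendsto (fun n => u n * x) atTop (𝓝 l)) : x = 0 := by
  have h1 := h.mul hu.inv_tendsto_atTop
  rw [mul_zero] at h1
  refine tendsto_nhds_unique (tendsto_const_nhds.congr' ?_) h1
  filter_upwards [hu.eventually_gt_atTop 0] with n hn
  rw [Pi.inv_apply]
  field_simp

lemma pull_inv_eq {p : M4} {f g y γ : G4} (h : pull (pull p y) γ = pull p y)
    (hg : g * y = f * y * γ) : pull p f⁻¹ = pull p g⁻¹ := by
  have h1 : f⁻¹ = y * γ * y⁻¹ * g⁻¹ := by
    have : g = f * y * γ * y⁻¹ := by rw [← hg]; group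
    rw [this]; group
  rw [h1, pull_mul, pull_mul, pull_mul, h, ← pull_mul, ← pull_mul, mul_inv_cancel_left]

theorem IsMinInv.false_of_isolated_param {S : Set ℝ} (hS : IsClosed S)
    (hne : S ≠ Set.univ) {x₀ : G4} (hirr : ¬RatProp (pull jm x₀))
    (hx₀ : Good S jm x₀)
    {Y Z L K : Set G4} (hZ : IsMinInv flow latticeGroup Z) (hZA : Z ⊆ affineGroup) (hYZ : Y ⊆ Z)
    (hZX : Z ⊆ closure {x | x ∈ affineGroup ∧ ∃ γ ∈ latticeGroup, pull jm x = pull jm (x₀ * γ)})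
    (hY : IsMinInv (Set.range un) latticeGroup Y) (hL : IsCompact L)
    (hLY : ∀ y ∈ Y, ∃ γ ∈ latticeGroup, y * γ ∈ L) (hK : IsCompact K)
    (hret : ∀ y ∈ Y, ∀ T, ∃ t, T ≤ t ∧ ∃ γ ∈ latticeGroup, un t * y * γ ∈ K)
    (hJ : ∀ y ∈ Z, Good S jm y) {y : G4} (hy : y ∈ Y) {ε : ℝ} (hε : 0 < ε)
    (hΘ : ∀ s β, |s| ≤ ε → |β| ≤ ε → Good S (jm + tm s β) y → s = 0 ∧ β = 0) :
    False := by
  have hyA := hZA (hYZ hy)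
  have hnear : ∀ᶠ p in 𝓝 jm, ∀ a ∈ affineGroup, p = pull jm a → Good S p y → p = jm := by
    have h1 : ∀ᶠ p : M4 in 𝓝 jm, |p 2 2 / 2| < ε := by
      have : Continuous fun p : M4 => |p 2 2 / 2| := by fun_prop
      exact (this.tendsto jm).eventually_lt_const (by simpa [jm])
    have h2 : ∀ᶠ p : M4 in 𝓝 jm, |p 2 3| < ε := by
      have : Continuous fun p : M4 => |p 2 3| := by fun_prop
      exact (this.tendsto jm).eventually_lt_const (by simpa [jm])
    filter_upwards [hY.eventually_eq_jm_add_tm hS hne (hYZ.trans hZA) hL hLY hy, h1, h2]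
      with p hp h1 h2 a ha e hg
    obtain ⟨s, β, rfl⟩ := hp a ha e hg
    obtain ⟨rfl, rfl⟩ := hΘ s β (by simpa [jm, tm] using h1.le) (by simpa [jm, tm] using h2.le) hg
    rw [tm_zero, add_zero]
  obtain ⟨γ₀, hγ₀, hq⟩ : ∃ γ ∈ latticeGroup, pull jm y = pull jm (x₀ * γ) := by
    have hc : Continuous fun x : G4 => pull jm (x * y⁻¹) :=
      (continuous_pull_right jm).comp (continuous_mul_const _)
    have h1 := hc.tendsto y
    rw [mul_inv_cancel, pull_one] at h1
    obtain ⟨x, hx, hxA, γ, hγ, e⟩ := mem_closure_iff_nhds.mp (hZX (hYZ hy)) _ (h1.eventually hnear)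
    have h2 : pull jm (x * y⁻¹) = jm := by
      refine hx _ (mul_mem hxA (inv_mem hyA)) rfl ?_
      rw [← good_mul, inv_mul_cancel_right, ← mul_one x, good_mul, e, ← good_mul, mul_one]
      exact hx₀.mul_lattice hγ
    refine ⟨γ, hγ, ?_⟩
    rw [← e, ← inv_mul_cancel_right x y, pull_mul, h2]
  have hstab : ∀ {f γ g : G4}, f ∈ flow → γ ∈ latticeGroup → g * y = f * y * γ →
      pull jm g = jm → pull (pull jm y) γ = pull jm y := fun {f γ g} hf _ e hg => by
    have : pull jm (g * y) = pull jm y := by rw [pull_mul, hg]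
    rw [e, pull_mul, pull_mul, pull_jm_flow hf] at this
    exact this
  obtain ⟨t, γ, g, ht, hγ, hg, hg1⟩ := hY.exists_return_un hK hret hy
  obtain ⟨σ, τ, γ', g', hσ, hγ', hg', hg1'⟩ := hZ.exists_return_flow hZA (hYZ hy)
  have hjm : ∀ {f γ g : ℕ → G4}, (∀ n, f n ∈ flow) → (∀ n, γ n ∈ latticeGroup) →
      (∀ n, g n * y = f n * y * γ n) → Tendsto g atTop (𝓝 1) →
      ∀ᶠ n in atTop, pull (pull jm y) (γ n) = pull jm y := fun {f γ g} hf hγ e hg1 => by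
    filter_upwards [(tendsto_pull_one jm hg1).eventually hnear] with n hn
    refine hstab (hf n) (hγ n) (e n) (hn _ (mem_affine_of_mul_eq (flow_mem (hf n)) hyA (hγ n) (e n))
      rfl ?_)
    rw [← good_mul, e]
    refine Good.mul_lattice ?_ (hγ n)
    rw [good_mul, pull_jm_flow (hf n)]
    exact hJ y (hYZ hy)
  have hst := hjm (fun n => range_un_subset_flow ⟨t n, rfl⟩) hγ hg hg1
  have hst' := hjm (f := fun n => un (τ n) * dg (σ n)) (fun n => ⟨_, _, rfl⟩) hγ' hg' hg1'
  have hrat : RatProp (pull jm y) := by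
    refine ratProp_of_rigid (by rw [transpose_pull, transpose_jm]) fun S' hS' hinv => ?_
    obtain ⟨p, hp⟩ : ∃ p, p = pull S' y⁻¹ := ⟨_, rfl⟩
    have hpy : pull p y = S' := by rw [hp, ← pull_mul, inv_mul_cancel, pull_one]
    have hlim : ∀ {f γ g : ℕ → G4}, (∀ n, γ n ∈ latticeGroup) →
        (∀ n, g n * y = f n * y * γ n) → Tendsto g atTop (𝓝 1) →
        (∀ᶠ n in atTop, pull (pull jm y) (γ n) = pull jm y) →
        Tendsto (fun n => pull p (f n)⁻¹) atTop (𝓝 p) := fun {f γ g} hγ e hg1 hst => by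
      have h1 : Tendsto (fun n => (g n)⁻¹) atTop (𝓝 1) := by simpa using hg1.inv
      refine (tendsto_pull_one p h1).congr' ?_
      filter_upwards [hst] with n hn
      refine (pull_inv_eq ?_ (e n)).symm
      rw [hpy]
      exact hinv _ (hγ n) hn
    have hder : der p = 0 := der_eq_zero_of_tendsto ht (p' := p) (by
      simpa only [un_neg] using hlim hγ hg hg1 hst)
    have hpe := eq_of_der_eq_zero (by rw [hp, transpose_pull, hS']) hder
    obtain ⟨c, s, β, d, hpe⟩ : ∃ c s β d : ℝ, p = c • jm + tm s β + d • em := ⟨_, _, _, _, hpe⟩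
    have hlim' := hlim hγ' hg' hg1' hst'
    have hform : ∀ n, pull p (un (τ n) * dg (σ n))⁻¹ = c • jm +
        tm (Real.exp (σ n) ^ 2 * s) (Real.exp (σ n) * β) + d • em := fun n => by
      rw [_root_.mul_inv_rev, ← un_neg, ← dg_neg, pull_mul, hpe]
      simp only [pull_add, pull_smul, pull_jm_dg, pull_jm_un, pull_tm_dg, pull_tm_un,
        pull_em (dg_mem _), pull_em (un_mem _), neg_neg]
    simp only [hform] at hlim'
    have hent : ∀ i j, Tendsto (fun n => (c • jm + tm (Real.exp (σ n) ^ 2 * s)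
        (Real.exp (σ n) * β) + d • em) i j) atTop (𝓝 (p i j)) := fun i j =>
      ((continuous_apply j).tendsto _).comp (((continuous_apply i).tendsto _).comp hlim')
    have hexp := Real.tendsto_exp_atTop.comp hσ
    have hs : s = 0 := by
      have h1 := (hent 2 2).div_const 2
      refine eq_zero_of_tendsto_mul (u := fun n => Real.exp (σ n) ^ 2)
        (tendsto_pow_atTop two_ne_zero |>.comp hexp) (l := p 2 2 / 2) ?_
      simpa [jm, tm, em] using h1
    have hβ : β = 0 := by
      have h1 := hent 2 3
      refine eq_zero_of_tendsto_mul (u := fun n => Real.exp (σ n)) hexp (l := p 2 3) ?_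
      simpa [jm, tm, em] using h1
    refine ⟨c, d, ?_⟩
    rw [← hpy, hpe, hs, hβ, tm_zero, add_zero, pull_add, pull_smul, pull_smul, pull_em hyA]
  apply hirr
  have := hrat.pull_lattice (inv_mem hγ₀)
  rwa [hq, ← pull_mul, mul_inv_cancel_right] at this

/-- The values of an irrational inhomogeneous ternary form on integer points are dense. -/
theorem eq_univ_of_not_ratProp {S : Set ℝ} (hS : IsClosed S) {x₀ : G4} (hx₀A : x₀ ∈ affineGroup)
    (hx₀ : Good S jm x₀) (hirr : ¬RatProp (pull jm x₀)) : S = Set.univ := by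
  by_contra hne
  set X := {x | x ∈ affineGroup ∧ ∃ γ ∈ latticeGroup, pull jm x = pull jm (x₀ * γ)} with hX
  have hXJ : ∀ x ∈ closure X, Good S jm x := by
    have hcl : IsClosed {x | Good S jm x} :=
      (isClosed_good hS).preimage (f := fun y => (jm, y)) (by fun_prop)
    refine closure_minimal ?_ hcl
    rintro x ⟨-, γ, hγ, e⟩
    change Good S jm x
    rw [← mul_one x, good_mul, e, ← good_mul, mul_one]
    exact hx₀.mul_lattice hγ
  have hXA : closure X ⊆ affineGroup := closure_minimal (fun x hx => hx.1) isClosed_affineGroup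
  have hinv : InvClosed flow latticeGroup (closure X) := by
    refine invClosed_closure ⟨x₀, hx₀A, 1, one_mem _, by rw [mul_one]⟩ ?_ ?_
    · rintro h hh x ⟨hxA, γ, hγ, e⟩
      exact ⟨mul_mem (flow_mem hh) hxA, γ, hγ, by rw [pull_mul, pull_jm_flow hh, e]⟩
    · rintro δ hδ x ⟨hxA, γ, hγ, e⟩
      refine ⟨mul_mem hxA hδ.1, γ * δ, mul_mem hγ hδ, ?_⟩
      rw [pull_mul, e, ← pull_mul, mul_assoc]
  obtain ⟨K₀, hK₀, hret₀⟩ := exists_return_dg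
  obtain ⟨Z, hZX, hZ⟩ := exists_isMinInv hinv hK₀ fun y hy => by
    obtain ⟨s, -, t, γ, hγ, h⟩ := hret₀ y (hXA hy) 0
    exact ⟨_, ⟨t, s, rfl⟩, γ, hγ, h⟩
  have hZA := hZX.trans hXA
  have hZJ : ∀ y ∈ Z, Good S jm y := fun y hy => hXJ y (hZX hy)
  have hZu : InvClosed (Set.range un) latticeGroup Z :=
    ⟨hZ.closed, hZ.nonempty, fun h hh => hZ.left h (range_un_subset_flow hh), hZ.right⟩
  obtain ⟨Y, hYZ, hY, K, hK, hret⟩ := hZu.exists_isMinInv_un hS hne hZA hZJ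
  obtain ⟨L, hL, hLY⟩ := hY.exists_bounded isClosed_latticeGroup continuous_un un_add hK hret
  obtain ⟨y, hy⟩ := hY.nonempty
  have hYJ : ∀ y ∈ Y, Good S jm y := fun y hy => hZJ y (hYZ hy)
  by_cases hΘ : ∀ ε > 0, ∃ s β, ¬(s = 0 ∧ β = 0) ∧ |s| ≤ ε ∧ |β| ≤ ε ∧ Good S (jm + tm s β) y
  · exact hZ.false_of_small_params hS hne hZA hYZ hY hL hLY hK hret hYJ hy hΘ
  · push Not at hΘ
    obtain ⟨ε, hε, h⟩ := hΘ
    refine hZ.false_of_isolated_param hS hne hirr hx₀ hZA hYZ hZX hY hL hLY hK hret hZJ hy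
      hε fun s β hs hβ hg => ?_
    by_contra hsβ
    exact h s β (fun h1 h2 => hsβ ⟨h1, h2⟩) hs hβ hg

end IrratQuad

namespace IrratQuad

open Matrix Topology Filter

lemma exists_isotropic {V : Type*} [AddCommGroup V] [Module ℝ V] (B : LinearMap.BilinForm ℝ V)
    {x y : V} (hx : 0 < B x x) (hy : B y y < 0) : ∃ v ≠ 0, B v v = 0 := by
  let f : ℝ → ℝ := fun t =>
    (1 - t) ^ 2 * B x x + (1 - t) * t * (B x y + B y x) + t ^ 2 * B y y
  have hf : ∀ t, B ((1 - t) • x + t • y) ((1 - t) • x + t • y) = f t := fun t => by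
    simp only [map_add, map_smul, LinearMap.add_apply, LinearMap.smul_apply, smul_eq_mul, f]
    ring
  have hc : Continuous f := by fun_prop
  obtain ⟨t, -, ht⟩ := intermediate_value_Icc' zero_le_one hc.continuousOn
    (show (0 : ℝ) ∈ Set.Icc (f 1) (f 0) by simp [f, hx.le, hy.le])
  refine ⟨(1 - t) • x + t • y, fun h => ?_, by rw [hf, ht]⟩
  have h1 : (1 - t) • x = -(t • y) := eq_neg_of_add_eq_zero_left h
  have h2 := congrArg (fun z => B z z) h1
  simp only [map_neg, map_smul, LinearMap.smul_apply, LinearMap.neg_apply, smul_eq_mul] at h2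
  have h3 : (1 - t) ^ 2 * B x x = t ^ 2 * B y y := by linarith
  have h4 : t = 0 := by
    by_contra ht
    have : t ^ 2 * B y y < 0 := mul_neg_of_pos_of_neg (by positivity) hy
    have : 0 ≤ (1 - t) ^ 2 * B x x := by positivity
    linarith
  rw [h4] at h3
  norm_num at h3
  exact hx.ne' h3

lemma exists_cube_eq (x : ℝ) : ∃ y : ℝ, y ^ 3 = x := by
  have hodd : Odd 3 := by decide
  obtain ⟨y, hy⟩ := mem_range_of_exists_le_of_exists_ge (f := fun y : ℝ => y ^ 3) (by fun_prop)
    (c := x) ⟨-(|x| + 1), by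
      have := neg_abs_le x
      have : 0 ≤ |x| := abs_nonneg x
      nlinarith [sq_nonneg |x|, pow_nonneg this 3]⟩ ⟨|x| + 1, by
      have := le_abs_self x
      have : 0 ≤ |x| := abs_nonneg x
      nlinarith [sq_nonneg |x|, pow_nonneg this 3]⟩
  exact ⟨y, hy⟩

/-- The matrix of an inhomogeneous ternary quadratic polynomial. -/
def quadMat (a b c d e f p q r k : ℝ) : M4 :=
  !![a, b, c, p; b, d, e, q; c, e, f, r; p, q, r, k]

lemma exists_normal_form_of_basis {a b c d e f p q r k x y z X Y Z u v w η θ ζ μ ν D : ℝ}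
    (hν : ν ≠ 0)
    (hQ : a * x ^ 2 + d * y ^ 2 + f * z ^ 2 + 2 * b * x * y + 2 * c * x * z + 2 * e * y * z = 0)
    (hB : (a * x + b * y + c * z) * X + (b * x + d * y + e * z) * Y +
      (c * x + e * y + f * z) * Z = 1)
    (hW : a * X ^ 2 + d * Y ^ 2 + f * Z ^ 2 + 2 * b * X * Y + 2 * c * X * Z + 2 * e * Y * Z = 0)
    (hvu : (a * x + b * y + c * z) * u + (b * x + d * y + e * z) * v +
      (c * x + e * y + f * z) * w = 0)
    (hwu : (a * X + b * Y + c * Z) * u + (b * X + d * Y + e * Z) * v +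
      (c * X + e * Y + f * Z) * w = 0)
    (huu : a * u ^ 2 + d * v ^ 2 + f * w ^ 2 + 2 * b * u * v + 2 * c * u * w + 2 * e * v * w = -D)
    (hμν : μ ^ 2 * D = ν) (h0 : a * η + b * θ + c * ζ = -p) (h1 : b * η + d * θ + e * ζ = -q)
    (h2 : c * η + e * θ + f * ζ = -r)
    (hd : x * (v * Z - w * Y) - y * (u * Z - w * X) + z * (u * Y - v * X) = 1) (h3 : μ * ν = 1) :
    ∃ x₀ ∈ affineGroup, ∃ l δ : ℝ, l ≠ 0 ∧
      quadMat a b c d e f p q r k = l • pull jm x₀ + δ • em := by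
  let h : G4 := ⟨!![x, μ * u, ν * X, η; y, μ * v, ν * Y, θ; z, μ * w, ν * Z, ζ; 0, 0, 0, 1], by
      simp [Matrix.det_succ_row_zero, Fin.sum_univ_succ, Fin.succAbove]
      linear_combination μ * ν * hd + h3⟩
  have hh : h ∈ affineGroup := mem_affineGroup.mpr (by simp [h])
  have hent : ∀ i j, pull (quadMat a b c d e f p q r k) h i j =
      h 0 i * (a * h 0 j + b * h 1 j + c * h 2 j + p * h 3 j) +
      h 1 i * (b * h 0 j + d * h 1 j + e * h 2 j + q * h 3 j) +
      h 2 i * (c * h 0 j + e * h 1 j + f * h 2 j + r * h 3 j) +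
      h 3 i * (p * h 0 j + q * h 1 j + r * h 2 j + k * h 3 j) := fun i j => by
    rw [pull, Matrix.mul_assoc, Matrix.mul_apply]
    simp [quadMat, Matrix.mul_apply, Fin.sum_univ_four]
  have hpull : pull (quadMat a b c d e f p q r k) h = ν • jm +
      (pull (quadMat a b c d e f p q r k) h 3 3) • em := by
    have hsymm : (quadMat a b c d e f p q r k)ᵀ = quadMat a b c d e f p q r k := by
      ext i j; fin_cases i <;> fin_cases j <;> rfl
    obtain ⟨M, hM⟩ : ∃ M, M = pull (quadMat a b c d e f p q r k) h := ⟨_, rfl⟩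
    have hMs : ∀ i j, M j i = M i j := fun i j => by
      have := congrFun (congrFun (transpose_pull (quadMat a b c d e f p q r k) h) i) j
      rwa [hsymm, ← hM] at this
    have m00 : M 0 0 = 0 := by
      rw [hM, hent]; simp [h]; linear_combination hQ
    have m01 : M 0 1 = 0 := by
      rw [hM, hent]; simp [h]; linear_combination μ * hvu
    have m02 : M 0 2 = ν := by
      rw [hM, hent]; simp [h]; linear_combination ν * hB
    have m03 : M 0 3 = 0 := by
      rw [hM, hent]; simp [h]; linear_combination x * h0 + y * h1 + z * h2
    have m11 : M 1 1 = -ν := by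
      rw [hM, hent]; simp [h]; linear_combination μ ^ 2 * huu - hμν
    have m12 : M 1 2 = 0 := by
      rw [hM, hent]; simp [h]; linear_combination μ * ν * hwu
    have m13 : M 1 3 = 0 := by
      rw [hM, hent]; simp [h]; linear_combination μ * (u * h0 + v * h1 + w * h2)
    have m22 : M 2 2 = 0 := by
      rw [hM, hent]; simp [h]; linear_combination ν ^ 2 * hW
    have m23 : M 2 3 = 0 := by
      rw [hM, hent]; simp [h]; linear_combination ν * (X * h0 + Y * h1 + Z * h2)
    rw [← hM]
    ext i j
    fin_cases i <;> fin_cases j <;>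
      simp [jm, em, m00, m01, m02, m03, m11, m12, m13, m22, m23, hMs 0 1, hMs 0 2, hMs 0 3,
        hMs 1 2, hMs 1 3, hMs 2 3]
  refine ⟨h⁻¹, inv_mem hh, ν, pull (quadMat a b c d e f p q r k) h 3 3, hν, ?_⟩
  calc quadMat a b c d e f p q r k
      = pull (pull (quadMat a b c d e f p q r k) h) h⁻¹ := by
        rw [← pull_mul, mul_inv_cancel, pull_one]
    _ = _ := by
        conv_lhs => rw [hpull, pull_add, pull_smul, pull_smul, pull_em (inv_mem hh)]

/-- Normal form of indefinite inhomogeneous ternary quadratic polynomials. -/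
lemma exists_normal_form (a b c d e f p q r k : ℝ)
    (hdet : a * (d * f - e * e) - b * (b * f - e * c) + c * (b * e - d * c) ≠ 0)
    {x y z : ℝ} (hv : ¬(x = 0 ∧ y = 0 ∧ z = 0))
    (hQ : a * x ^ 2 + d * y ^ 2 + f * z ^ 2 + 2 * b * x * y + 2 * c * x * z + 2 * e * y * z = 0) :
    ∃ x₀ ∈ affineGroup, ∃ l δ : ℝ, l ≠ 0 ∧
      quadMat a b c d e f p q r k = l • pull jm x₀ + δ • em := by
  set D := a * (d * f - e * e) - b * (b * f - e * c) + c * (b * e - d * c) with hD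
  obtain ⟨x', y', z', h1⟩ : ∃ x' y' z' : ℝ, (a * x + b * y + c * z) * x' +
      (b * x + d * y + e * z) * y' + (c * x + e * y + f * z) * z' = 1 := by
    set α := a * x + b * y + c * z with hα
    set β := b * x + d * y + e * z with hβ
    set γ := c * x + e * y + f * z with hγ
    have hne : α ^ 2 + β ^ 2 + γ ^ 2 ≠ 0 := fun h => by
      have k1 : α = 0 := by nlinarith [sq_nonneg α, sq_nonneg β, sq_nonneg γ]
      have k2 : β = 0 := by nlinarith [sq_nonneg α, sq_nonneg β, sq_nonneg γ]
      have k3 : γ = 0 := by nlinarith [sq_nonneg α, sq_nonneg β, sq_nonneg γ]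
      refine hv ⟨?_, ?_, ?_⟩
      · refine (mul_eq_zero.mp (?_ : D * x = 0)).resolve_left hdet
        rw [hD]
        linear_combination (d * f - e * e) * k1 - (b * f - c * e) * k2 + (b * e - c * d) * k3
      · refine (mul_eq_zero.mp (?_ : D * y = 0)).resolve_left hdet
        rw [hD]
        linear_combination -(b * f - c * e) * k1 + (a * f - c * c) * k2 - (a * e - b * c) * k3
      · refine (mul_eq_zero.mp (?_ : D * z = 0)).resolve_left hdet
        rw [hD]
        linear_combination (b * e - c * d) * k1 - (a * e - b * c) * k2 + (a * d - b * b) * k3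
    refine ⟨α / (α ^ 2 + β ^ 2 + γ ^ 2), β / (α ^ 2 + β ^ 2 + γ ^ 2),
      γ / (α ^ 2 + β ^ 2 + γ ^ 2), ?_⟩
    field_simp
  obtain ⟨X, Y, Z, hB, hW⟩ : ∃ X Y Z : ℝ, (a * x + b * y + c * z) * X +
      (b * x + d * y + e * z) * Y + (c * x + e * y + f * z) * Z = 1 ∧
      a * X ^ 2 + d * Y ^ 2 + f * Z ^ 2 + 2 * b * X * Y + 2 * c * X * Z + 2 * e * Y * Z = 0 := by
    set τ := (a * x' ^ 2 + d * y' ^ 2 + f * z' ^ 2 + 2 * b * x' * y' + 2 * c * x' * z' +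
      2 * e * y' * z') / 2 with hτ
    refine ⟨x' - τ * x, y' - τ * y, z' - τ * z, ?_, ?_⟩
    · linear_combination h1 - τ * hQ
    · linear_combination -2 * τ * h1 + τ ^ 2 * hQ - 2 * hτ
  obtain ⟨u, v, w, hvu, hwu, huu, hd⟩ : ∃ u v w : ℝ,
      (a * x + b * y + c * z) * u + (b * x + d * y + e * z) * v + (c * x + e * y + f * z) * w = 0 ∧
      (a * X + b * Y + c * Z) * u + (b * X + d * Y + e * Z) * v + (c * X + e * Y + f * Z) * w = 0 ∧
      a * u ^ 2 + d * v ^ 2 + f * w ^ 2 + 2 * b * u * v + 2 * c * u * w + 2 * e * v * w = -D ∧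
      x * (v * Z - w * Y) - y * (u * Z - w * X) + z * (u * Y - v * X) = 1 := by
    refine ⟨(b * x + d * y + e * z) * (c * X + e * Y + f * Z) -
        (c * x + e * y + f * z) * (b * X + d * Y + e * Z),
      (c * x + e * y + f * z) * (a * X + b * Y + c * Z) -
        (a * x + b * y + c * z) * (c * X + e * Y + f * Z),
      (a * x + b * y + c * z) * (b * X + d * Y + e * Z) -
        (b * x + d * y + e * z) * (a * X + b * Y + c * Z), by ring, by ring, ?_, ?_⟩
    · rw [hD]
      linear_combination D * (a * X ^ 2 + d * Y ^ 2 + f * Z ^ 2 + 2 * b * X * Y + 2 * c * X * Z +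
        2 * e * Y * Z) * hQ - D * ((a * x + b * y + c * z) * X +
        (b * x + d * y + e * z) * Y + (c * x + e * y + f * z) * Z + 1) * hB
    · linear_combination ((a * x + b * y + c * z) * X +
        (b * x + d * y + e * z) * Y + (c * x + e * y + f * z) * Z + 1) * hB -
        (a * X ^ 2 + d * Y ^ 2 + f * Z ^ 2 + 2 * b * X * Y + 2 * c * X * Z +
        2 * e * Y * Z) * hQ
  obtain ⟨μ, hμ⟩ := exists_cube_eq D⁻¹
  have hμD : μ ^ 3 * D = 1 := by rw [hμ, inv_mul_cancel₀ hdet]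
  obtain ⟨η, θ, ζ, h0, h1, h2⟩ : ∃ η θ ζ : ℝ, a * η + b * θ + c * ζ = -p ∧
      b * η + d * θ + e * ζ = -q ∧ c * η + e * θ + f * ζ = -r := by
    refine ⟨-((d * f - e * e) * p - (b * f - c * e) * q + (b * e - c * d) * r) / D,
      -(-(b * f - c * e) * p + (a * f - c * c) * q - (a * e - b * c) * r) / D,
      -((b * e - c * d) * p - (a * e - b * c) * q + (a * d - b * b) * r) / D, ?_, ?_, ?_⟩
    all_goals
      field_simp
      rw [hD]
      ring
  refine exists_normal_form_of_basis (μ := μ) ?_ hQ hB hW hvu hwu huu (ν := μ ^ 2 * D) ?_ h0 h1 h2 hd ?_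
  · exact mul_ne_zero (pow_ne_zero 2 fun h => by rw [h] at hμD; norm_num at hμD) hdet
  · exact rfl
  · linear_combination hμD

end IrratQuad

namespace IrratQuad

open Matrix Topology Filter

lemma exists_ratio_of_not_dense {a b c d e f p q r k : ℝ} (ha : 0 < a) (hd : d < 0)
    (hdet : a * (d * f - e * e) - b * (b * f - e * c) + c * (b * e - d * c) ≠ 0)
    (hnd : ¬ Dense {t | ∃ m : Fin 4 → ℤ, m 3 = 1 ∧
      qv (quadMat a b c d e f p q r k) (toR m) = t}) :
    (∃ s : ℚ, f = s * a) ∧ ∃ s : ℚ, r = s * a := by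
  obtain ⟨V, hV, hVV⟩ := exists_isotropic (Matrix.toBilin' !![a, b, c; b, d, e; c, e, f])
    (x := Pi.single 0 1) (y := Pi.single 1 1) (by simpa using ha) (by simpa using hd)
  obtain ⟨x₀, hx₀, l, δ, hl, hP⟩ := exists_normal_form a b c d e f p q r k hdet
    (x := V 0) (y := V 1) (z := V 2)
    (fun h => hV (by ext i; fin_cases i <;> simp [h.1, h.2.1, h.2.2]))
    (by
      rw [← hVV]
      simp [Matrix.toBilin'_apply, Fin.sum_univ_three]
      ring)
  have hrat : RatProp (pull jm x₀) := by
    by_contra hirr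
    refine hnd fun y => ?_
    set T := {t | ∃ m : Fin 4 → ℤ, m 3 = 1 ∧
      qv (quadMat a b c d e f p q r k) (toR m) = t} with hT
    have huniv := eq_univ_of_not_ratProp (S := {s | l * s + δ ∈ closure T})
      (isClosed_closure.preimage (by fun_prop)) hx₀ (fun m hm => subset_closure ⟨m, hm, by
        rw [hP, ← qv_pull]
        simp [qv, em, hm, dotProduct, Matrix.mulVec, Fin.sum_univ_four]
        ring⟩) hirr
    have hy : (y - δ) / l ∈ {s | l * s + δ ∈ closure T} := by rw [huniv]; trivial
    simpa [mul_div_cancel₀, hl] using hy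
  obtain ⟨t, A, hA⟩ := hrat
  have key : ∀ i j, ¬(i = 3 ∧ j = 3) → quadMat a b c d e f p q r k i j = l * t * (A i j : ℝ) :=
    fun i j hij => by
      rw [hP, Matrix.add_apply, Matrix.smul_apply, Matrix.smul_apply, hA i j hij]
      have : em i j = 0 := by
        fin_cases i <;> fin_cases j <;> simp [em] at hij ⊢
      simp [this, mul_assoc]
  have k00 : a = l * t * (A 0 0 : ℝ) := by simpa [quadMat] using key 0 0 (by decide)
  have k22 : f = l * t * (A 2 2 : ℝ) := by simpa [quadMat] using key 2 2 (by decide)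
  have k23 : r = l * t * (A 2 3 : ℝ) := by simpa [quadMat] using key 2 3 (by decide)
  have hA0 : (A 0 0 : ℝ) ≠ 0 := fun h => by rw [h, mul_zero] at k00; exact ha.ne' k00
  refine ⟨⟨A 2 2 / A 0 0, ?_⟩, ⟨A 2 3 / A 0 0, ?_⟩⟩
  · rw [k22, k00]; push_cast; field_simp
  · rw [k23, k00]; push_cast; field_simp

section Reduction

variable {V : Type*} [AddCommGroup V] [Module ℝ V]

lemma eq_zero_of_forall_self_eq_zero {E : LinearMap.BilinForm ℝ V} {Λ : AddSubgroup V}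
    (hΛ : Submodule.span ℝ (Λ : Set V) = ⊤) (hE : ∀ x y, E x y = E y x)
    (h : ∀ w ∈ Λ, E w w = 0) : E = 0 := by
  have h1 : ∀ x ∈ Λ, ∀ y ∈ Λ, E x y = 0 := fun x hx y hy => by
    have := h _ (Λ.add_mem hx hy)
    simp only [map_add, LinearMap.add_apply, h x hx, h y hy, hE y x] at this
    linarith
  refine LinearMap.ext_on hΛ fun x hx => LinearMap.ext_on hΛ fun y hy => ?_
  simpa using h1 x hx y hy

/-- The Gram determinant of three vectors. -/
def gram (B : LinearMap.BilinForm ℝ V) (u v w : V) : ℝ :=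
  B u u * (B v v * B w w - B v w * B v w) - B u v * (B u v * B w w - B v w * B u w) +
    B u w * (B u v * B v w - B v v * B u w)

lemma exists_gram_form (B : LinearMap.BilinForm ℝ V) (hB : ∀ x y, B x y = B y x)
    (hnd : ∀ x, (∀ y, B y x = 0) → x = 0) (hdim : 2 < Module.finrank ℝ V) {u v : V}
    (hu : 0 < B u u) (hv : B v v < 0) :
    ∃ E : LinearMap.BilinForm ℝ V, (∀ x y, E x y = E y x) ∧ (∀ w, E w w = gram B u v w) ∧
      E ≠ 0 := by
  let δ := B u u * B v v - B u v ^ 2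
  have hδ : δ ≠ 0 := by
    have : B u u * B v v < 0 := mul_neg_of_pos_of_neg hu hv
    have : 0 ≤ B u v ^ 2 := sq_nonneg _
    simp only [δ]
    linarith
  let T : V →ₗ[ℝ] V := δ • LinearMap.id - (B u u • B v - B u v • B u).smulRight v +
    (B u v • B v - B v v • B u).smulRight u
  have hT : ∀ y, T y = δ • y - (B u u * B v y - B u v * B u y) • v +
      (B u v * B v y - B v v * B u y) • u := fun y => rfl
  have hE : ∀ x y, B.compRight T x y = δ * B x y - (B u u * B v y - B u v * B u y) * B x v +
      (B u v * B v y - B v v * B u y) * B x u := fun x y => by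
    rw [LinearMap.BilinForm.compRight_apply, hT]
    simp
  refine ⟨B.compRight T, fun x y => ?_, fun w => ?_, fun h0 => ?_⟩
  · rw [hE, hE, hB y x, hB x v, hB x u, hB y v, hB y u]; ring
  · rw [hE, gram, hB w v, hB w u]; simp only [δ]; ring
  · have hT0 : ∀ y, T y = 0 := fun y => hnd _ fun x => by
      rw [← LinearMap.BilinForm.compRight_apply, h0]; rfl
    have htop : Submodule.span ℝ (Set.range ![u, v]) = ⊤ := by
      refine eq_top_iff.mpr fun y _ => ?_
      have hy : δ • y ∈ Submodule.span ℝ (Set.range ![u, v]) := by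
        have h1 : δ • y = (B u u * B v y - B u v * B u y) • v -
            (B u v * B v y - B v v * B u y) • u := by
          have := hT0 y
          rw [hT] at this
          rw [← sub_eq_zero, ← this]
          abel
        rw [h1]
        exact Submodule.sub_mem _
          (Submodule.smul_mem _ _ (Submodule.subset_span ⟨1, rfl⟩))
          (Submodule.smul_mem _ _ (Submodule.subset_span ⟨0, rfl⟩))
      exact (Submodule.smul_mem_iff _ hδ).mp hy
    have := finrank_range_le_card (R := ℝ) ![u, v]
    rw [Set.finrank, htop, finrank_top, Fintype.card_fin] at this
    omega

lemma exists_forall_quadratic_ne_zero {α : ℝ} (hα : α ≠ 0) (β γ : ℝ) :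
    ∃ N : ℕ, ∀ M : ℕ, N ≤ M → (M : ℝ) ^ 2 * α + 2 * M * β + γ ≠ 0 := by
  obtain ⟨N, hN⟩ := exists_nat_gt ((2 * |β| + |γ|) / |α|)
  refine ⟨N + 1, fun M hM h => ?_⟩
  have hα' : 0 < |α| := abs_pos.mpr hα
  rw [div_lt_iff₀ hα'] at hN
  have hM' : (N : ℝ) + 1 ≤ M := by exact_mod_cast hM
  have hN0 : (0 : ℝ) ≤ N := N.cast_nonneg
  have h1 : (M : ℝ) ^ 2 * |α| = |2 * M * β + γ| := by
    rw [← abs_neg (2 * M * β + γ), ← abs_of_nonneg (sq_nonneg (M : ℝ)), ← abs_mul]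
    congr 1
    linarith
  have h2 : |2 * M * β + γ| ≤ 2 * M * |β| + |γ| := by
    refine (abs_add_le _ _).trans (le_of_eq ?_)
    rw [abs_mul, abs_of_nonneg (by linarith : (0 : ℝ) ≤ 2 * M)]
  have h3 : (N : ℝ) * |α| ≤ M * |α| := by gcongr; linarith
  have h4 : |γ| ≤ M * |γ| := le_mul_of_one_le_left (abs_nonneg _) (by linarith)
  have h5 : (M : ℝ) * (2 * |β| + |γ|) < M * (M * |α|) :=
    mul_lt_mul_of_pos_left (by linarith) (by linarith)
  nlinarith

lemma forall_mem_of_forall_ne_zero {B E : LinearMap.BilinForm ℝ V} {ℓ : V →ₗ[ℝ] ℝ}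
    (hB : ∀ x y, B x y = B y x) (hE : ∀ x y, E x y = E y x) {Λ : AddSubgroup V}
    {R : Submodule ℚ ℝ} (h : ∀ w ∈ Λ, E w w ≠ 0 → B w w ∈ R ∧ ℓ w ∈ R)
    {w : V} (hw : w ∈ Λ) (hEw : E w w ≠ 0) {x : V} (hx : x ∈ Λ) : B x x ∈ R ∧ ℓ x ∈ R := by
  obtain ⟨N, hN⟩ := exists_forall_quadratic_ne_zero hEw (E w x) (E x x)
  have hR : ∀ (m : ℕ) {t : ℝ}, t ∈ R → (m : ℝ) * t ∈ R := fun m t ht => by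
    rw [← nsmul_eq_mul]; exact R.nsmul_mem ht m
  obtain ⟨hBw, hℓw⟩ := h w hw hEw
  have key : ∀ M : ℕ, N ≤ M → B x x + 2 * M * B w x ∈ R ∧ ℓ x ∈ R := fun M hM => by
    have hmem : (M : ℝ) • w + x ∈ Λ := by
      rw [Nat.cast_smul_eq_nsmul]
      exact Λ.add_mem (Λ.nsmul_mem hw M) hx
    obtain ⟨h1, h2⟩ := h _ hmem (by
      have := hN M hM
      simp only [map_add, map_smul, LinearMap.add_apply, LinearMap.smul_apply, smul_eq_mul, hE x w]
      convert this using 1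
      ring)
    constructor
    · have := R.sub_mem h1 (hR M (hR M hBw))
      convert this using 1
      simp only [map_add, map_smul, LinearMap.add_apply, LinearMap.smul_apply, smul_eq_mul, hB x w]
      ring
    · have := R.sub_mem h2 (hR M hℓw)
      convert this using 1
      simp
  refine ⟨?_, (key N le_rfl).2⟩
  have := R.sub_mem (hR (N + 1) (key N le_rfl).1) (hR N (key (N + 1) (by omega)).1)
  convert this using 1
  push_cast
  ring

lemma exists_mem_span_of_not_dense (B : LinearMap.BilinForm ℝ V) (hB : ∀ x y, B x y = B y x)
    (hnd : ∀ x, (∀ y, B y x = 0) → x = 0) (hdim : 2 < Module.finrank ℝ V) (ℓ : V →ₗ[ℝ] ℝ)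
    (k : ℝ) {Λ : AddSubgroup V} (hΛ : Submodule.span ℝ (Λ : Set V) = ⊤) {u v : V} (huΛ : u ∈ Λ)
    (hvΛ : v ∈ Λ) (hu : 0 < B u u) (hv : B v v < 0)
    (hdense : ¬ Dense {t | ∃ x ∈ Λ, B x x + ℓ x + k = t}) {x : V} (hx : x ∈ Λ) :
    B x x ∈ Submodule.span ℚ {B u u} ∧ ℓ x ∈ Submodule.span ℚ {B u u} := by
  obtain ⟨E, hE, hEg, hE0⟩ := exists_gram_form B hB hnd hdim hu hv
  obtain ⟨w, hw, hEw⟩ : ∃ w ∈ Λ, E w w ≠ 0 := by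
    by_contra! hcon
    exact hE0 (eq_zero_of_forall_self_eq_zero hΛ hE hcon)
  refine forall_mem_of_forall_ne_zero hB hE (fun w hw hEw => ?_) hw hEw hx
  obtain ⟨⟨s, hs⟩, ⟨s', hs'⟩⟩ := exists_ratio_of_not_dense (a := B u u) (b := B u v) (c := B u w)
    (d := B v v) (e := B v w) (f := B w w) (p := ℓ u / 2) (q := ℓ v / 2) (r := ℓ w / 2) (k := k)
    hu hv (by rw [hEg, gram] at hEw; exact hEw) (fun hcon => hdense (hcon.mono (by
      rintro t ⟨m, hm, rfl⟩
      refine ⟨m 0 • u + m 1 • v + m 2 • w, Λ.add_mem (Λ.add_mem (Λ.zsmul_mem huΛ _)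
        (Λ.zsmul_mem hvΛ _)) (Λ.zsmul_mem hw _), ?_⟩
      simp only [← Int.cast_smul_eq_zsmul ℝ, map_add, map_smul, LinearMap.add_apply,
        LinearMap.smul_apply, smul_eq_mul, hB v u, hB w u, hB w v]
      simp [qv, quadMat, dotProduct, Matrix.mulVec, Fin.sum_univ_four, hm]
      ring)))
  refine ⟨Submodule.mem_span_singleton.mpr ⟨s, by rw [hs, Rat.smul_def]⟩,
    Submodule.mem_span_singleton.mpr ⟨2 * s', ?_⟩⟩
  rw [Rat.smul_def]
  push_cast
  linarith

end Reduction

/-- The lattice of integer vectors. -/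
def intLattice (n : ℕ) : AddSubgroup (Fin n → ℝ) :=
  ((Int.castAddHom ℝ).compLeft (Fin n)).range

lemma toR_mem_intLattice {n : ℕ} (m : Fin n → ℤ) : toR m ∈ intLattice n := ⟨m, rfl⟩

lemma single_mem_intLattice {n : ℕ} (i : Fin n) : Pi.single i (1 : ℝ) ∈ intLattice n :=
  ⟨Pi.single i 1, by
    ext j
    by_cases h : j = i
    · subst h; simp
    · simp [h]⟩

lemma span_intLattice (n : ℕ) : Submodule.span ℝ (intLattice n : Set (Fin n → ℝ)) = ⊤ := by
  rw [eq_top_iff, ← (Pi.basisFun ℝ (Fin n)).span_eq]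
  refine Submodule.span_mono ?_
  rintro _ ⟨i, rfl⟩
  simpa using single_mem_intLattice i

lemma tendsto_floor_mul_natCast_div (y : ℝ) :
    Tendsto (fun N : ℕ => (⌊y * (N : ℝ)⌋ : ℝ) / (N : ℝ)) atTop (𝓝 y) := by
  have h : Tendsto (fun N : ℕ => Int.fract (y * (N : ℝ)) / (N : ℝ)) atTop (𝓝 0) :=
    squeeze_zero (fun N => div_nonneg (Int.fract_nonneg _) N.cast_nonneg)
      (fun N => div_le_div_of_nonneg_right (Int.fract_lt_one _).le N.cast_nonneg)
      tendsto_one_div_atTop_nhds_zero_nat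
  have h' := h.const_sub y
  rw [sub_zero] at h'
  refine h'.congr' ((eventually_ge_atTop 1).mono fun N hN => ?_)
  have hN0 : (N : ℝ) ≠ 0 := by exact_mod_cast (Nat.one_le_iff_ne_zero.mp hN)
  have := Int.floor_add_fract (y * (N : ℝ))
  field_simp
  linarith

/-- Integer vectors meet every nonempty open cone. -/
lemma exists_toR_mem_of_isOpen {n : ℕ} {f : (Fin n → ℝ) → ℝ} (hf : Continuous f)
    (hhom : ∀ (c : ℝ) x, f (c • x) = c ^ 2 * f x) {y : Fin n → ℝ} (hy : 0 < f y) :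
    ∃ m : Fin n → ℤ, 0 < f (toR m) := by
  have hlim : Tendsto (fun N : ℕ => fun i => (⌊(y i) * (N : ℝ)⌋ : ℝ) / (N : ℝ)) atTop (𝓝 y) :=
    tendsto_pi_nhds.mpr fun i => tendsto_floor_mul_natCast_div (y i)
  obtain ⟨N, hN, hN1⟩ := ((((hf.tendsto y).comp hlim).eventually (lt_mem_nhds hy)).and
    (eventually_ge_atTop 1)).exists
  have hN0 : (0 : ℝ) < N := by exact_mod_cast hN1
  refine ⟨fun i => ⌊(y i) * (N : ℝ)⌋, ?_⟩
  have : (toR fun i => ⌊(y i) * (N : ℝ)⌋) =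
      (N : ℝ) • fun i => (⌊(y i) * (N : ℝ)⌋ : ℝ) / (N : ℝ) := by
    ext i
    simp
    field_simp
  rw [this, hhom]
  exact mul_pos (by positivity) hN

end IrratQuad

/-- **Values of irrational quadratic polynomials (Corollary 8.3).**
Let `n ≥ 3` and let `q(y) = ∑_{i,j} a_{ij} yᵢ yⱼ + ∑_i bᵢ yᵢ + q₀` be a real
quadratic polynomial (with `a` symmetric) whose homogeneous part is
nondegenerate and indefinite, and which satisfies the irrationality
condition: `q(y) - q(0)` is not a real multiple of a rational polynomial.
Then `q(ℤⁿ)` is dense in `ℝ`. -/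
theorem irrational_quadratic_dense
    (n : ℕ) (hn : 3 ≤ n)
    (a : Matrix (Fin n) (Fin n) ℝ) (b : Fin n → ℝ) (q₀ : ℝ)
    (hsymm : ∀ i j, a i j = a j i)
    (hnd : a.det ≠ 0)
    (hindef : (∃ y : Fin n → ℝ, 0 < ∑ i, ∑ j, a i j * y i * y j) ∧
      (∃ y : Fin n → ℝ, (∑ i, ∑ j, a i j * y i * y j) < 0))
    (hirr : ¬ ∃ (t : ℝ) (a' : Matrix (Fin n) (Fin n) ℚ) (b' : Fin n → ℚ),
      (∀ i j, a i j = t * (a' i j : ℝ)) ∧ (∀ i, b i = t * (b' i : ℝ))) :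
    Dense {r : ℝ | ∃ y : Fin n → ℤ,
      (∑ i, ∑ j, a i j * (y i : ℝ) * (y j : ℝ)) +
        (∑ i, b i * (y i : ℝ)) + q₀ = r} := by
  set B := Matrix.toBilin' a with hBdef
  have hQ : ∀ y : Fin n → ℝ, B y y = ∑ i, ∑ j, a i j * y i * y j := fun y => by
    rw [hBdef, Matrix.toBilin'_apply]
    exact Finset.sum_congr rfl fun i _ => Finset.sum_congr rfl fun j _ => by ring
  have hB : ∀ x y, B x y = B y x := fun x y => by
    rw [hBdef, Matrix.toBilin'_apply, Matrix.toBilin'_apply, Finset.sum_comm]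
    exact Finset.sum_congr rfl fun i _ => Finset.sum_congr rfl fun j _ => by
      rw [hsymm i j]; ring
  have hcont : Continuous fun y : Fin n → ℝ => B y y := by
    simp only [hQ]; fun_prop
  have hhom : ∀ (c : ℝ) x, B (c • x) (c • x) = c ^ 2 * B x x := fun c x => by
    simp only [map_smul, LinearMap.smul_apply, smul_eq_mul]; ring
  obtain ⟨⟨y, hy⟩, ⟨z, hz⟩⟩ := hindef
  rw [← hQ] at hy hz
  obtain ⟨u, hu⟩ := IrratQuad.exists_toR_mem_of_isOpen hcont hhom hy
  obtain ⟨v, hv⟩ := IrratQuad.exists_toR_mem_of_isOpen (f := fun x => -B x x) hcont.neg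
    (fun c x => by rw [hhom]; ring) (neg_pos.mpr hz)
  let ℓ : (Fin n → ℝ) →ₗ[ℝ] ℝ := Fintype.linearCombination ℝ b
  have hℓ : ∀ x, ℓ x = ∑ i, b i * x i := fun x => by
    simp [ℓ, Fintype.linearCombination_apply, mul_comm]
  by_contra hdense
  have hnd' : ∀ x, (∀ y, B y x = 0) → x = 0 := fun x hx =>
    Matrix.eq_zero_of_mulVec_eq_zero hnd (dotProduct_eq_zero _ fun w => by
      rw [dotProduct_comm, ← Matrix.toBilin'_apply']
      exact hx w)
  have key := fun x hx => IrratQuad.exists_mem_span_of_not_dense B hB hnd' (by simp; omega) ℓ q₀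
    (IrratQuad.span_intLattice n) (IrratQuad.toR_mem_intLattice u)
    (IrratQuad.toR_mem_intLattice v) hu (neg_pos.mp hv) (fun h => hdense (h.mono (by
      rintro t ⟨_, ⟨m, rfl⟩, rfl⟩
      refine ⟨m, ?_⟩
      rw [hQ, hℓ]
      rfl))) (x := x) hx
  set R := Submodule.span ℚ {B (IrratQuad.toR u) (IrratQuad.toR u)} with hR
  have ha : ∀ i j, a i j ∈ R := fun i j => by
    have hi := IrratQuad.single_mem_intLattice i
    have hj := IrratQuad.single_mem_intLattice j
    have h1 := R.smul_mem (1 / 2 : ℚ) (R.sub_mem (R.sub_mem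
      (key _ ((IrratQuad.intLattice n).add_mem hi hj)).1 (key _ hi).1) (key _ hj).1)
    have h2 : B (Pi.single i 1) (Pi.single j 1) = a i j := Matrix.toBilin'_single a i j
    convert h1 using 1
    simp only [map_add, LinearMap.add_apply, hB (Pi.single j 1) (Pi.single i 1), h2, Rat.smul_def]
    push_cast
    ring
  have hb : ∀ i, b i ∈ R := fun i => by
    have := (key _ (IrratQuad.single_mem_intLattice i)).2
    simpa [hℓ, Pi.single_apply] using this
  simp only [hR, Submodule.mem_span_singleton, Rat.smul_def] at ha hb
  choose a' ha' using ha
  choose b' hb' using hb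
  exact hirr ⟨B (IrratQuad.toR u) (IrratQuad.toR u), a', b',
    fun i j => by rw [← ha', mul_comm], fun i => by rw [← hb', mul_comm]⟩
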